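/- Under hypotheses (H0)-(H4), for any a ∈ D̂∩∂₊D, any fixed z₀ ∈ ℤ^{d−1}×ℕ, and any sequence of points z_n ∈ ℤ^{d−1}×ℕ with lim_{n→∞} |z_n| = ∞ and lim_{n→∞} dist(V(a), z_n/|z_n|) = 0, one has lim_{n→∞} G(z,z_n)/G(z₀,z_n) = h_a(z)/h_a(z₀) for every z ∈ ℤ^{d−1}×ℕ. -/

import Mathlib

open scoped ENNReal
open Filter MeasureTheory

namespace ReflectedRW

/-- `ℤ^d` realized as `ℤ^{d-1} × ℤ`. -/
abbrev Zd (d : ℕ) := (Fin (d-1) → ℤ) × ℤ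
/-- `ℝ^d` realized as `ℝ^{d-1} × ℝ`. -/
abbrev Rd (d : ℕ) := (Fin (d-1) → ℝ) × ℝ
/-- The state space `ℤ^{d-1} × ℕ` of the reflected walk. -/
abbrev St (d : ℕ) := (Fin (d-1) → ℤ) × ℕ

/-- Embedding of the state space into `ℤ^d`. -/
def toZ (d : ℕ) (z : St d) : Zd d := (z.1, (z.2 : ℤ))

/-- Embedding of `ℤ^d` into `ℝ^d`. -/
def toR (d : ℕ) (z : Zd d) : Rd d := (fun i => (z.1 i : ℝ), (z.2 : ℝ))

/-- Scalar product `a · z` of `a ∈ ℝ^d` and `z ∈ ℤ^d`. -/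
noncomputable def dotZ (d : ℕ) (a : Rd d) (z : Zd d) : ℝ :=
  (∑ i, a.1 i * (z.1 i : ℝ)) + a.2 * (z.2 : ℝ)

/-- Scalar product on `ℝ^d`. -/
noncomputable def dotR (d : ℕ) (a q : Rd d) : ℝ :=
  (∑ i, a.1 i * q.1 i) + a.2 * q.2

/-- One-step transition probabilities of the reflected random walk `Z(t)`:
jumps with law `μ` in the interior and with law `μ0` on the boundary `y = 0`. -/
noncomputable def step (d : ℕ) (μ μ0 : Zd d → ℝ) (z z' : St d) : ℝ≥0∞ :=
  if z.2 = 0 then ENNReal.ofReal (μ0 (toZ d z' - toZ d z))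
  else ENNReal.ofReal (μ (toZ d z' - toZ d z))

/-- Real-valued version of the transition kernel of `Z(t)`. -/
noncomputable def stepR (d : ℕ) (μ μ0 : Zd d → ℝ) (z z' : St d) : ℝ :=
  if z.2 = 0 then μ0 (toZ d z' - toZ d z) else μ (toZ d z' - toZ d z)

/-- `n`-step kernel obtained by iterating a sub-Markov kernel `p`. -/
noncomputable def kerIter {S : Type*} [DecidableEq S] (p : S → S → ℝ≥0∞) :
    ℕ → S → S → ℝ≥0∞
  | 0, z, z' => if z = z' then 1 else 0
  | n+1, z, z' => ∑' w : S, kerIter p n z w * p w z'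

/-- `n`-step transition probabilities of `Z(t)`: `P_z(Z(n) = z')`. -/
noncomputable def stepn (d : ℕ) (μ μ0 : Zd d → ℝ) : ℕ → St d → St d → ℝ≥0∞ :=
  kerIter (step d μ μ0)

/-- Green's function `G(z,z') = ∑_{t ≥ 0} P_z(Z(t) = z')` of the reflected walk. -/
noncomputable def green (d : ℕ) (μ μ0 : Zd d → ℝ) (z z' : St d) : ℝ≥0∞ :=
  ∑' n : ℕ, stepn d μ μ0 n z z'

/-- Kernel of the walk killed upon hitting the boundary hyperplane `y = 0`. -/
noncomputable def stepKilled (d : ℕ) (μ μ0 : Zd d → ℝ) (z z' : St d) : ℝ≥0∞ :=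
  if z'.2 = 0 then 0 else step d μ μ0 z z'

/-- `n`-step kernel of the killed walk: `P_z(Z(n) = z', τ > n)` where
`τ` is the first return time to the boundary hyperplane. -/
noncomputable def stepKilledn (d : ℕ) (μ μ0 : Zd d → ℝ) : ℕ → St d → St d → ℝ≥0∞ :=
  kerIter (stepKilled d μ μ0)

/-- Green's function `G₊(z,z')` of the killed walk. -/
noncomputable def greenPlus (d : ℕ) (μ μ0 : Zd d → ℝ) (z z' : St d) : ℝ≥0∞ :=
  ∑' n : ℕ, stepKilledn d μ μ0 n z z'

/-- One-step kernel of the homogeneous random walk `S(t)` on `ℤ^d`. -/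
noncomputable def stepS (d : ℕ) (μ : Zd d → ℝ) (z z' : Zd d) : ℝ≥0∞ :=
  ENNReal.ofReal (μ (z' - z))

/-- `n`-step kernel of the homogeneous random walk on `ℤ^d`. -/
noncomputable def stepSn (d : ℕ) (μ : Zd d → ℝ) : ℕ → Zd d → Zd d → ℝ≥0∞ :=
  kerIter (stepS d μ)

/-- Green's function `G_S` of the homogeneous random walk on `ℤ^d`. -/
noncomputable def greenS (d : ℕ) (μ : Zd d → ℝ) (z z' : Zd d) : ℝ≥0∞ :=
  ∑' n : ℕ, stepSn d μ n z z'

/-- `hitProb z w = P_z(τ < ∞, Z(τ) = w)`, the hitting distribution on the boundary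
hyperplane, `τ = inf{t ≥ 1 : Z(t) ∈ ℤ^{d-1}×{0}}`. -/
noncomputable def hitProb (d : ℕ) (μ μ0 : Zd d → ℝ) (z w : St d) : ℝ≥0∞ :=
  if w.2 = 0 then
    ∑' n : ℕ, ∑' v : St d, stepKilledn d μ μ0 n z v * step d μ μ0 v w
  else 0

/-- The jump generating function `φ(a) = ∑_z μ(z) e^{a·z}`. -/
noncomputable def jgf (d : ℕ) (μ : Zd d → ℝ) (a : Rd d) : ℝ :=
  ∑' z : Zd d, μ z * Real.exp (dotZ d a z)

/-- Partial derivative `∂φ/∂β` of the jump generating function in the last coordinate. -/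
noncomputable def jgfDβ (d : ℕ) (μ : Zd d → ℝ) (a : Rd d) : ℝ :=
  ∑' z : Zd d, μ z * (z.2 : ℝ) * Real.exp (dotZ d a z)

/-- Gradient `∇φ(a)` of the jump generating function. -/
noncomputable def jgfGrad (d : ℕ) (μ : Zd d → ℝ) (a : Rd d) : Rd d :=
  (fun i => ∑' z : Zd d, μ z * (z.1 i : ℝ) * Real.exp (dotZ d a z), jgfDβ d μ a)

/-- The set `D = {a : φ(a) ≤ 1}`. -/
def Dset (d : ℕ) (μ : Zd d → ℝ) : Set (Rd d) := {a | jgf d μ a ≤ 1}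

/-- `∂₊D`: points of the boundary of `D` where the last coordinate of `∇φ` is `≥ 0`. -/
def bdPlus (d : ℕ) (μ : Zd d → ℝ) : Set (Rd d) :=
  {a | jgf d μ a = 1 ∧ 0 ≤ jgfDβ d μ a}

/-- `∂₋D`: points of the boundary of `D` where the last coordinate of `∇φ` is `≤ 0`. -/
def bdMinus (d : ℕ) (μ : Zd d → ℝ) : Set (Rd d) :=
  {a | jgf d μ a = 1 ∧ jgfDβ d μ a ≤ 0}

/-- `∂₀D`: points of the boundary of `D` where the last coordinate of `∇φ` is `0`. -/
def bdZero (d : ℕ) (μ : Zd d → ℝ) : Set (Rd d) :=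
  {a | jgf d μ a = 1 ∧ jgfDβ d μ a = 0}

/-- `Θ = {α ∈ ℝ^{d-1} : inf_β max(φ(α,β), φ₀(α,β)) ≤ 1}`. -/
noncomputable def Theta (d : ℕ) (μ μ0 : Zd d → ℝ) : Set (Fin (d-1) → ℝ) :=
  {α | (⨅ β : ℝ, max (jgf d μ (α, β)) (jgf d μ0 (α, β))) ≤ 1}

/-- `D̂ = (Θ×ℝ) ∩ D`. -/
noncomputable def Dhat (d : ℕ) (μ μ0 : Zd d → ℝ) : Set (Rd d) :=
  {a | a.1 ∈ Theta d μ μ0 ∧ jgf d μ a ≤ 1}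

/-- Normal cone to a convex set `s ⊆ ℝ^d` at the point `a`. -/
noncomputable def normalCone (d : ℕ) (s : Set (Rd d)) (a : Rd d) : Set (Rd d) :=
  {q | ∀ b ∈ s, dotR d q (b - a) ≤ 0}

/-- The mean vector `m = ∑_z z μ(z)`. -/
noncomputable def meanVec (d : ℕ) (μ : Zd d → ℝ) : Rd d :=
  (fun i => ∑' z : Zd d, μ z * (z.1 i : ℝ), ∑' z : Zd d, μ z * (z.2 : ℝ))

/-- The harmonic functions `h_a` of (1-8), for `a ∈ D̂ ∩ ∂₊D` with associated
point `abar = ā ∈ ∂₋D` (same first `d-1` coordinates as `a`). -/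
noncomputable def hfun (d : ℕ) (μ μ0 : Zd d → ℝ) (a abar : Rd d) (z : St d) : ℝ :=
  if jgf d μ0 abar = 1 then Real.exp (dotZ d abar (toZ d z))
  else if a = abar then
    (z.2 : ℝ) * Real.exp (dotZ d a (toZ d z))
      + (jgfDβ d μ0 a / (1 - jgf d μ0 a)) * Real.exp (dotZ d a (toZ d z))
  else
    Real.exp (dotZ d a (toZ d z))
      - ((1 - jgf d μ0 a) / (1 - jgf d μ0 abar)) * Real.exp (dotZ d abar (toZ d z))

/-- `h : ℤ^{d-1}×ℕ → ℝ` is harmonic for the reflected walk. -/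
def IsHarmonic (d : ℕ) (μ μ0 : Zd d → ℝ) (h : St d → ℝ) : Prop :=
  ∀ z : St d, HasSum (fun z' => stepR d μ μ0 z z' * h z') (h z)

/-- Minimal nonnegative harmonic function. -/
def IsMinimalHarmonic (d : ℕ) (μ μ0 : Zd d → ℝ) (h : St d → ℝ) : Prop :=
  IsHarmonic d μ μ0 h ∧ (∀ z, 0 ≤ h z) ∧ h ≠ 0 ∧
    ∀ h' : St d → ℝ, IsHarmonic d μ μ0 h' → (∀ z, 0 ≤ h' z) → h' ≠ 0 →
      (∀ z, h' z ≤ h z) → ∃ c : ℝ, 0 < c ∧ h' = fun z => c * h z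

/- Hypotheses (H0)–(H4). -/

/-- `(H0)`: `μ(x,y) = 0` for `y < -1` and `μ₀(x,y) = 0` for `y < 0`. -/
def H0 (d : ℕ) (μ μ0 : Zd d → ℝ) : Prop :=
  (∀ z : Zd d, z.2 < -1 → μ z = 0) ∧ (∀ z : Zd d, z.2 < 0 → μ0 z = 0)

/-- `(H1)`: the reflected walk is irreducible on `ℤ^{d-1}×ℕ`. -/
def H1 (d : ℕ) (μ μ0 : Zd d → ℝ) : Prop :=
  ∀ z z' : St d, ∃ n : ℕ, 0 < stepn d μ μ0 n z z'

/-- `(H2)`: the homogeneous walk with step law `μ` is irreducible on `ℤ^d` and its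
last coordinate is an aperiodic random walk on `ℤ`. -/
def H2 (d : ℕ) (μ : Zd d → ℝ) : Prop :=
  (∀ z z' : Zd d, ∃ n : ℕ, 0 < stepSn d μ n z z') ∧
    AddSubgroup.closure {y : ℤ | ∃ x : Fin (d-1) → ℤ, μ (x, y) ≠ 0} = ⊤

/-- `(H3)`: `m ≠ 0` and `m/|m| + m₀/|m₀| ≠ 0`. -/
noncomputable def H3 (d : ℕ) (μ μ0 : Zd d → ℝ) : Prop :=
  meanVec d μ ≠ 0 ∧ meanVec d μ0 ≠ 0 ∧
    ‖meanVec d μ‖⁻¹ • meanVec d μ + ‖meanVec d μ0‖⁻¹ • meanVec d μ0 ≠ 0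

/-- `(H4)`: the jump generating functions are finite everywhere on `ℝ^d`. -/
def H4 (d : ℕ) (μ μ0 : Zd d → ℝ) : Prop :=
  ∀ a : Rd d, Summable (fun z : Zd d => μ z * Real.exp (dotZ d a z)) ∧
    Summable (fun z : Zd d => μ0 z * Real.exp (dotZ d a z))

/-- `μ` is a probability distribution on `ℤ^d`. -/
def IsProb (d : ℕ) (μ : Zd d → ℝ) : Prop :=
  (∀ z : Zd d, 0 ≤ μ z) ∧ HasSum μ 1

section Operators

/-- The positive linear operator `f ↦ (z ↦ ∑' z', p z z' * f z')` attached to a kernel. -/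
noncomputable def kerOp {S : Type*} (p : S → S → ℝ≥0∞) : Module.End ℝ≥0∞ (S → ℝ≥0∞) where
  toFun f z := ∑' z', p z z' * f z'
  map_add' f g := by
    funext z
    simp only [Pi.add_apply, mul_add]
    exact ENNReal.tsum_add
  map_smul' c f := by
    funext z
    simp only [Pi.smul_apply, smul_eq_mul, RingHom.id_apply]
    rw [← ENNReal.tsum_mul_left]
    exact tsum_congr fun z' => by ring

lemma kerOp_apply {S : Type*} (p : S → S → ℝ≥0∞) (f : S → ℝ≥0∞) (z : S) :
    kerOp p f z = ∑' z', p z z' * f z' := rfl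

lemma kerOp_mono {S : Type*} (p : S → S → ℝ≥0∞) : Monotone (kerOp p) := by
  intro f g h z
  exact ENNReal.tsum_le_tsum fun z' => by gcongr; exact h z'

lemma monotone_pow {S : Type*} {A : Module.End ℝ≥0∞ (S → ℝ≥0∞)} (hA : Monotone A) (n : ℕ) :
    Monotone (A ^ n) := by
  rw [Module.End.coe_pow]
  exact hA.iterate n

lemma pow_apply_le_smul {S : Type*} {A : Module.End ℝ≥0∞ (S → ℝ≥0∞)} (hA : Monotone A)
    {f : S → ℝ≥0∞} {c : ℝ≥0∞} (h : A f ≤ c • f) (n : ℕ) : (A ^ n) f ≤ c ^ n • f := by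
  induction n with
  | zero => simp
  | succ n ih =>
    rw [pow_succ', Module.End.mul_apply]
    calc A ((A ^ n) f) ≤ A (c ^ n • f) := hA ih
      _ = c ^ n • A f := map_smul _ _ _
      _ ≤ c ^ n • c • f := by
          intro z
          have := h z
          simp only [Pi.smul_apply, smul_eq_mul] at *
          gcongr
      _ = c ^ (n + 1) • f := by rw [smul_smul, pow_succ]

lemma le_pow_apply {S : Type*} {A : Module.End ℝ≥0∞ (S → ℝ≥0∞)} (hA : Monotone A)
    {f : S → ℝ≥0∞} (h : f ≤ A f) (n : ℕ) : f ≤ (A ^ n) f := by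
  induction n with
  | zero => simp
  | succ n ih =>
    rw [pow_succ', Module.End.mul_apply]
    exact h.trans (hA ih)

lemma kerOp_tsum {S ι : Type*} (p : S → S → ℝ≥0∞) (f : ι → S → ℝ≥0∞) :
    kerOp p (fun z => ∑' i, f i z) = fun z => ∑' i, kerOp p (f i) z := by
  funext z
  simp only [kerOp_apply, ← ENNReal.tsum_mul_left]
  exact ENNReal.tsum_comm

lemma kerOp_pow_apply {S : Type*} [DecidableEq S] (p : S → S → ℝ≥0∞) (n : ℕ)
    (f : S → ℝ≥0∞) (z : S) : (kerOp p ^ n) f z = ∑' w, kerIter p n z w * f w := by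
  induction n generalizing f with
  | zero =>
    simp only [pow_zero, Module.End.one_apply, kerIter, ite_mul, one_mul, zero_mul]
    rw [tsum_eq_single z (fun w hw => if_neg (Ne.symm hw)), if_pos rfl]
  | succ n ih =>
    rw [pow_succ, Module.End.mul_apply, ih]
    simp only [kerOp_apply, kerIter, ← ENNReal.tsum_mul_left, ← ENNReal.tsum_mul_right]
    rw [ENNReal.tsum_comm]
    exact tsum_congr fun w => tsum_congr fun v => by ring

lemma kerIter_eq_pow {S : Type*} [DecidableEq S] (p : S → S → ℝ≥0∞) (n : ℕ) (z z' : S) :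
    kerIter p n z z' = (kerOp p ^ n) (Pi.single z' 1) z := by
  rw [kerOp_pow_apply, tsum_eq_single z']
  · simp
  · intro w hw
    simp [Pi.single_eq_of_ne hw]

lemma kerOp_single {S : Type*} [DecidableEq S] (p : S → S → ℝ≥0∞) (z z' : S) :
    kerOp p (Pi.single z' 1) z = p z z' := by
  rw [kerOp_apply, tsum_eq_single z']
  · simp
  · intro w hw
    simp [Pi.single_eq_of_ne hw]

lemma kerIter_mul_le_pow {S : Type*} [DecidableEq S] (p : S → S → ℝ≥0∞) (n : ℕ) (z z' : S)
    (f : S → ℝ≥0∞) : kerIter p n z z' * f z' ≤ (kerOp p ^ n) f z := by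
  rw [kerOp_pow_apply]
  exact ENNReal.le_tsum (f := fun w => kerIter p n z w * f w) z'

lemma kerIter_add {S : Type*} [DecidableEq S] (p : S → S → ℝ≥0∞) (m n : ℕ) (z z' : S) :
    kerIter p (m + n) z z' = ∑' w, kerIter p m z w * kerIter p n w z' := by
  rw [kerIter_eq_pow, pow_add, Module.End.mul_apply, kerOp_pow_apply]
  exact tsum_congr fun w => by rw [kerIter_eq_pow p n]

lemma kerIter_mul_le {S : Type*} [DecidableEq S] (p : S → S → ℝ≥0∞) (m n : ℕ) (z w z' : S) :
    kerIter p m z w * kerIter p n w z' ≤ kerIter p (m + n) z z' := by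
  rw [kerIter_add]
  exact ENNReal.le_tsum (f := fun w => kerIter p m z w * kerIter p n w z') w

lemma kerIter_one {S : Type*} [DecidableEq S] (p : S → S → ℝ≥0∞) (z z' : S) :
    kerIter p 1 z z' = p z z' := by
  rw [kerIter_eq_pow, pow_one, kerOp_single]

lemma kerIter_equivariant {S : Type*} [DecidableEq S] (p : S → S → ℝ≥0∞) (e : S ≃ S)
    (hp : ∀ z z', p (e z) (e z') = p z z') (n : ℕ) (z z' : S) :
    kerIter p n (e z) (e z') = kerIter p n z z' := by
  induction n generalizing z' with
  | zero => simp [kerIter]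
  | succ n ih =>
    simp only [kerIter]
    rw [← e.tsum_eq]
    exact tsum_congr fun w => by rw [ih, hp]

/-- The kernel sum `∑ n, p ^ n`. -/
noncomputable def kerGreen {S : Type*} [DecidableEq S] (p : S → S → ℝ≥0∞) (z z' : S) : ℝ≥0∞ :=
  ∑' n, kerIter p n z z'

lemma kerIter_mul_kerGreen_le {S : Type*} [DecidableEq S] (p : S → S → ℝ≥0∞) (m : ℕ)
    (z w z' : S) : kerIter p m z w * kerGreen p w z' ≤ kerGreen p z z' := by
  unfold kerGreen
  rw [← ENNReal.tsum_mul_left]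
  calc ∑' n, kerIter p m z w * kerIter p n w z' ≤ ∑' n, kerIter p (m + n) z z' :=
        ENNReal.tsum_le_tsum fun n => kerIter_mul_le p m n z w z'
    _ ≤ ∑' n, kerIter p n z z' :=
        ENNReal.tsum_comp_le_tsum_of_injective (add_right_injective m)
          (fun n => kerIter p n z z')

lemma kerIter_le_kerGreen {S : Type*} [DecidableEq S] (p : S → S → ℝ≥0∞) (m : ℕ)
    (z z' : S) : kerIter p m z z' ≤ kerGreen p z z' :=
  ENNReal.le_tsum (f := fun n => kerIter p n z z') m

/-- The Poisson equation for the potential `∑ n, p ^ n ψ`. -/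
lemma potential_eq {S : Type*} (A : Module.End ℝ≥0∞ (S → ℝ≥0∞)) (ψ : S → ℝ≥0∞) (z : S)
    (hA : ∀ f : ℕ → S → ℝ≥0∞, A (fun z => ∑' i, f i z) = fun z => ∑' i, A (f i) z) :
    ∑' n, (A ^ n) ψ z = ψ z + A (fun z => ∑' n, (A ^ n) ψ z) z := by
  have h : A (fun z => ∑' n, (A ^ n) ψ z) z = ∑' n, A ((A ^ n) ψ) z :=
    congrFun (hA (fun n => (A ^ n) ψ)) z
  rw [h, tsum_eq_zero_add' ENNReal.summable]
  simp only [pow_zero, Module.End.one_apply, pow_succ', Module.End.mul_apply]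

lemma kerGreen_eq {S : Type*} [DecidableEq S] (p : S → S → ℝ≥0∞) (z z' : S) :
    kerGreen p z z' = (if z = z' then 1 else 0) + ∑' w, p z w * kerGreen p w z' := by
  have h := potential_eq (kerOp p) (Pi.single z' 1) z (fun f => kerOp_tsum p f)
  simp only [← kerIter_eq_pow] at h
  unfold kerGreen
  rw [h, kerOp_apply]
  congr 1
  simp [Pi.single_apply]

/-- A solution of `u = ψ + A u` with vanishing remainder is the potential of `ψ`. -/
lemma eq_potential {S : Type*} (A : Module.End ℝ≥0∞ (S → ℝ≥0∞)) {u ψ : S → ℝ≥0∞}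
    (hu : u = ψ + A u) (z : S)
    (h0 : Tendsto (fun n => (A ^ n) u z) atTop (nhds 0)) :
    u z = ∑' n, (A ^ n) ψ z := by
  have h1 : ∀ n, u z = ∑ i ∈ Finset.range n, (A ^ i) ψ z + (A ^ n) u z := by
    intro n
    induction n with
    | zero => simp
    | succ n ih =>
      rw [Finset.sum_range_succ, add_assoc, pow_succ, Module.End.mul_apply, ← Pi.add_apply,
        ← map_add, ← hu]
      exact ih
  have h2 := (ENNReal.tendsto_nat_tsum (fun n => (A ^ n) ψ z)).add h0
  rw [add_zero] at h2
  exact tendsto_nhds_unique (tendsto_const_nhds.congr h1) h2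

end Operators

section GeneratingFunctions

lemma dotZ_add_left (d : ℕ) (a b : Rd d) (z : Zd d) :
    dotZ d (a + b) z = dotZ d a z + dotZ d b z := by
  simp only [dotZ, Prod.fst_add, Prod.snd_add, Pi.add_apply, add_mul, Finset.sum_add_distrib]
  ring

lemma dotZ_smul_left (d : ℕ) (c : ℝ) (a : Rd d) (z : Zd d) :
    dotZ d (c • a) z = c * dotZ d a z := by
  simp only [dotZ, Prod.smul_fst, Prod.smul_snd, Pi.smul_apply, smul_eq_mul, mul_add,
    Finset.mul_sum, mul_assoc]

lemma dotZ_add_right (d : ℕ) (a : Rd d) (z w : Zd d) :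
    dotZ d a (z + w) = dotZ d a z + dotZ d a w := by
  simp only [dotZ, Prod.fst_add, Prod.snd_add, Pi.add_apply, Int.cast_add, mul_add,
    Finset.sum_add_distrib]
  ring

lemma dotZ_sub_right (d : ℕ) (a : Rd d) (z w : Zd d) :
    dotZ d a (z - w) = dotZ d a z - dotZ d a w := by
  have := dotZ_add_right d a (z - w) w
  rw [sub_add_cancel] at this
  linarith

lemma dotZ_zero_left (d : ℕ) (z : Zd d) : dotZ d 0 z = 0 := by
  simp [dotZ]

lemma dotZ_zero_right (d : ℕ) (a : Rd d) : dotZ d a 0 = 0 := by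
  simp [dotZ]

lemma abs_dotR_le (d : ℕ) (hd : 1 ≤ d) (v q : Rd d) :
    |dotR d v q| ≤ d * (‖v‖ * ‖q‖) := by
  have h1 : ∀ i, |v.1 i * q.1 i| ≤ ‖v‖ * ‖q‖ := by
    intro i
    rw [abs_mul]
    have h1 : |v.1 i| ≤ ‖v‖ := (norm_le_pi_norm v.1 i).trans (norm_fst_le v)
    have h2 : |q.1 i| ≤ ‖q‖ :=
      (norm_le_pi_norm q.1 i).trans (norm_fst_le q)
    gcongr
  have h2 : |v.2 * q.2| ≤ ‖v‖ * ‖q‖ := by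
    rw [abs_mul]
    have h1 : |v.2| ≤ ‖v‖ := norm_snd_le v
    have h2 : |q.2| ≤ ‖q‖ := norm_snd_le q
    gcongr
  calc |dotR d v q| ≤ |∑ i, v.1 i * q.1 i| + |v.2 * q.2| := abs_add_le _ _
    _ ≤ ∑ i, |v.1 i * q.1 i| + ‖v‖ * ‖q‖ := by
        gcongr
        exact Finset.abs_sum_le_sum_abs _ _
    _ ≤ ∑ _i : Fin (d - 1), ‖v‖ * ‖q‖ + ‖v‖ * ‖q‖ := by
        gcongr with i
        exact h1 i
    _ = d * (‖v‖ * ‖q‖) := by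
        obtain ⟨k, rfl⟩ : ∃ k, d = k + 1 := ⟨d - 1, by omega⟩
        simp only [Finset.sum_const, Finset.card_univ, Fintype.card_fin, nsmul_eq_mul]
        push_cast [Nat.add_sub_cancel]
        ring

lemma abs_dotZ_le (d : ℕ) (hd : 1 ≤ d) (v : Rd d) (z : Zd d) :
    |dotZ d v z| ≤ d * (‖v‖ * ‖toR d z‖) :=
  abs_dotR_le d hd v (toR d z)

/-- The signed coordinate vectors. -/
noncomputable def dirVec (d : ℕ) : (Fin (d - 1) ⊕ Unit) × Bool → Rd d
  | (Sum.inl i, true) => (Pi.single i 1, 0)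
  | (Sum.inl i, false) => (Pi.single i (-1), 0)
  | (Sum.inr _, true) => (0, 1)
  | (Sum.inr _, false) => (0, -1)

lemma norm_dirVec_le (d : ℕ) (s) : ‖dirVec d s‖ ≤ 1 := by
  have h : ∀ (i : Fin (d - 1)) (c : ℝ), |c| ≤ 1 → ‖(Pi.single i c : Fin (d - 1) → ℝ)‖ ≤ 1 := by
    intro i c hc
    refine (pi_norm_le_iff_of_nonneg zero_le_one).2 fun j => ?_
    by_cases hj : j = i
    · subst hj; simpa using hc
    · simp [Pi.single_eq_of_ne hj]
  rcases s with ⟨i | u, _ | _⟩ <;> simp [dirVec, Prod.norm_def] <;> exact h _ _ (by simp)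

lemma exists_dirVec (d : ℕ) (z : Zd d) : ∃ s, dotZ d (dirVec d s) z = ‖toR d z‖ := by
  have hsum : ∀ (i : Fin (d - 1)) (c : ℝ),
      ∑ j, (Pi.single i c : Fin (d - 1) → ℝ) j * (z.1 j : ℝ) = c * z.1 i := by
    intro i c
    rw [Finset.sum_eq_single i]
    · simp
    · intro j _ hj; simp [Pi.single_eq_of_ne hj]
    · simp
  rcases le_total ‖(toR d z).1‖ ‖(toR d z).2‖ with h | h
  · rw [Prod.norm_def, max_eq_right h, Real.norm_eq_abs]
    rcases abs_cases (toR d z).2 with ⟨h', _⟩ | ⟨h', _⟩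
    · exact ⟨(Sum.inr (), true), by rw [h']; simp [dirVec, dotZ, toR]⟩
    · exact ⟨(Sum.inr (), false), by rw [h']; simp [dirVec, dotZ, toR]⟩
  · rw [Prod.norm_def, max_eq_left h]
    rcases isEmpty_or_nonempty (Fin (d - 1)) with he | he
    · have h1 : ‖(toR d z).1‖ = 0 := by
        rw [Subsingleton.elim (toR d z).1 0, norm_zero]
      have h2 : (toR d z).2 = 0 := by
        rw [h1] at h
        exact norm_le_zero_iff.1 h
      refine ⟨(Sum.inr (), true), ?_⟩
      rw [h1]
      simp only [toR] at h2
      simp [dirVec, dotZ, h2]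
    · obtain ⟨i, hi⟩ : ∃ i, ‖(toR d z).1‖ = ‖(toR d z).1 i‖ := by
        obtain ⟨i, hi⟩ := Finite.exists_max fun i => ‖(toR d z).1 i‖
        exact ⟨i, le_antisymm ((pi_norm_le_iff_of_nonneg (norm_nonneg _)).2 hi)
          (norm_le_pi_norm _ i)⟩
      rw [hi, Real.norm_eq_abs]
      rcases abs_cases ((toR d z).1 i) with ⟨h', _⟩ | ⟨h', _⟩
      · exact ⟨(Sum.inl i, true), by rw [h']; simp [dirVec, dotZ, toR, hsum]⟩
      · exact ⟨(Sum.inl i, false), by rw [h']; simp [dirVec, dotZ, toR, hsum]⟩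

lemma summable_mul_exp_norm {d : ℕ} {μ : Zd d → ℝ} (hμ : ∀ z, 0 ≤ μ z)
    (hs : ∀ a : Rd d, Summable fun z => μ z * Real.exp (dotZ d a z)) (a : Rd d) (M : ℝ) :
    Summable fun z => μ z * Real.exp (dotZ d a z) * Real.exp (M * ‖toR d z‖) := by
  have h : Summable fun z => ∑ s, μ z * Real.exp (dotZ d (a + M • dirVec d s) z) :=
    summable_sum fun s _ => hs _
  refine Summable.of_nonneg_of_le (fun z => ?_) (fun z => ?_) h
  · have := hμ z
    positivity
  · obtain ⟨s, hs⟩ := exists_dirVec d z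
    refine le_trans (le_of_eq ?_) (Finset.single_le_sum (f := fun s =>
      μ z * Real.exp (dotZ d (a + M • dirVec d s) z)) (fun s _ => ?_) (Finset.mem_univ s))
    · rw [dotZ_add_left, dotZ_smul_left, hs, Real.exp_add]
      ring
    · exact mul_nonneg (hμ z) (Real.exp_pos _).le

lemma abs_exp_sub_one_le {t u U : ℝ} (ht0 : 0 ≤ t) (ht : t ≤ 1) (hu : |u| ≤ t * U) :
    |Real.exp u - 1| ≤ t * Real.exp U := by
  have h1 : |Real.exp u - 1| ≤ Real.exp |u| - 1 := by
    rcases le_total 0 u with h | h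
    · rw [abs_of_nonneg h, abs_of_nonneg (by linarith [Real.add_one_le_exp u])]
    · rw [abs_of_nonpos h, abs_of_nonpos (by linarith [Real.exp_le_one_iff.2 h])]
      have h3 := Real.add_one_le_exp u
      have h4 := Real.add_one_le_exp (-u)
      linarith
  have h2 : Real.exp (t * U) ≤ t * Real.exp U + (1 - t) := by
    have := convexOn_exp.2 (Set.mem_univ U) (Set.mem_univ 0) ht0 (sub_nonneg.2 ht) (by ring)
    simpa using this
  have h3 : Real.exp |u| ≤ Real.exp (t * U) := Real.exp_le_exp.2 hu
  linarith

lemma abs_jgf_sub_le {d : ℕ} (hd : 1 ≤ d) {μ : Zd d → ℝ} (hμ : ∀ z, 0 ≤ μ z)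
    (hs : ∀ a : Rd d, Summable fun z => μ z * Real.exp (dotZ d a z)) (a : Rd d) :
    ∃ C : ℝ, 0 ≤ C ∧ ∀ (t : ℝ) (v : Rd d), 0 ≤ t → t ≤ 1 → ‖v‖ ≤ t →
      |jgf d μ (a + v) - jgf d μ a| ≤ t * C := by
  have hS := summable_mul_exp_norm hμ hs a d
  refine ⟨∑' z, μ z * Real.exp (dotZ d a z) * Real.exp (d * ‖toR d z‖),
    tsum_nonneg fun z => ?_, fun t v ht0 ht hv => ?_⟩
  · have := hμ z
    positivity
  · rw [jgf, jgf, ← (hs (a + v)).tsum_sub (hs a), ← tsum_mul_left]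
    have hle : ∀ z, |μ z * Real.exp (dotZ d (a + v) z) - μ z * Real.exp (dotZ d a z)| ≤
        t * (μ z * Real.exp (dotZ d a z) * Real.exp (d * ‖toR d z‖)) := by
      intro z
      have h1 : |dotZ d v z| ≤ t * (d * ‖toR d z‖) := by
        refine (abs_dotZ_le d hd v z).trans ?_
        calc (d : ℝ) * (‖v‖ * ‖toR d z‖) ≤ d * (t * ‖toR d z‖) := by gcongr
          _ = _ := by ring
      have h2 := abs_exp_sub_one_le ht0 ht h1
      have h3 : μ z * Real.exp (dotZ d (a + v) z) - μ z * Real.exp (dotZ d a z) =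
          μ z * Real.exp (dotZ d a z) * (Real.exp (dotZ d v z) - 1) := by
        rw [dotZ_add_left, Real.exp_add]; ring
      have h4 : 0 ≤ μ z * Real.exp (dotZ d a z) := mul_nonneg (hμ z) (Real.exp_pos _).le
      rw [h3, abs_mul, abs_of_nonneg h4]
      calc _ ≤ μ z * Real.exp (dotZ d a z) * (t * Real.exp (d * ‖toR d z‖)) := by gcongr
        _ = _ := by ring
    have hS' := hS.mul_left t
    have := ((hs (a + v)).sub (hs a))
    have habs : Summable fun z => |μ z * Real.exp (dotZ d (a + v) z) -
      μ z * Real.exp (dotZ d a z)| := this.abs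
    calc _ ≤ ∑' z, |μ z * Real.exp (dotZ d (a + v) z) - μ z * Real.exp (dotZ d a z)| := by
          have := norm_tsum_le_tsum_norm (f := fun z => μ z * Real.exp (dotZ d (a + v) z) -
            μ z * Real.exp (dotZ d a z)) habs
          simpa [Real.norm_eq_abs] using this
      _ ≤ _ := habs.tsum_le_tsum hle hS'

lemma continuous_jgf {d : ℕ} (hd : 1 ≤ d) {μ : Zd d → ℝ} (hμ : ∀ z, 0 ≤ μ z)
    (hs : ∀ a : Rd d, Summable fun z => μ z * Real.exp (dotZ d a z)) :
    Continuous (jgf d μ) := by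
  refine continuous_iff_continuousAt.2 fun a => ?_
  obtain ⟨C, hC, h⟩ := abs_jgf_sub_le hd hμ hs a
  rw [ContinuousAt, tendsto_iff_dist_tendsto_zero]
  have h0 : Tendsto (fun b : Rd d => ‖b - a‖ * C) (nhds a) (nhds 0) := by
    have : Continuous fun b : Rd d => ‖b - a‖ * C := by fun_prop
    simpa using this.tendsto a
  refine squeeze_zero' (Eventually.of_forall fun _ => dist_nonneg) ?_ h0
  filter_upwards [Metric.ball_mem_nhds a zero_lt_one] with b hb
  rw [Metric.mem_ball, dist_eq_norm] at hb
  have := h ‖b - a‖ (b - a) (norm_nonneg _) hb.le le_rfl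
  rwa [add_sub_cancel] at this

end GeneratingFunctions

/-- The standing assumptions on the reflected walk. -/
structure Assumptions (d : ℕ) (μ μ0 : Zd d → ℝ) : Prop where
  two_le : 2 ≤ d
  prob : IsProb d μ
  prob0 : IsProb d μ0
  h0 : H0 d μ μ0
  h1 : H1 d μ μ0
  h2 : H2 d μ
  h3 : H3 d μ μ0
  h4 : H4 d μ μ0

namespace Assumptions

variable {d : ℕ} {μ μ0 : Zd d → ℝ}

lemma one_le (H : Assumptions d μ μ0) : 1 ≤ d := one_le_two.trans H.two_le

lemma summable (H : Assumptions d μ μ0) (a : Rd d) :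
    Summable fun z => μ z * Real.exp (dotZ d a z) := (H.h4 a).1

lemma summable0 (H : Assumptions d μ μ0) (a : Rd d) :
    Summable fun z => μ0 z * Real.exp (dotZ d a z) := (H.h4 a).2

lemma continuous (H : Assumptions d μ μ0) : Continuous (jgf d μ) :=
  continuous_jgf H.one_le H.prob.1 H.summable

lemma continuous0 (H : Assumptions d μ μ0) : Continuous (jgf d μ0) :=
  continuous_jgf H.one_le H.prob0.1 H.summable0

end Assumptions

lemma jgf_nonneg {d : ℕ} {μ : Zd d → ℝ} (hμ : ∀ z, 0 ≤ μ z) (a : Rd d) : 0 ≤ jgf d μ a :=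
  tsum_nonneg fun z => mul_nonneg (hμ z) (Real.exp_pos _).le

section Transfer

lemma toZ_injective (d : ℕ) : Function.Injective (toZ d) := by
  intro z z' h
  simp only [toZ, Prod.mk.injEq, Nat.cast_inj] at h
  exact Prod.ext h.1 h.2

lemma toZ_sub_injective (d : ℕ) (z : St d) : Function.Injective fun z' => toZ d z' - toZ d z :=
  fun _ _ h => toZ_injective d (sub_left_injective h)

lemma exists_toZ_sub (d : ℕ) (z : St d) (w : Zd d) (hw : -(z.2 : ℤ) ≤ w.2) :
    ∃ z' : St d, toZ d z' - toZ d z = w :=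
  ⟨(z.1 + w.1, ((z.2 : ℤ) + w.2).toNat), by
    refine Prod.ext ?_ ?_
    · simp [toZ]
    · simp only [toZ, Prod.snd_sub]
      omega⟩

lemma tsum_toZ_sub_le (d : ℕ) (z : St d) (F : Zd d → ℝ≥0∞) :
    ∑' z' : St d, F (toZ d z' - toZ d z) ≤ ∑' w, F w :=
  ENNReal.tsum_comp_le_tsum_of_injective (toZ_sub_injective d z) F

lemma eq_zero_of_notMem_range {M : Type*} [Zero M] (d : ℕ) (z : St d) (F : Zd d → M)
    (hF : ∀ w : Zd d, w.2 < -(z.2 : ℤ) → F w = 0) (w : Zd d)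
    (hw : w ∉ Set.range fun z' => toZ d z' - toZ d z) : F w = 0 := by
  refine hF w (lt_of_not_ge fun h => hw ?_)
  obtain ⟨z', hz'⟩ := exists_toZ_sub d z w h
  exact ⟨z', hz'⟩

lemma tsum_toZ_sub {M : Type*} [AddCommMonoid M] [TopologicalSpace M] (d : ℕ) (z : St d)
    (F : Zd d → M) (hF : ∀ w : Zd d, w.2 < -(z.2 : ℤ) → F w = 0) :
    ∑' z' : St d, F (toZ d z' - toZ d z) = ∑' w, F w :=
  (toZ_sub_injective d z).tsum_eq (f := F) fun w hw => by
    by_contra h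
    exact hw (eq_zero_of_notMem_range d z F hF w h)

lemma hasSum_toZ_sub {M : Type*} [AddCommMonoid M] [TopologicalSpace M] (d : ℕ) (z : St d)
    (F : Zd d → M) (hF : ∀ w : Zd d, w.2 < -(z.2 : ℤ) → F w = 0) (c : M) :
    HasSum (fun z' : St d => F (toZ d z' - toZ d z)) c ↔ HasSum F c :=
  (toZ_sub_injective d z).hasSum_iff fun w hw => eq_zero_of_notMem_range d z F hF w hw

end Transfer

section ExponentialWeights

/-- The exponential `z ↦ e^{b·z}` as an extended nonnegative function. -/
noncomputable def expW (d : ℕ) (b : Rd d) (z : St d) : ℝ≥0∞ :=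
  ENNReal.ofReal (Real.exp (dotZ d b (toZ d z)))

/-- The kernel of the homogeneous walk killed when it leaves the state space. -/
noncomputable def stepUp (d : ℕ) (μ : Zd d → ℝ) (z z' : St d) : ℝ≥0∞ :=
  ENNReal.ofReal (μ (toZ d z' - toZ d z))

lemma expW_pos (d : ℕ) (b : Rd d) (z : St d) : 0 < expW d b z :=
  ENNReal.ofReal_pos.2 (Real.exp_pos _)

lemma expW_ne_top (d : ℕ) (b : Rd d) (z : St d) : expW d b z ≠ ⊤ := ENNReal.ofReal_ne_top

lemma expW_eq_mul (d : ℕ) (b : Rd d) (z z' : St d) :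
    expW d b z' = ENNReal.ofReal (Real.exp (dotZ d b (toZ d z' - toZ d z))) * expW d b z := by
  rw [expW, expW, ← ENNReal.ofReal_mul (Real.exp_pos _).le, ← Real.exp_add, dotZ_sub_right,
    sub_add_cancel]

lemma tsum_ofReal_mul_exp {d : ℕ} {μ : Zd d → ℝ} (hμ : ∀ z, 0 ≤ μ z) {b : Rd d}
    (hs : Summable fun z => μ z * Real.exp (dotZ d b z)) :
    ∑' w, ENNReal.ofReal (μ w) * ENNReal.ofReal (Real.exp (dotZ d b w)) =
      ENNReal.ofReal (jgf d μ b) := by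
  rw [jgf, ENNReal.ofReal_tsum_of_nonneg (fun z => mul_nonneg (hμ z) (Real.exp_pos _).le) hs]
  exact tsum_congr fun w => (ENNReal.ofReal_mul (hμ w)).symm

lemma kerOp_stepUp_expW_le {d : ℕ} {μ : Zd d → ℝ} (hμ : ∀ z, 0 ≤ μ z) {b : Rd d}
    (hs : Summable fun z => μ z * Real.exp (dotZ d b z)) :
    kerOp (stepUp d μ) (expW d b) ≤ ENNReal.ofReal (jgf d μ b) • expW d b := by
  intro z
  rw [kerOp_apply, Pi.smul_apply, smul_eq_mul, ← tsum_ofReal_mul_exp hμ hs,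
    ← ENNReal.tsum_mul_right]
  refine le_trans (le_of_eq (tsum_congr fun z' => ?_)) (tsum_toZ_sub_le d z fun w =>
    ENNReal.ofReal (μ w) * ENNReal.ofReal (Real.exp (dotZ d b w)) * expW d b z)
  rw [expW_eq_mul d b z z', mul_assoc, stepUp]

/-- The generating function governing the step out of `z`. -/
noncomputable def jgfAt (d : ℕ) (μ μ0 : Zd d → ℝ) (b : Rd d) (z : St d) : ℝ :=
  if z.2 = 0 then jgf d μ0 b else jgf d μ b

lemma kerOp_step_expW {d : ℕ} {μ μ0 : Zd d → ℝ} (H : Assumptions d μ μ0) (b : Rd d) (z : St d) :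
    kerOp (step d μ μ0) (expW d b) z = ENNReal.ofReal (jgfAt d μ μ0 b z) * expW d b z := by
  rw [kerOp_apply]
  unfold step jgfAt
  split_ifs with h
  · rw [← tsum_ofReal_mul_exp H.prob0.1 (H.summable0 b), ← ENNReal.tsum_mul_right,
      ← tsum_toZ_sub d z]
    · exact tsum_congr fun z' => by rw [expW_eq_mul d b z z', mul_assoc]
    · intro w hw
      rw [h] at hw
      rw [H.h0.2 w (by simpa using hw)]
      simp
  · rw [← tsum_ofReal_mul_exp H.prob.1 (H.summable b), ← ENNReal.tsum_mul_right,
      ← tsum_toZ_sub d z]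
    · exact tsum_congr fun z' => by rw [expW_eq_mul d b z z', mul_assoc]
    · intro w hw
      rw [H.h0.1 w (by omega)]
      simp

lemma kerOp_step_expW_le {d : ℕ} {μ μ0 : Zd d → ℝ} (H : Assumptions d μ μ0) {b : Rd d} {c : ℝ}
    (h : jgf d μ b ≤ c) (h' : jgf d μ0 b ≤ c) :
    kerOp (step d μ μ0) (expW d b) ≤ ENNReal.ofReal c • expW d b := by
  intro z
  rw [kerOp_step_expW H, Pi.smul_apply, smul_eq_mul, jgfAt]
  gcongr
  split_ifs <;> assumption

end ExponentialWeights

section Irreducibility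

lemma exists_kernel_step {S : Type*} [DecidableEq S] {p : S → S → ℝ≥0∞} (A : Set S)
    {n : ℕ} {z z' : S} (h : kerIter p n z z' ≠ 0) (hz : z ∈ A) (hz' : z' ∉ A) :
    ∃ u ∈ A, ∃ v ∉ A, p u v ≠ 0 := by
  induction n generalizing z' with
  | zero =>
    rw [kerIter] at h
    have : z = z' := by
      by_contra h'
      exact h (if_neg h')
    exact absurd (this ▸ hz) hz'
  | succ n ih =>
    rw [kerIter, Ne, ENNReal.tsum_eq_zero, not_forall] at h
    obtain ⟨w, hw⟩ := h
    by_cases hwA : w ∈ A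
    · exact ⟨w, hwA, z', hz', right_ne_zero_of_mul hw⟩
    · exact ih (left_ne_zero_of_mul hw) hwA

variable {d : ℕ} {μ μ0 : Zd d → ℝ}

lemma Assumptions.exists_neg (H : Assumptions d μ μ0) : ∃ w : Zd d, 0 < μ w ∧ w.2 = -1 := by
  obtain ⟨n, hn⟩ := H.h2.1 0 (0, -1)
  obtain ⟨u, hu, v, hv, huv⟩ := exists_kernel_step {z : Zd d | 0 ≤ z.2} hn.ne'
    (by simp) (by simp)
  simp only [Set.mem_ofPred_eq, not_le] at hu hv
  have h1 : 0 < μ (v - u) := by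
    by_contra h
    exact huv (ENNReal.ofReal_eq_zero.2 (not_lt.1 h))
  refine ⟨v - u, h1, ?_⟩
  have h2 : ¬ (v - u).2 < -1 := fun h => h1.ne' (H.h0.1 _ h)
  rw [Prod.snd_sub] at h2 ⊢
  omega

lemma Assumptions.exists_pos (H : Assumptions d μ μ0) : ∃ w : Zd d, 0 < μ w ∧ 1 ≤ w.2 := by
  obtain ⟨n, hn⟩ := H.h2.1 0 (0, 1)
  obtain ⟨u, hu, v, hv, huv⟩ := exists_kernel_step {z : Zd d | z.2 ≤ 0} hn.ne'
    (by simp) (by simp)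
  simp only [Set.mem_ofPred_eq, not_le] at hu hv
  have h1 : 0 < μ (v - u) := by
    by_contra h
    exact huv (ENNReal.ofReal_eq_zero.2 (not_lt.1 h))
  refine ⟨v - u, h1, ?_⟩
  rw [Prod.snd_sub]
  omega

lemma Assumptions.exists_pos0 (H : Assumptions d μ μ0) : ∃ w : Zd d, 0 < μ0 w ∧ 1 ≤ w.2 := by
  obtain ⟨n, hn⟩ := H.h1 0 (0, 1)
  obtain ⟨u, hu, v, hv, huv⟩ := exists_kernel_step {z : St d | z.2 = 0} hn.ne'
    (by simp) (by simp)
  simp only [Set.mem_ofPred_eq] at hu hv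
  have h1 : 0 < μ0 (toZ d v - toZ d u) := by
    by_contra h
    rw [step, if_pos hu] at huv
    exact huv (ENNReal.ofReal_eq_zero.2 (not_lt.1 h))
  refine ⟨_, h1, ?_⟩
  simp only [toZ, Prod.snd_sub]
  omega

end Irreducibility

section Convexity

lemma summable_mul_snd {d : ℕ} {μ : Zd d → ℝ} (hμ : ∀ z, 0 ≤ μ z)
    (hs : ∀ a : Rd d, Summable fun z => μ z * Real.exp (dotZ d a z)) (a : Rd d) :
    Summable fun z : Zd d => μ z * (z.2 : ℝ) * Real.exp (dotZ d a z) := by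
  refine Summable.of_norm_bounded (summable_mul_exp_norm hμ hs a 1) fun z => ?_
  have h1 : |(z.2 : ℝ)| ≤ Real.exp (1 * ‖toR d z‖) := by
    have h2 : |(z.2 : ℝ)| ≤ ‖toR d z‖ := norm_snd_le (toR d z)
    have h3 := Real.add_one_le_exp ‖toR d z‖
    rw [one_mul]
    linarith
  rw [Real.norm_eq_abs, abs_mul, abs_mul, abs_of_nonneg (hμ z), abs_of_pos (Real.exp_pos _)]
  have := hμ z
  calc μ z * |(z.2 : ℝ)| * Real.exp (dotZ d a z) 
      ≤ μ z * Real.exp (1 * ‖toR d z‖) * Real.exp (dotZ d a z) := by gcongr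
    _ = _ := by ring

lemma dotZ_mk (d : ℕ) (a : Rd d) (t : ℝ) (z : Zd d) :
    dotZ d (a.1, t) z = dotZ d a z + (t - a.2) * z.2 := by
  simp only [dotZ]; ring

lemma jgf_mono0 {d : ℕ} {μ μ0 : Zd d → ℝ} (H : Assumptions d μ μ0) (α : Fin (d - 1) → ℝ) :
    StrictMono fun β : ℝ => jgf d μ0 (α, β) := by
  intro s t hst
  obtain ⟨w, hw, hw1⟩ := H.exists_pos0
  refine Summable.tsum_lt_tsum (i := w) (fun z => ?_) ?_ (H.summable0 _) (H.summable0 _)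
  · rcases lt_or_ge z.2 0 with h | h
    · simp [H.h0.2 z h]
    · have : (0 : ℝ) ≤ z.2 := by exact_mod_cast h
      have h2 := H.prob0.1 z
      simp only [dotZ]
      gcongr
  · have : (0 : ℝ) < w.2 := by exact_mod_cast hw1
    simp only [dotZ]
    gcongr

lemma jgfDβ0_pos {d : ℕ} {μ μ0 : Zd d → ℝ} (H : Assumptions d μ μ0) (a : Rd d) :
    0 < jgfDβ d μ0 a := by
  obtain ⟨w, hw, hw1⟩ := H.exists_pos0
  refine (summable_mul_snd H.prob0.1 H.summable0 a).tsum_pos (fun z => ?_) w ?_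
  · rcases lt_or_ge z.2 0 with h | h
    · simp [H.h0.2 z h]
    · have : (0 : ℝ) ≤ z.2 := by exact_mod_cast h
      have h2 := H.prob0.1 z
      positivity
  · have : (0 : ℝ) < w.2 := by exact_mod_cast hw1
    positivity

/-- Quadratic growth of `β ↦ φ(α, β)` to the left of a point of `∂₋D`. -/
lemma exists_quadratic_le {d : ℕ} {μ μ0 : Zd d → ℝ} (H : Assumptions d μ μ0) {b : Rd d}
    (hb : b ∈ bdMinus d μ) :
    ∃ c : ℝ, 0 < c ∧ ∀ t ≤ b.2, 1 + c * (b.2 - t) ^ 2 ≤ jgf d μ (b.1, t) := by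
  obtain ⟨w, hw, hw1⟩ := H.exists_neg
  set e : ℝ := μ w * Real.exp (dotZ d b w) with he
  have he0 : 0 < e := by positivity
  refine ⟨e / 2, by positivity, fun t ht => ?_⟩
  have h1 := (H.summable b).hasSum
  have h2 := (summable_mul_snd H.prob.1 H.summable b).hasSum
  have h3 : HasSum (fun z => if z = w then e * (b.2 - t) ^ 2 / 2 else 0) (e * (b.2 - t) ^ 2 / 2) :=
    hasSum_ite_eq w _
  have h4 := (h1.add (h2.mul_left (t - b.2))).add h3
  have h5 := hasSum_le (fun z => ?_) h4 (H.summable (b.1, t)).hasSum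
  · have h6 : (∑' z, μ z * Real.exp (dotZ d b z)) = 1 := hb.1
    have h7 : (∑' z : Zd d, μ z * (z.2 : ℝ) * Real.exp (dotZ d b z)) ≤ 0 := hb.2
    rw [h6] at h5
    have h8 : 0 ≤ (t - b.2) * (∑' z : Zd d, μ z * (z.2 : ℝ) * Real.exp (dotZ d b z)) :=
      mul_nonneg_of_nonpos_of_nonpos (by linarith) h7
    refine le_trans ?_ h5
    linarith
  · have hz : 0 ≤ μ z * Real.exp (dotZ d b z) := mul_nonneg (H.prob.1 z) (Real.exp_pos _).le
    have hexp : Real.exp (dotZ d (b.1, t) z) =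
        Real.exp (dotZ d b z) * Real.exp ((t - b.2) * z.2) := by
      rw [dotZ_mk, Real.exp_add]
    rw [hexp]
    split_ifs with hzw
    · subst hzw
      have h9 := Real.quadratic_le_exp_of_nonneg (x := (t - b.2) * (z.2 : ℝ)) (by
        rw [hw1]; push_cast; linarith)
      have h10 := mul_le_mul_of_nonneg_left h9 hz
      rw [he]
      refine le_trans (le_of_eq ?_) (h10.trans_eq (mul_assoc _ _ _))
      rw [hw1]
      push_cast
      ring
    · have h9 := Real.add_one_le_exp ((t - b.2) * (z.2 : ℝ))
      have h10 := mul_le_mul_of_nonneg_left h9 hz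
      refine le_trans (le_of_eq ?_) (h10.trans_eq (mul_assoc _ _ _))
      ring

lemma le_of_jgf_le_one {d : ℕ} {μ μ0 : Zd d → ℝ} (H : Assumptions d μ μ0) {b : Rd d}
    (hb : b ∈ bdMinus d μ) {t : ℝ} (ht : jgf d μ (b.1, t) ≤ 1) : b.2 ≤ t := by
  by_contra! h
  obtain ⟨c, hc, h'⟩ := exists_quadratic_le H hb
  have := h' t h.le
  have : 0 < c * (b.2 - t) ^ 2 := mul_pos hc (pow_pos (by linarith) 2)
  linarith

lemma jgf0_le_one_of_mem_Theta {d : ℕ} {μ μ0 : Zd d → ℝ} (H : Assumptions d μ μ0) {b : Rd d}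
    (hb : b ∈ bdMinus d μ) (hT : b.1 ∈ Theta d μ μ0) : jgf d μ0 b ≤ 1 := by
  refine le_of_forall_pos_le_add fun η hη => ?_
  obtain ⟨c, hc, hq⟩ := exists_quadratic_le H hb
  have hcont : Continuous fun t : ℝ => jgf d μ0 (b.1, t) := H.continuous0.comp (by fun_prop)
  obtain ⟨δ, hδ, hδ'⟩ := Metric.continuousAt_iff.1 (hcont.continuousAt (x := b.2)) (η / 2)
    (by positivity)
  have hlt : (⨅ t : ℝ, max (jgf d μ (b.1, t)) (jgf d μ0 (b.1, t))) < 1 + min (η / 2) (c * δ ^ 2) :=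
    lt_of_le_of_lt hT (by linarith [lt_min (half_pos hη) (by positivity : 0 < c * δ ^ 2)])
  obtain ⟨t, ht⟩ := exists_lt_of_ciInf_lt hlt
  have ht1 : jgf d μ (b.1, t) < 1 + c * δ ^ 2 :=
    (le_max_left _ _).trans_lt (ht.trans_le (by gcongr; exact min_le_right _ _))
  have ht2 : jgf d μ0 (b.1, t) < 1 + η / 2 :=
    (le_max_right _ _).trans_lt (ht.trans_le (by gcongr; exact min_le_left _ _))
  rcases le_total b.2 t with h | h
  · have := (jgf_mono0 H b.1).monotone h
    simp only [Prod.mk.eta] at this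
    linarith
  · have h1 := hq t h
    have h2 : (b.2 - t) ^ 2 < δ ^ 2 := by
      have : c * (b.2 - t) ^ 2 < c * δ ^ 2 := by linarith
      exact lt_of_mul_lt_mul_left this hc.le
    have h3 : b.2 - t < δ := lt_of_pow_lt_pow_left₀ 2 hδ.le h2
    have h4 := hδ' (x := t) (by rw [Real.dist_eq, abs_sub_comm, abs_of_nonneg (by linarith)]; exact h3)
    rw [Real.dist_eq] at h4
    have h5 := (abs_lt.1 h4).1
    simp only [Prod.mk.eta] at h5
    linarith

lemma mem_Dhat_of_le {d : ℕ} {μ μ0 : Zd d → ℝ} (H : Assumptions d μ μ0) {b : Rd d} {t : ℝ}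
    (h1 : jgf d μ (b.1, t) ≤ 1) (h2 : jgf d μ0 (b.1, t) ≤ 1) (h : jgf d μ b ≤ 1) :
    b ∈ Dhat d μ μ0 :=
  ⟨le_trans (ciInf_le (f := fun t : ℝ => max (jgf d μ (b.1, t)) (jgf d μ0 (b.1, t))) ⟨0, by
    rintro _ ⟨s, rfl⟩
    exact (jgf_nonneg H.prob.1 _).trans (le_max_left _ _)⟩ t) (max_le h1 h2), h⟩

end Convexity

section LocalMoves

variable {d : ℕ} {μ μ0 : Zd d → ℝ}

lemma kerGreen_mul_kerIter_le {S : Type*} [DecidableEq S] (p : S → S → ℝ≥0∞) (m : ℕ)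
    (z w z' : S) : kerGreen p z w * kerIter p m w z' ≤ kerGreen p z z' := by
  unfold kerGreen
  rw [← ENNReal.tsum_mul_right]
  calc ∑' n, kerIter p n z w * kerIter p m w z' ≤ ∑' n, kerIter p (n + m) z z' :=
        ENNReal.tsum_le_tsum fun n => kerIter_mul_le p n m z w z'
    _ ≤ ∑' n, kerIter p n z z' :=
        ENNReal.tsum_comp_le_tsum_of_injective (add_left_injective m) fun n => kerIter p n z z'

/-- Translation of the state space along the boundary. -/
def shiftSt (d : ℕ) (k : Fin (d - 1) → ℤ) : St d ≃ St d where
  toFun z := (z.1 + k, z.2)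
  invFun z := (z.1 - k, z.2)
  left_inv z := by simp
  right_inv z := by simp

lemma toZ_shiftSt (k : Fin (d - 1) → ℤ) (z : St d) : toZ d (shiftSt d k z) = toZ d z + (k, 0) := by
  simp [toZ, shiftSt]

lemma step_shiftSt (k : Fin (d - 1) → ℤ) (z z' : St d) :
    step d μ μ0 (shiftSt d k z) (shiftSt d k z') = step d μ μ0 z z' := by
  unfold step
  rw [toZ_shiftSt, toZ_shiftSt, add_sub_add_right_eq_sub]
  rfl

lemma kerIter_step_shiftSt (k : Fin (d - 1) → ℤ) (n : ℕ) (z z' : St d) :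
    kerIter (step d μ μ0) n (shiftSt d k z) (shiftSt d k z') = kerIter (step d μ μ0) n z z' :=
  kerIter_equivariant _ _ (step_shiftSt k) n z z'

lemma stepSn_add_right (c : Zd d) (n : ℕ) (z z' : Zd d) :
    stepSn d μ n (z + c) (z' + c) = stepSn d μ n z z' :=
  kerIter_equivariant (stepS d μ) (Equiv.addRight c)
    (fun z z' => by simp [stepS]) n z z'

lemma stepSn_eq_zero (H : Assumptions d μ μ0) (n : ℕ) {z z' : Zd d} (h : z'.2 < z.2 - n) :
    stepSn d μ n z z' = 0 := by
  induction n generalizing z' with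
  | zero =>
    simp only [stepSn, kerIter]
    rw [if_neg]
    rintro rfl
    simp at h
  | succ n ih =>
    change ∑' w, stepSn d μ n z w * stepS d μ w z' = 0
    refine ENNReal.tsum_eq_zero.2 fun w => ?_
    rcases lt_or_ge w.2 (z.2 - n) with hw | hw
    · rw [ih hw, zero_mul]
    · rw [stepS, H.h0.1, ENNReal.ofReal_zero, mul_zero]
      rw [Prod.snd_sub]
      push_cast at h
      omega

lemma stepSn_le_kerIter (H : Assumptions d μ μ0) {n : ℕ} {z : St d} (h : n ≤ z.2) (z' : St d) :
    stepSn d μ n (toZ d z) (toZ d z') ≤ kerIter (step d μ μ0) n z z' := by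
  induction n generalizing z' with
  | zero => simp [stepSn, kerIter, (toZ_injective d).eq_iff]
  | succ n ih =>
    change ∑' w, stepSn d μ n (toZ d z) w * stepS d μ w (toZ d z') ≤ 
      ∑' w, kerIter (step d μ μ0) n z w * step d μ μ0 w z'
    have hlow : ∀ w : Zd d, w.2 < 1 → stepSn d μ n (toZ d z) w = 0 := fun w hw =>
      stepSn_eq_zero H n (by simp only [toZ]; omega)
    rw [← (toZ_injective d).tsum_eq]
    · refine ENNReal.tsum_le_tsum fun w => ?_
      rcases Nat.eq_zero_or_pos w.2 with hw | hw
      · rw [hlow _ (by simp [toZ, hw]), zero_mul]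
        exact zero_le
      · refine mul_le_mul' (ih (by omega) w) ?_
        rw [step, if_neg hw.ne', stepS]
    · intro w hw
      by_contra hr
      refine hw ?_
      have h0 : stepSn d μ n (toZ d z) w = 0 := by
        refine hlow w ?_
        by_contra! hlt
        exact hr ⟨(w.1, w.2.toNat), Prod.ext rfl (by simp only [toZ]; omega)⟩
      simp [h0]

/-- Transitions with a fixed displacement `e` from heights in `A` have uniformly positive
probability within a bounded number of steps. -/
def LocalMoves (d : ℕ) (μ μ0 : Zd d → ℝ) (A : Set ℕ) (e : Zd d) : Prop :=
  ∃ (N : ℕ) (ε : ℝ≥0∞), ε ≠ 0 ∧ ∀ z z' : St d, z.2 ∈ A → toZ d z' - toZ d z = e →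
    ∃ m ≤ N, ε ≤ kerIter (step d μ μ0) m z z'

lemma LocalMoves.union {A B : Set ℕ} {e : Zd d} (hA : LocalMoves d μ μ0 A e)
    (hB : LocalMoves d μ μ0 B e) : LocalMoves d μ μ0 (A ∪ B) e := by
  obtain ⟨N, ε, hε, h⟩ := hA
  obtain ⟨N', ε', hε', h'⟩ := hB
  refine ⟨max N N', min ε ε', (lt_min (pos_iff_ne_zero.2 hε) (pos_iff_ne_zero.2 hε')).ne',
    fun z z' hz hzz' => ?_⟩
  rcases hz with hz | hz
  · obtain ⟨m, hm, h1⟩ := h z z' hz hzz'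
    exact ⟨m, hm.trans (le_max_left _ _), (min_le_left _ _).trans h1⟩
  · obtain ⟨m, hm, h1⟩ := h' z z' hz hzz'
    exact ⟨m, hm.trans (le_max_right _ _), (min_le_right _ _).trans h1⟩

lemma LocalMoves.singleton (H : Assumptions d μ μ0) (y : ℕ) (e : Zd d) :
    LocalMoves d μ μ0 {y} e := by
  by_cases he : ∃ z' : St d, toZ d z' - toZ d (0, y) = e
  · obtain ⟨z', hz'⟩ := he
    obtain ⟨n, hn⟩ := H.h1 (0, y) z'
    refine ⟨n, _, hn.ne', fun w w' hw hww' => ⟨n, le_rfl, le_of_eq ?_⟩⟩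
    have h1 : w = shiftSt d w.1 (0, y) := by
      refine Prod.ext ?_ hw
      simp [shiftSt]
    have h2 : w' = shiftSt d w.1 z' := by
      refine toZ_injective d ?_
      rw [toZ_shiftSt, eq_add_of_sub_eq hww', eq_add_of_sub_eq hz', h1, toZ_shiftSt]
      simp only [shiftSt, Equiv.coe_fn_mk, zero_add]
      abel
    calc stepn d μ μ0 n (0, y) z'
        = kerIter (step d μ μ0) n (shiftSt d w.1 (0, y)) (shiftSt d w.1 z') :=
          (kerIter_step_shiftSt w.1 n (0, y) z').symm
      _ = _ := by rw [← h1, ← h2]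
  · refine ⟨0, 1, one_ne_zero, fun w w' hw hww' => absurd ?_ he⟩
    refine ⟨shiftSt d (-w.1) w', ?_⟩
    have h1 : ((0, y) : St d) = shiftSt d (-w.1) w := by
      refine Prod.ext ?_ hw.symm
      simp [shiftSt]
    rw [h1, toZ_shiftSt, toZ_shiftSt, add_sub_add_right_eq_sub, hww']

lemma LocalMoves.univ (H : Assumptions d μ μ0) (e : Zd d) : LocalMoves d μ μ0 Set.univ e := by
  obtain ⟨n, hn⟩ := H.h2.1 0 e
  have h1 : ∀ k, LocalMoves d μ μ0 (Set.Iio k) e := by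
    intro k
    induction k with
    | zero => exact ⟨0, 1, one_ne_zero, fun z z' hz => absurd hz (Nat.not_lt_zero _)⟩
    | succ k ih =>
      have := ih.union (LocalMoves.singleton H k e)
      rwa [show Set.Iio k ∪ {k} = Set.Iio (k + 1) by ext x; simp] at this
  have h2 : LocalMoves d μ μ0 (Set.Ici n) e := by
    refine ⟨n, _, hn.ne', fun z z' hz hzz' => ⟨n, le_rfl, ?_⟩⟩
    have := stepSn_le_kerIter H (z := z) hz z'
    rw [← stepSn_add_right (toZ d z) n 0 e, zero_add, ← hzz', sub_add_cancel]
    exact this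
  have := (h1 n).union h2
  rwa [Set.Iio_union_Ici] at this

lemma exists_uniform_localMoves (H : Assumptions d μ μ0) {E : Set (Zd d)} (hE : E.Finite) :
    ∃ ε : ℝ, 0 < ε ∧ ε ≤ 1 ∧ ∃ N : ℕ, ∀ z z' : St d, toZ d z' - toZ d z ∈ E →
      ∃ m ≤ N, ENNReal.ofReal ε ≤ kerIter (step d μ μ0) m z z' := by
  induction E, hE using Set.Finite.induction_on with
  | empty => exact ⟨1, one_pos, le_rfl, 0, fun _ _ h => h.elim⟩
  | @insert e E _ _ ih =>
    obtain ⟨ε, hε, hε1, N, h⟩ := ih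
    obtain ⟨N', ε', hε', h'⟩ := LocalMoves.univ H e
    obtain ⟨r, hr0, hr⟩ := ENNReal.lt_iff_exists_nnreal_btwn.1 (pos_iff_ne_zero.2 hε')
    have hr0' : 0 < (r : ℝ) := by exact_mod_cast ENNReal.coe_pos.1 hr0
    refine ⟨min ε r, lt_min hε hr0', (min_le_left _ _).trans hε1, max N N', fun z z' hz => ?_⟩
    rcases hz with hz | hz
    · obtain ⟨m, hm, h1⟩ := h' z z' (Set.mem_univ _) hz
      refine ⟨m, hm.trans (le_max_right _ _), le_trans ?_ (hr.le.trans h1)⟩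
      rw [← ENNReal.ofReal_coe_nnreal]
      exact ENNReal.ofReal_le_ofReal (min_le_right _ _)
    · obtain ⟨m, hm, h1⟩ := h z z' hz
      exact ⟨m, hm.trans (le_max_left _ _),
        (ENNReal.ofReal_le_ofReal (min_le_left _ _)).trans h1⟩

lemma exists_kerIter_ge (H : Assumptions d μ μ0) :
    ∃ M : ℝ, 0 ≤ M ∧ ∀ z z' : St d, ∃ m,
      ENNReal.ofReal (Real.exp (-(M * ‖toR d (toZ d z' - toZ d z)‖))) ≤
        kerIter (step d μ μ0) m z z' := by
  obtain ⟨ε, hε, hε1, N, h⟩ := exists_uniform_localMoves H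
    (E := {e : Zd d | (∀ i, |e.1 i| ≤ 1) ∧ |e.2| ≤ 1}) (by
      refine ((Set.finite_Icc (-1 : Fin (d - 1) → ℤ) 1).prod
        (Set.finite_Icc (-1 : ℤ) 1)).subset fun e he => ?_
      exact ⟨⟨fun i => (abs_le.1 (he.1 i)).1, fun i => (abs_le.1 (he.1 i)).2⟩, abs_le.1 he.2⟩)
  have key : ∀ (k : ℕ) (z z' : St d), (∀ i, |z'.1 i - z.1 i| ≤ k) → |(z'.2 : ℤ) - z.2| ≤ k →
      ∃ m, ENNReal.ofReal ε ^ k ≤ kerIter (step d μ μ0) m z z' := by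
    intro k
    induction k with
    | zero =>
      intro z z' h1 h2
      refine ⟨0, ?_⟩
      have : z = z' := by
        refine Prod.ext (funext fun i => ?_) ?_
        · have := abs_nonpos_iff.1 (h1 i); omega
        · have := abs_nonpos_iff.1 h2; omega
      rw [kerIter, if_pos this, pow_zero]
    | succ k ih =>
      intro z z' h1 h2
      have hstep : ∀ u v : ℤ, |v - u| ≤ (k + 1 : ℕ) → |v - (u + (v - u).sign)| ≤ k := by
        intro u v huv
        rcases lt_trichotomy (v - u) 0 with h | h | h
        · rw [Int.sign_eq_neg_one_of_neg h]
          rw [abs_le] at huv ⊢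
          push_cast at huv
          omega
        · rw [h, Int.sign_zero, add_zero, h]
          simp
        · rw [Int.sign_eq_one_of_pos h]
          rw [abs_le] at huv ⊢
          push_cast at huv
          omega
      have hsign : ∀ u : ℤ, |u.sign| ≤ 1 := by
        intro u
        rcases lt_trichotomy u 0 with h | h | h
        · rw [Int.sign_eq_neg_one_of_neg h]; simp
        · rw [h]; simp
        · rw [Int.sign_eq_one_of_pos h]; simp
      set y : ℤ := z.2 + ((z'.2 : ℤ) - z.2).sign with hy
      have hy0 : 0 ≤ y := by
        rcases lt_trichotomy ((z'.2 : ℤ) - z.2) 0 with h | h | h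
        · rw [Int.sign_eq_neg_one_of_neg h] at hy; omega
        · rw [h, Int.sign_zero] at hy; omega
        · rw [Int.sign_eq_one_of_pos h] at hy; omega
      set u : St d := (fun i => z.1 i + (z'.1 i - z.1 i).sign, y.toNat) with hu
      have hu2 : (u.2 : ℤ) = y := Int.toNat_of_nonneg hy0
      obtain ⟨m, hm⟩ := ih u z' (fun i => hstep _ _ (h1 i)) (by
        rw [hu2]; exact hstep _ _ h2)
      obtain ⟨m', -, hm'⟩ := h z u ⟨fun i => by simpa [toZ, hu] using hsign _, by
        simp only [toZ, Prod.snd_sub, hu2, hy, add_sub_cancel_left]; exact hsign _⟩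
      refine ⟨m' + m, le_trans ?_ (kerIter_mul_le _ m' m z u z')⟩
      rw [pow_succ']
      exact mul_le_mul' hm' hm
  refine ⟨-Real.log ε, neg_nonneg.2 (Real.log_nonpos hε.le hε1), fun z z' => ?_⟩
  set r := ‖toR d (toZ d z' - toZ d z)‖ with hr
  have hfl : ∀ u : ℤ, |(u : ℝ)| ≤ r → |u| ≤ (⌊r⌋₊ : ℤ) := by
    intro u hu
    rw [Int.abs_eq_natAbs]
    have : ((u.natAbs : ℕ) : ℝ) ≤ r := by
      rwa [Nat.cast_natAbs, Int.cast_abs]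
    exact_mod_cast Nat.le_floor this
  obtain ⟨m, hm⟩ := key ⌊r⌋₊ z z'
    (fun i => hfl _ ((norm_le_pi_norm (toR d (toZ d z' - toZ d z)).1 i).trans (norm_fst_le _)))
    (hfl _ (norm_snd_le (toR d (toZ d z' - toZ d z))))
  refine ⟨m, le_trans ?_ hm⟩
  rw [← ENNReal.ofReal_pow hε.le, ← Real.rpow_natCast, Real.rpow_def_of_pos hε]
  refine ENNReal.ofReal_le_ofReal (Real.exp_le_exp.2 ?_)
  have h1 := Nat.floor_le (norm_nonneg (toR d (toZ d z' - toZ d z)))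
  have h2 := Real.log_nonpos hε.le hε1
  nlinarith

end LocalMoves

section Contraction

variable {d : ℕ} {μ μ0 : Zd d → ℝ}

lemma dotR_add_right (a q r : Rd d) : dotR d a (q + r) = dotR d a q + dotR d a r := by
  simp only [dotR, Prod.fst_add, Prod.snd_add, Pi.add_apply, mul_add, Finset.sum_add_distrib]
  ring

lemma dotR_smul_right (a q : Rd d) (c : ℝ) : dotR d a (c • q) = c * dotR d a q := by
  simp only [dotR, Prod.smul_fst, Prod.smul_snd, Pi.smul_apply, smul_eq_mul, mul_add,
    Finset.mul_sum]
  congr 1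
  · exact Finset.sum_congr rfl fun i _ => by ring
  · ring

lemma dotR_comm (a q : Rd d) : dotR d a q = dotR d q a := by
  simp only [dotR, mul_comm]

lemma dotR_sub_right (a q r : Rd d) : dotR d a (q - r) = dotR d a q - dotR d a r := by
  have := dotR_add_right a (q - r) r
  rw [sub_add_cancel] at this
  linarith

lemma dotR_self_pos {q : Rd d} (hq : q ≠ 0) : 0 < dotR d q q := by
  have h1 : ∀ i, 0 ≤ q.1 i * q.1 i := fun i => mul_self_nonneg _
  have h2 : 0 ≤ ∑ i, q.1 i * q.1 i := Finset.sum_nonneg fun i _ => h1 i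
  have h3 := mul_self_nonneg q.2
  refine lt_of_le_of_ne (by unfold dotR; linarith) fun h => hq ?_
  unfold dotR at h
  have h4 : ∑ i, q.1 i * q.1 i = 0 := by linarith
  have h5 : q.2 * q.2 = 0 := by linarith
  refine Prod.ext (funext fun i => ?_) (mul_self_eq_zero.1 h5)
  exact mul_self_eq_zero.1 ((Finset.sum_eq_zero_iff_of_nonneg fun i _ => h1 i).1 h4 i
    (Finset.mem_univ i))

lemma dotZ_eq_dotR (a : Rd d) (z : Zd d) : dotZ d a z = dotR d a (toR d z) := rfl

/-- Two nonzero vectors that do not point in opposite directions lie in a common open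
half-space. -/
lemma exists_dotR_neg {m m0 : Rd d} (hm : m ≠ 0) (hm0 : m0 ≠ 0)
    (h : ‖m‖⁻¹ • m + ‖m0‖⁻¹ • m0 ≠ 0) : ∃ v : Rd d, dotR d v m < 0 ∧ dotR d v m0 < 0 := by
  set r := √(dotR d m m) with hr
  set r0 := √(dotR d m0 m0) with hr0
  have hr1 : 0 < r := Real.sqrt_pos.2 (dotR_self_pos hm)
  have hr2 : 0 < r0 := Real.sqrt_pos.2 (dotR_self_pos hm0)
  have hrr : dotR d m m = r * r := (Real.mul_self_sqrt (dotR_self_pos hm).le).symm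
  have hrr0 : dotR d m0 m0 = r0 * r0 := (Real.mul_self_sqrt (dotR_self_pos hm0).le).symm
  set w := r0 • m + r • m0 with hw
  have hw0 : w ≠ 0 := by
    intro hw0
    have h1 : m0 = -(r0 / r) • m := by
      have h2 : r • m0 = -(r0 • m) := by
        rw [eq_neg_iff_add_eq_zero, add_comm]; exact hw0
      rw [← inv_smul_smul₀ hr1.ne' m0, h2, smul_neg, smul_smul, neg_smul]
      congr 2
      ring
    refine h ?_
    have h3 : ‖m0‖ = r0 / r * ‖m‖ := by
      rw [h1, norm_smul, norm_neg, Real.norm_of_nonneg (by positivity)]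
    have h4 : 0 < ‖m‖ := norm_pos_iff.2 hm
    rw [h3, h1, smul_smul, ← add_smul]
    convert zero_smul ℝ m using 2
    field_simp
    ring
  have hmw : dotR d w m = r * (r * r0 + dotR d m m0) := by
    rw [dotR_comm, hw, dotR_add_right, dotR_smul_right, dotR_smul_right, hrr]
    ring
  have hm0w : dotR d w m0 = r0 * (r * r0 + dotR d m m0) := by
    rw [dotR_comm, hw, dotR_add_right, dotR_smul_right, dotR_smul_right, hrr0, dotR_comm m0 m]
    ring
  have hww : dotR d w w = 2 * r * r0 * (r * r0 + dotR d m m0) := by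
    nth_rewrite 2 [hw]
    rw [dotR_add_right, dotR_smul_right, dotR_smul_right, hmw, hm0w]
    ring
  have hpos : 0 < r * r0 + dotR d m m0 := by
    have := dotR_self_pos hw0
    rw [hww] at this
    exact pos_of_mul_pos_right this (by positivity)
  have hneg : ∀ q, dotR d ((-1 : ℝ) • w) q = -dotR d w q := fun q => by
    rw [dotR_comm, dotR_smul_right, dotR_comm]; ring
  refine ⟨(-1 : ℝ) • w, ?_, ?_⟩
  · rw [hneg, hmw]
    have := mul_pos hr1 hpos
    linarith
  · rw [hneg, hm0w]
    have := mul_pos hr2 hpos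
    linarith

lemma hasSum_mul_dotZ (hμ : ∀ z, 0 ≤ μ z)
    (hs : ∀ a : Rd d, Summable fun z => μ z * Real.exp (dotZ d a z)) (v : Rd d) :
    HasSum (fun z => μ z * dotZ d v z) (dotR d v (meanVec d μ)) := by
  have hS : Summable fun z => μ z * Real.exp (1 * ‖toR d z‖) := by
    simpa [dotZ_zero_left] using summable_mul_exp_norm hμ hs 0 1
  have hle : ∀ (z : Zd d) (u : ℝ), |u| ≤ ‖toR d z‖ → ‖μ z * u‖ ≤ μ z * Real.exp (1 * ‖toR d z‖) := by
    intro z u hu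
    have h2 := Real.add_one_le_exp ‖toR d z‖
    rw [Real.norm_eq_abs, abs_mul, abs_of_nonneg (hμ z), one_mul]
    have := hμ z
    gcongr
    linarith
  have h1 : ∀ i, HasSum (fun z => μ z * (z.1 i : ℝ)) ((meanVec d μ).1 i) := fun i =>
    (Summable.of_norm_bounded hS fun z => hle z _
      ((norm_le_pi_norm (toR d z).1 i).trans (norm_fst_le (toR d z)))).hasSum
  have h2 : HasSum (fun z : Zd d => μ z * (z.2 : ℝ)) (meanVec d μ).2 :=
    (Summable.of_norm_bounded hS fun z => hle z _ (norm_snd_le (toR d z))).hasSum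
  have h3 := (hasSum_sum fun i (_ : i ∈ Finset.univ) => (h1 i).mul_left (v.1 i)).add
    (h2.mul_left v.2)
  refine (congrArg (HasSum · _) (funext fun z => ?_)).mpr h3
  simp only [dotZ, mul_add, Finset.mul_sum]
  congr 1
  · exact Finset.sum_congr rfl fun i _ => by ring
  · ring

lemma eventually_jgf_smul_lt_one (hd : 1 ≤ d) (hμ : IsProb d μ)
    (hs : ∀ a : Rd d, Summable fun z => μ z * Real.exp (dotZ d a z)) {v : Rd d}
    (hv : dotR d v (meanVec d μ) < 0) :
    ∀ᶠ n : ℕ in atTop, jgf d μ ((1 / ((n : ℝ) + 1)) • v) < 1 := by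
  have hS : Summable fun z => μ z * Real.exp (d * ‖v‖ * ‖toR d z‖) := by
    simpa [dotZ_zero_left] using summable_mul_exp_norm hμ.1 hs 0 (d * ‖v‖)
  have hpos : ∀ n : ℕ, 0 < 1 / ((n : ℝ) + 1) := fun n => Nat.one_div_pos_of_nat
  have hle1 : ∀ n : ℕ, 1 / ((n : ℝ) + 1) ≤ 1 := fun n => by
    rw [div_le_one (by positivity)]
    linarith [n.cast_nonneg (α := ℝ)]
  have hlim := tendsto_tsum_of_dominated_convergence
    (f := fun (n : ℕ) z => μ z * ((Real.exp ((1 / ((n : ℝ) + 1)) * dotZ d v z) - 1) *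
      ((n : ℝ) + 1))) (g := fun z => μ z * dotZ d v z) (𝓕 := atTop) hS ?_ ?_
  · rw [(hasSum_mul_dotZ hμ.1 hs v).tsum_eq] at hlim
    filter_upwards [hlim.eventually_lt_const hv] with n hn
    have h1 : HasSum (fun z => μ z * ((Real.exp ((1 / ((n : ℝ) + 1)) * dotZ d v z) - 1) *
        ((n : ℝ) + 1))) ((jgf d μ ((1 / ((n : ℝ) + 1)) • v) - 1) * ((n : ℝ) + 1)) := by
      have h2 := ((hs ((1 / ((n : ℝ) + 1)) • v)).hasSum.sub hμ.2).mul_right ((n : ℝ) + 1)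
      refine (congrArg (HasSum · _) (funext fun z => ?_)).mpr h2
      rw [dotZ_smul_left]
      ring
    rw [h1.tsum_eq] at hn
    have h3 : (0 : ℝ) < (n : ℝ) + 1 := by positivity
    have := neg_of_mul_neg_left hn h3.le
    linarith
  · intro z
    refine Tendsto.const_mul _ ?_
    have hder : HasDerivAt (fun t : ℝ => Real.exp (t * dotZ d v z)) (dotZ d v z) 0 := by
      have h := ((hasDerivAt_id (0 : ℝ)).mul_const (dotZ d v z)).exp
      simpa using h
    have h1 := hder.tendsto_slope_zero.comp (f := fun n : ℕ => 1 / ((n : ℝ) + 1))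
      (x := atTop) ?_
    · refine h1.congr fun n => ?_
      simp [mul_comm]
    · exact tendsto_nhdsWithin_iff.2 ⟨tendsto_one_div_add_atTop_nhds_zero_nat,
        Eventually.of_forall fun n => (hpos n).ne'⟩
  · refine Eventually.of_forall fun n z => ?_
    have h1 : |dotZ d v z| ≤ d * ‖v‖ * ‖toR d z‖ := by
      rw [mul_assoc]; exact abs_dotZ_le d hd v z
    have h2 := abs_exp_sub_one_le (u := (1 / ((n : ℝ) + 1)) * dotZ d v z)
      (U := d * ‖v‖ * ‖toR d z‖) (hpos n).le (hle1 n)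
      (by rw [abs_mul, abs_of_pos (hpos n)]; exact mul_le_mul_of_nonneg_left h1 (hpos n).le)
    have h3 : (0 : ℝ) < (n : ℝ) + 1 := by positivity
    rw [Real.norm_eq_abs, abs_mul, abs_mul, abs_of_nonneg (hμ.1 z), abs_of_pos h3]
    refine mul_le_mul_of_nonneg_left ?_ (hμ.1 z)
    calc _ ≤ 1 / ((n : ℝ) + 1) * Real.exp (d * ‖v‖ * ‖toR d z‖) * ((n : ℝ) + 1) := by gcongr
      _ = _ := by field_simp

/-- `c` is a point where both generating functions are uniformly less than `κ < 1` on the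
closed ball of radius `δ`. -/
structure IsContraction (d : ℕ) (μ μ0 : Zd d → ℝ) (c : Rd d) (δ κ : ℝ) : Prop where
  δ_pos : 0 < δ
  κ_pos : 0 < κ
  κ_lt : κ < 1
  le : ∀ b, ‖b - c‖ ≤ δ → jgf d μ b ≤ κ
  le0 : ∀ b, ‖b - c‖ ≤ δ → jgf d μ0 b ≤ κ

lemma exists_isContraction (H : Assumptions d μ μ0) :
    ∃ c δ κ, IsContraction d μ μ0 c δ κ := by
  obtain ⟨v, hv, hv0⟩ := exists_dotR_neg H.h3.1 H.h3.2.1 H.h3.2.2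
  obtain ⟨n, hn, hn0⟩ := ((eventually_jgf_smul_lt_one H.one_le H.prob H.summable hv).and
    (eventually_jgf_smul_lt_one H.one_le H.prob0 H.summable0 hv0)).exists
  set c := (1 / ((n : ℝ) + 1)) • v
  obtain ⟨κ, hκ, hκ1⟩ := exists_between (max_lt (max_lt hn hn0) one_pos)
  have hκ' := max_lt_iff.1 hκ
  have hκ'' := max_lt_iff.1 hκ'.1
  have h1 := (H.continuous.tendsto c).eventually_lt_const hκ''.1
  have h2 := (H.continuous0.tendsto c).eventually_lt_const hκ''.2
  obtain ⟨δ, hδ, h⟩ := Metric.eventually_nhds_iff_ball.1 (h1.and h2)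
  have hmem : ∀ b, ‖b - c‖ ≤ δ / 2 → b ∈ Metric.ball c δ := fun b hb => by
    rw [Metric.mem_ball, dist_eq_norm]; linarith
  exact ⟨c, δ / 2, κ, by positivity, hκ'.2, hκ1, fun b hb => (h b (hmem b hb)).1.le,
    fun b hb => (h b (hmem b hb)).2.le⟩

lemma kerIter_mul_expW_le {p : St d → St d → ℝ≥0∞} {b : Rd d} {κ : ℝ}
    (hp : kerOp p (expW d b) ≤ ENNReal.ofReal κ • expW d b) (n : ℕ) (z z' : St d) :
    kerIter p n z z' * expW d b z' ≤ ENNReal.ofReal κ ^ n * expW d b z :=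
  (kerIter_mul_le_pow p n z z' _).trans (pow_apply_le_smul (kerOp_mono p) hp n z)

lemma expW_add (b v : Rd d) (z : St d) :
    expW d (b + v) z = expW d b z * ENNReal.ofReal (Real.exp (dotZ d v (toZ d z))) := by
  rw [expW, expW, dotZ_add_left, Real.exp_add, ENNReal.ofReal_mul (Real.exp_pos _).le]

lemma kerIter_le_of_ball {p : St d → St d → ℝ≥0∞} {c : Rd d} {δ κ : ℝ} (hδ : 0 ≤ δ)
    (hp : ∀ b, ‖b - c‖ ≤ δ → kerOp p (expW d b) ≤ ENNReal.ofReal κ • expW d b)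
    (n : ℕ) (z z' : St d) :
    kerIter p n z z' *
        ENNReal.ofReal (Real.exp (dotZ d c (toZ d z' - toZ d z) + δ * ‖toR d (toZ d z' - toZ d z)‖))
      ≤ ENNReal.ofReal κ ^ n := by
  obtain ⟨s, hs⟩ := exists_dirVec d (toZ d z' - toZ d z)
  have h1 := kerIter_mul_expW_le (hp (c + δ • dirVec d s) (by
    rw [add_sub_cancel_left, norm_smul, Real.norm_of_nonneg hδ]
    exact mul_le_of_le_one_right hδ (norm_dirVec_le d s))) n z z'
  rw [expW_eq_mul d _ z z', dotZ_add_left, dotZ_smul_left, hs, ← mul_assoc] at h1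
  exact (ENNReal.mul_le_mul_iff_left (expW_pos d _ z).ne' (expW_ne_top d _ z)).1 h1

lemma IsContraction.kerOp_step_le (H : Assumptions d μ μ0) {c : Rd d} {δ κ : ℝ}
    (hc : IsContraction d μ μ0 c δ κ) (b : Rd d) (hb : ‖b - c‖ ≤ δ) :
    kerOp (step d μ μ0) (expW d b) ≤ ENNReal.ofReal κ • expW d b :=
  kerOp_step_expW_le H (hc.le b hb) (hc.le0 b hb)

lemma IsContraction.kerOp_stepUp_le (H : Assumptions d μ μ0) {c : Rd d} {δ κ : ℝ}
    (hc : IsContraction d μ μ0 c δ κ) (b : Rd d) (hb : ‖b - c‖ ≤ δ) :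
    kerOp (stepUp d μ) (expW d b) ≤ ENNReal.ofReal κ • expW d b := by
  refine (kerOp_stepUp_expW_le H.prob.1 (H.summable b)).trans fun z => ?_
  simp only [Pi.smul_apply, smul_eq_mul]
  gcongr
  exact hc.le b hb

lemma IsContraction.kerGreen_mul_le (H : Assumptions d μ μ0) {c : Rd d} {δ κ : ℝ}
    (hc : IsContraction d μ μ0 c δ κ) (z z' : St d) :
    kerGreen (step d μ μ0) z z' * expW d c z' ≤ (1 - ENNReal.ofReal κ)⁻¹ * expW d c z := by
  unfold kerGreen
  rw [← ENNReal.tsum_mul_right, ← ENNReal.tsum_geometric, ← ENNReal.tsum_mul_right]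
  exact ENNReal.tsum_le_tsum fun n => kerIter_mul_expW_le
    (hc.kerOp_step_le H c (by simpa using hc.δ_pos.le)) n z z'

lemma IsContraction.inv_ne_top {c : Rd d} {δ κ : ℝ}
    (hc : IsContraction d μ μ0 c δ κ) : (1 - ENNReal.ofReal κ)⁻¹ ≠ ⊤ := by
  rw [ENNReal.inv_ne_top]
  exact (tsub_pos_of_lt (by simpa using hc.κ_lt)).ne'

lemma kerGreen_ne_top (H : Assumptions d μ μ0) (z z' : St d) :
    kerGreen (step d μ μ0) z z' ≠ ⊤ := by
  obtain ⟨c, δ, κ, hc⟩ := exists_isContraction H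
  intro h
  have := hc.kerGreen_mul_le H z z'
  rw [h, ENNReal.top_mul (expW_pos d c z').ne', top_le_iff] at this
  exact ENNReal.mul_ne_top hc.inv_ne_top (expW_ne_top d c z) this

lemma kerGreen_pos (H : Assumptions d μ μ0) (z z' : St d) :
    0 < kerGreen (step d μ μ0) z z' := by
  obtain ⟨n, hn⟩ := H.h1 z z'
  exact hn.trans_le (kerIter_le_kerGreen (step d μ μ0) n z z')

end Contraction

section Superharmonic

variable {d : ℕ} {μ μ0 : Zd d → ℝ}

lemma pow_apply_le {S : Type*} {A : Module.End ℝ≥0∞ (S → ℝ≥0∞)} (hA : Monotone A)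
    {f : S → ℝ≥0∞} (h : A f ≤ f) (n : ℕ) : (A ^ n) f ≤ f := by
  simpa using pow_apply_le_smul hA (c := 1) (by simpa using h) n

lemma expW_shiftSt (b : Rd d) (k : Fin (d - 1) → ℤ) (z : St d) :
    expW d b (shiftSt d k z) = ENNReal.ofReal (Real.exp (dotZ d b (k, 0))) * expW d b z := by
  rw [expW_eq_mul d b z, toZ_shiftSt, add_sub_cancel_left]

lemma dotZ_fst (b : Rd d) (k : Fin (d - 1) → ℤ) : dotZ d b (k, 0) = ∑ i, b.1 i * (k i : ℝ) := by
  simp [dotZ]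

/-- A positive finite superharmonic function that is multiplicative along the boundary is
exponentially growing in the transverse direction, at a rate `t` with `φ(α, t) ≤ 1` and
`φ₀(α, t) ≤ 1`. -/
lemma exists_rate_of_superharmonic (H : Assumptions d μ μ0) (a : Rd d) {U : St d → ℝ≥0∞}
    (hU0 : ∀ z, 0 < U z) (hUtop : ∀ z, U z ≠ ⊤)
    (hshift : ∀ k z, U (shiftSt d k z) = ENNReal.ofReal (Real.exp (dotZ d a (k, 0))) * U z)
    (hU : kerOp (step d μ μ0) U ≤ U) :
    ∃ t : ℝ, jgf d μ (a.1, t) ≤ 1 ∧ jgf d μ0 (a.1, t) ≤ 1 ∧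
      ∀ x y, ENNReal.ofReal (Real.exp t) * U (x, y) ≤ U (x, y + 1) := by
  set Γ : ℕ → ℝ := fun n => (U (0, n)).toReal with hΓ
  have hΓpos : ∀ n, 0 < Γ n := fun n => ENNReal.toReal_pos (hU0 _).ne' (hUtop _)
  have hUΓ : ∀ z : St d, U z = ENNReal.ofReal (Real.exp (dotZ d a (z.1, 0)) * Γ z.2) := by
    intro z
    have h1 : z = shiftSt d z.1 (0, z.2) := Prod.ext (by simp [shiftSt]) rfl
    rw [ENNReal.ofReal_mul (Real.exp_pos _).le, hΓ, ENNReal.ofReal_toReal (hUtop _), ← hshift, ← h1]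
  obtain ⟨ε, hε, -, N, hmove⟩ := exists_uniform_localMoves H (Set.finite_singleton ((0, -1) : Zd d))
  have hεle : ∀ n, ε ≤ Γ (n + 1) / Γ n := by
    intro n
    obtain ⟨m, -, hm⟩ := hmove (0, n + 1) (0, n) (by simp [toZ])
    have h1 := (mul_le_mul_left hm (U (0, n))).trans ((kerIter_mul_le_pow _ m _ _ U).trans
      (pow_apply_le (kerOp_mono _) hU m _))
    rw [← ENNReal.ofReal_toReal (hUtop (0, n)), ← ENNReal.ofReal_mul hε.le,
      ENNReal.ofReal_le_iff_le_toReal (hUtop _)] at h1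
    rw [le_div_iff₀ (hΓpos n)]
    exact h1
  set F : ℝ := ⨅ n, Γ (n + 1) / Γ n with hF
  have hFε : ε ≤ F := le_ciInf hεle
  have hF0 : 0 < F := hε.trans_le hFε
  have hFle : ∀ n, F * Γ n ≤ Γ (n + 1) := by
    intro n
    rw [← le_div_iff₀ (hΓpos n)]
    exact ciInf_le ⟨ε, by rintro _ ⟨m, rfl⟩; exact hεle m⟩ n
  have hFpow : ∀ n j, F ^ j * Γ n ≤ Γ (n + j) := by
    intro n j
    induction j with
    | zero => simp
    | succ j ih =>
      calc F ^ (j + 1) * Γ n = F * (F ^ j * Γ n) := by ring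
        _ ≤ F * Γ (n + j) := by gcongr
        _ ≤ _ := hFle (n + j)
  set t := Real.log F with ht
  have hexpt : ∀ n : ℕ, Real.exp (t * n) = F ^ n := by
    intro n
    rw [mul_comm, Real.exp_nat_mul, ht, Real.exp_log hF0]
  have hexpW : ∀ z : St d, expW d (a.1, t) z =
      ENNReal.ofReal (Real.exp (dotZ d a (z.1, 0)) * F ^ z.2) := by
    intro z
    rw [expW, ← hexpt, ← Real.exp_add, dotZ_fst]
    simp [dotZ, toZ]
  have hkey : ∀ (n : ℕ) (z : St d), (∀ z' : St d, z'.2 < n → step d μ μ0 z z' = 0) →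
      ENNReal.ofReal (Γ n / F ^ n) * kerOp (step d μ μ0) (expW d (a.1, t)) z ≤ U z := by
    intro n z hz
    refine le_trans ?_ (hU z)
    rw [kerOp_apply, kerOp_apply, ← ENNReal.tsum_mul_left]
    refine ENNReal.tsum_le_tsum fun z' => ?_
    rcases lt_or_ge z'.2 n with h | h
    · rw [hz z' h]; simp
    · rw [mul_left_comm]
      gcongr
      rw [hexpW, hUΓ z', ← ENNReal.ofReal_mul (div_pos (hΓpos n) (pow_pos hF0 n)).le]
      refine ENNReal.ofReal_le_ofReal ?_
      obtain ⟨j, hj⟩ := Nat.exists_eq_add_of_le h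
      have := hFpow n j
      rw [hj, pow_add]
      calc _ = Real.exp (dotZ d a (z'.1, 0)) * (F ^ j * Γ n) := by
            field_simp
        _ ≤ _ := by gcongr
  have hjgf : 0 ≤ jgf d μ (a.1, t) := jgf_nonneg H.prob.1 _
  refine ⟨t, ?_, ?_, ?_⟩
  · have hn : ∀ n, F * jgf d μ (a.1, t) ≤ Γ (n + 1) / Γ n := by
      intro n
      have h1 := hkey n (0, n + 1) (fun z' hz' => by
        rw [step, if_neg (by simp), H.h0.1, ENNReal.ofReal_zero]
        simp only [toZ, Prod.snd_sub]
        push_cast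
        omega)
      rw [kerOp_step_expW H, jgfAt, if_neg (by simp), hexpW, hUΓ,
        ← ENNReal.ofReal_mul hjgf, ← ENNReal.ofReal_mul (div_pos (hΓpos n) (pow_pos hF0 n)).le] at h1
      have hz : dotZ d a (((0, n + 1) : St d).1, 0) = 0 := dotZ_zero_right d a
      rw [hz, Real.exp_zero, one_mul, one_mul, ENNReal.ofReal_le_ofReal_iff (hΓpos _).le] at h1
      rw [le_div_iff₀ (hΓpos n)]
      refine le_trans (le_of_eq ?_) h1
      simp only [pow_succ]
      field_simp
    have h2 : F * jgf d μ (a.1, t) ≤ F * 1 := by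
      rw [mul_one]
      exact le_ciInf hn
    exact le_of_mul_le_mul_left h2 hF0
  · have h1 := hkey 0 0 (fun z' hz' => absurd hz' (Nat.not_lt_zero _))
    rw [kerOp_step_expW H, jgfAt, if_pos Prod.snd_zero, hexpW, hUΓ,
      ← ENNReal.ofReal_mul (jgf_nonneg H.prob0.1 _),
      ← ENNReal.ofReal_mul (by have := hΓpos 0; positivity)] at h1
    have hz : dotZ d a ((0 : St d).1, 0) = 0 := dotZ_zero_right d a
    rw [hz, Real.exp_zero, one_mul, one_mul, ENNReal.ofReal_le_ofReal_iff (hΓpos _).le] at h1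
    simp only [Prod.snd_zero, pow_zero, mul_one, div_one] at h1
    exact le_of_mul_le_mul_left (by linarith) (hΓpos 0)
  · intro x y
    rw [hUΓ, hUΓ, ← ENNReal.ofReal_mul (Real.exp_pos _).le, ht, Real.exp_log hF0]
    refine ENNReal.ofReal_le_ofReal ?_
    have := hFle y
    calc _ = Real.exp (dotZ d a (x, 0)) * (F * Γ y) := by ring
      _ ≤ _ := by gcongr

/-- If `φ(b) ≥ 1` and `φ ≤ 1` somewhere below `b`, the killed homogeneous walk does not
exhaust `e^{b·z}`. -/
lemma exists_le_stepUp_pow (H : Assumptions d μ μ0) {b : Rd d} {t : ℝ} (hb : 1 ≤ jgf d μ b)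
    (ht : jgf d μ (b.1, t) ≤ 1) (htb : t < b.2) :
    ∃ η : ℝ≥0∞, η ≠ 0 ∧ ∀ n, η ≤ (kerOp (stepUp d μ) ^ n) (expW d b) 0 := by
  set C := Real.exp (-(b.2 - t)) with hC
  set h : Zd d → ℝ := fun z => Real.exp (dotZ d b z) - C * Real.exp (dotZ d (b.1, t) z) with hh
  have hheq : ∀ z, h z = Real.exp (dotZ d b z) * (1 - Real.exp ((t - b.2) * (z.2 + 1))) := by
    intro z
    simp only [hh, hC, dotZ_mk]
    rw [← Real.exp_add, mul_sub, mul_one, ← Real.exp_add]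
    congr 2
    ring
  have hnonneg : ∀ z : Zd d, -1 ≤ z.2 → 0 ≤ h z := by
    intro z hz
    have : (-1 : ℝ) ≤ z.2 := by exact_mod_cast hz
    rw [hheq]
    refine mul_nonneg (Real.exp_pos _).le (sub_nonneg.2 (Real.exp_le_one_iff.2 ?_))
    exact mul_nonpos_of_nonpos_of_nonneg (by linarith) (by linarith)
  set f : St d → ℝ≥0∞ := fun z => ENNReal.ofReal (h (toZ d z)) with hf
  have hsub : f ≤ kerOp (stepUp d μ) f := by
    intro z
    have h1 : kerOp (stepUp d μ) f z =
        ∑' w : Zd d, ENNReal.ofReal (μ w) * ENNReal.ofReal (h (w + toZ d z)) := by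
      rw [kerOp_apply, ← tsum_toZ_sub d z]
      · exact tsum_congr fun z' => by rw [sub_add_cancel, stepUp]
      · intro w hw
        rcases lt_or_ge w.2 (-1) with hw' | hw'
        · rw [H.h0.1 w hw']; simp
        · have hw2 : ((w + toZ d z).2 : ℝ) + 1 = 0 := by
            have : (w + toZ d z).2 + 1 = 0 := by
              simp only [toZ, Prod.snd_add]
              omega
            exact_mod_cast this
          rw [hheq, hw2]
          simp
    have h2 : HasSum (fun w : Zd d => μ w * h (w + toZ d z))
        (jgf d μ b * Real.exp (dotZ d b (toZ d z)) -
          C * (jgf d μ (b.1, t) * Real.exp (dotZ d (b.1, t) (toZ d z)))) := by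
      have h3 := ((H.summable b).hasSum.mul_right (Real.exp (dotZ d b (toZ d z)))).sub
        (((H.summable (b.1, t)).hasSum.mul_right
          (Real.exp (dotZ d (b.1, t) (toZ d z)))).mul_left C)
      refine (congrArg (HasSum · _) (funext fun w => ?_)).mpr h3
      simp only [hh, dotZ_add_right, Real.exp_add]
      ring
    have h4 : ∀ w : Zd d, 0 ≤ μ w * h (w + toZ d z) := by
      intro w
      rcases lt_or_ge w.2 (-1) with hw' | hw'
      · rw [H.h0.1 w hw']; simp
      · refine mul_nonneg (H.prob.1 w) (hnonneg _ ?_)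
        simp only [toZ, Prod.snd_add]
        omega
    have h5 : kerOp (stepUp d μ) f z = ENNReal.ofReal (∑' w : Zd d, μ w * h (w + toZ d z)) := by
      rw [h1, ENNReal.ofReal_tsum_of_nonneg h4 h2.summable]
      exact tsum_congr fun w => (ENNReal.ofReal_mul (H.prob.1 w)).symm
    rw [h5, h2.tsum_eq]
    refine ENNReal.ofReal_le_ofReal ?_
    have h6 : C * (jgf d μ (b.1, t) * Real.exp (dotZ d (b.1, t) (toZ d z))) ≤
        C * (1 * Real.exp (dotZ d (b.1, t) (toZ d z))) := by gcongr
    have h7 : 1 * Real.exp (dotZ d b (toZ d z)) ≤ jgf d μ b * Real.exp (dotZ d b (toZ d z)) := by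
      gcongr
    simp only [hh]
    linarith
  have hle : f ≤ expW d b := by
    intro z
    refine ENNReal.ofReal_le_ofReal ?_
    have : 0 < C * Real.exp (dotZ d (b.1, t) (toZ d z)) := by positivity
    simp only [hh]
    linarith
  refine ⟨f 0, ?_, fun n => (le_pow_apply (kerOp_mono _) hsub n 0).trans
    (monotone_pow (kerOp_mono _) n hle 0)⟩
  refine (ENNReal.ofReal_pos.2 ?_).ne'
  rw [hheq]
  refine mul_pos (Real.exp_pos _) (sub_pos.2 (Real.exp_lt_one_iff.2 ?_))
  simp [toZ]
  linarith

end Superharmonic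

section LowerBound

variable {d : ℕ} {μ μ0 : Zd d → ℝ}

lemma kerIter_le_of_injective {S T : Type*} [DecidableEq S] [DecidableEq T]
    {p : S → S → ℝ≥0∞} {q : T → T → ℝ≥0∞} {f : S → T} (hf : Function.Injective f)
    (h : ∀ u u', p u u' ≤ q (f u) (f u')) (n : ℕ) (u u' : S) :
    kerIter p n u u' ≤ kerIter q n (f u) (f u') := by
  induction n generalizing u' with
  | zero => simp [kerIter, hf.eq_iff]
  | succ n ih =>
    simp only [kerIter]
    calc _ ≤ ∑' w, kerIter q n (f u) (f w) * q (f w) (f u') :=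
          ENNReal.tsum_le_tsum fun w => mul_le_mul' (ih w) (h w u')
      _ ≤ _ := ENNReal.tsum_comp_le_tsum_of_injective hf
          (fun w => kerIter q n (f u) w * q w (f u'))

lemma toZ_add (z w : St d) : toZ d (z + w) = toZ d z + toZ d w := by
  simp [toZ]

lemma kerIter_stepUp_add_right (w : St d) (n : ℕ) (z z' : St d) :
    kerIter (stepUp d μ) n z z' ≤ kerIter (stepUp d μ) n (z + w) (z' + w) :=
  kerIter_le_of_injective (add_left_injective w)
    (fun u u' => by simp [stepUp, toZ_add]) n z z'

lemma kerIter_stepUp_le_step {w : St d} (hw : w.2 ≠ 0) (n : ℕ) (z z' : St d) :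
    kerIter (stepUp d μ) n z z' ≤ kerIter (step d μ μ0) n (z + w) (z' + w) :=
  kerIter_le_of_injective (add_left_injective w)
    (fun u u' => by simp [stepUp, toZ_add, step, hw]) n z z'

/-- Pairs `(z, w)` with `z` on the boundary such that `0` reaches `z` with probability at
least `e^w` in some number of steps. -/
noncomputable def boundaryMoves (d : ℕ) (μ μ0 : Zd d → ℝ) : AddSubmonoid (St d × ℝ) where
  carrier := {p | p.1.2 = 0 ∧ ∃ n, ENNReal.ofReal (Real.exp p.2) ≤ kerIter (step d μ μ0) n 0 p.1}
  zero_mem' := ⟨rfl, 0, by simp [kerIter]⟩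
  add_mem' := by
    rintro ⟨z, w⟩ ⟨z', w'⟩ ⟨hz, n, hn⟩ ⟨hz', n', hn'⟩
    refine ⟨by simp_all, n + n', ?_⟩
    have h1 : shiftSt d z.1 0 = z := Prod.ext (by simp [shiftSt]) (by simpa [shiftSt] using hz.symm)
    have h2 : shiftSt d z.1 z' = z + z' :=
      Prod.ext (by simp [shiftSt, add_comm]) (by simp_all [shiftSt])
    have h3 := kerIter_step_shiftSt (μ := μ) (μ0 := μ0) z.1 n' 0 z'
    rw [h1, h2] at h3
    simp only [Prod.snd_add, Prod.fst_add, Real.exp_add, ENNReal.ofReal_mul (Real.exp_pos w).le]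
    exact (mul_le_mul' hn (hn'.trans h3.ge)).trans (kerIter_mul_le _ n n' 0 z (z + z'))

/-- Pairs `(z, w)` such that the walk killed below the hyperplane reaches `z` from `0` with
probability at least `e^w` in some number of steps. -/
noncomputable def interiorMoves (d : ℕ) (μ : Zd d → ℝ) : AddSubmonoid (St d × ℝ) where
  carrier := {p | ∃ n, ENNReal.ofReal (Real.exp p.2) ≤ kerIter (stepUp d μ) n 0 p.1}
  zero_mem' := ⟨0, by simp [kerIter]⟩
  add_mem' := by
    rintro ⟨z, w⟩ ⟨z', w'⟩ ⟨n, hn⟩ ⟨n', hn'⟩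
    refine ⟨n + n', ?_⟩
    have h3 := kerIter_stepUp_add_right (μ := μ) z n' 0 z'
    rw [zero_add, add_comm z' z] at h3
    simp only [Prod.snd_add, Prod.fst_add, Real.exp_add, ENNReal.ofReal_mul (Real.exp_pos w).le]
    exact (mul_le_mul' hn (hn'.trans h3)).trans (kerIter_mul_le _ n n' 0 z (z + z'))

lemma exists_le_kerGreen_of_mem_moves (H : Assumptions d μ μ0) :
    ∃ c : ℝ, ∀ p ∈ boundaryMoves d μ μ0 ⊔ interiorMoves d μ,
      ENNReal.ofReal (Real.exp (c + p.2)) ≤ kerGreen (step d μ μ0) 0 (p.1 + (0, 1)) := by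
  obtain ⟨ε, hε, -, N, hN⟩ := exists_uniform_localMoves H (Set.finite_singleton ((0, 1) : Zd d))
  refine ⟨Real.log ε, ?_⟩
  rintro p hp
  obtain ⟨⟨z, w⟩, ⟨hz, n, hn⟩, ⟨z', w'⟩, ⟨n', hn'⟩, rfl⟩ := AddSubmonoid.mem_sup.1 hp
  obtain ⟨m, -, hm⟩ := hN z (z + (0, 1)) (by simp [toZ])
  have h1 := kerIter_stepUp_le_step (μ := μ) (μ0 := μ0) (w := z + (0, 1)) (by simp) n' 0 z'
  rw [zero_add] at h1
  have h2 : z' + (z + (0, 1)) = z + z' + (0, 1) := by abel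
  rw [h2] at h1
  have h3 := (mul_le_mul' (mul_le_mul' hn hm) (hn'.trans h1)).trans
    ((mul_le_mul_left (kerIter_mul_le _ n m 0 z (z + (0, 1))) _).trans
      (kerIter_mul_le _ (n + m) n' 0 _ _))
  refine le_trans (le_of_eq ?_) (h3.trans (kerIter_le_kerGreen _ _ _ _))
  rw [← ENNReal.ofReal_mul (Real.exp_pos _).le, ← ENNReal.ofReal_mul (by positivity)]
  simp only [Prod.mk_add_mk, Real.exp_add, Real.exp_log hε]
  congr 1
  ring

/-- The real vector attached to a pair in `St d × ℝ`. -/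
noncomputable def movesToR (d : ℕ) : St d × ℝ →+ Rd d × ℝ where
  toFun p := (toR d (toZ d p.1), p.2)
  map_zero' := by
    refine Prod.ext (Prod.ext (funext fun i => ?_) ?_) ?_ <;> simp [toR, toZ]
  map_add' p q := by
    refine Prod.ext (Prod.ext (funext fun i => ?_) ?_) ?_ <;> simp [toR, toZ]

/-- Directions that stay within bounded distance of an additive submonoid of moves. -/
def nearCone (d : ℕ) (E : AddSubmonoid (St d × ℝ)) : Set (Rd d × ℝ) :=
  {p | ∃ C : ℝ, ∀ t : ℝ, 0 ≤ t → ∃ e ∈ E, ‖movesToR d e - t • p‖ ≤ C}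

lemma nearCone_add {E : AddSubmonoid (St d × ℝ)} {p q : Rd d × ℝ} (hp : p ∈ nearCone d E)
    (hq : q ∈ nearCone d E) : p + q ∈ nearCone d E := by
  obtain ⟨C, hC⟩ := hp
  obtain ⟨C', hC'⟩ := hq
  refine ⟨C + C', fun t ht => ?_⟩
  obtain ⟨e, he, h⟩ := hC t ht
  obtain ⟨e', he', h'⟩ := hC' t ht
  refine ⟨e + e', add_mem he he', ?_⟩
  rw [map_add, smul_add, add_sub_add_comm]
  exact (norm_add_le _ _).trans (add_le_add h h')

lemma nearCone_smul {E : AddSubmonoid (St d × ℝ)} {p : Rd d × ℝ} (hp : p ∈ nearCone d E)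
    {r : ℝ} (hr : 0 ≤ r) : r • p ∈ nearCone d E := by
  obtain ⟨C, hC⟩ := hp
  refine ⟨C, fun t ht => ?_⟩
  rw [smul_smul]
  exact hC _ (mul_nonneg ht hr)

lemma convex_nearCone (E : AddSubmonoid (St d × ℝ)) : Convex ℝ (nearCone d E) :=
  fun _ hp _ hq _ _ hr hs _ => nearCone_add (nearCone_smul hp hr) (nearCone_smul hq hs)

lemma movesToR_mem_nearCone {E : AddSubmonoid (St d × ℝ)} {e : St d × ℝ} (he : e ∈ E) :
    movesToR d e ∈ nearCone d E := by
  refine ⟨‖movesToR d e‖, fun t ht => ⟨⌊t⌋₊ • e, nsmul_mem he _, ?_⟩⟩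
  rw [map_nsmul, ← Nat.cast_smul_eq_nsmul ℝ, ← sub_smul, norm_smul]
  refine mul_le_of_le_one_left (norm_nonneg _) ?_
  have h1 := Nat.floor_le ht
  have h2 := Nat.lt_floor_add_one t
  rw [Real.norm_eq_abs, abs_le]
  constructor <;> linarith

lemma exists_dotR_eq (g : Rd d →ₗ[ℝ] ℝ) : ∃ b : Rd d, ∀ q, g q = dotR d b q := by
  refine ⟨(fun i => g (Pi.single i 1, 0), g (0, 1)), fun q => ?_⟩
  have h1 : q = (q.1, 0) + q.2 • ((0, 1) : Rd d) := by ext <;> simp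
  have h2 := LinearMap.pi_apply_eq_sum_univ (g ∘ₗ LinearMap.inl ℝ (Fin (d - 1) → ℝ) ℝ) q.1
  rw [h1, map_add, map_smul]
  simp only [LinearMap.comp_apply, LinearMap.inl_apply] at h2
  rw [h2]
  simp only [dotR, smul_eq_mul]
  congr 1
  · refine Finset.sum_congr rfl fun i _ => ?_
    rw [mul_comm]
    simp only [Prod.fst_add, Prod.smul_fst, smul_zero, add_zero]
    congr 2
    ext j <;> simp [Pi.single_apply, eq_comm]
  · simp [mul_comm]

lemma exists_functional_of_notMem {E : AddSubmonoid (St d × ℝ)} {x : Rd d × ℝ}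
    (hx : x ∉ closure (nearCone d E)) :
    ∃ (b : Rd d) (s : ℝ), (∀ e ∈ E, dotZ d b (toZ d e.1) + s * e.2 ≤ 0) ∧
      0 < dotR d b x.1 + s * x.2 := by
  obtain ⟨f, u, hfx, hfu⟩ := geometric_hahn_banach_point_closed
    (convex_nearCone E).closure isClosed_closure hx
  obtain ⟨b, hb⟩ := exists_dotR_eq (-(f.toLinearMap ∘ₗ LinearMap.inl ℝ (Rd d) ℝ))
  have hdec : ∀ p : Rd d × ℝ, dotR d b p.1 + -f (0, 1) * p.2 = -f p := by
    intro p
    have h1 : p = (p.1, 0) + p.2 • ((0, 1) : Rd d × ℝ) := by ext <;> simp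
    rw [← hb]
    conv_rhs => rw [h1, map_add, map_smul]
    simp only [LinearMap.neg_apply, LinearMap.comp_apply, LinearMap.inl_apply, smul_eq_mul,
      ContinuousLinearMap.coe_coe]
    ring
  have h0 : ∀ p ∈ nearCone d E, 0 ≤ f p := by
    intro p hp
    by_contra! hneg
    have h1 := hfu _ (subset_closure (nearCone_smul hp (r := |u| / -f p) (by
      have := abs_nonneg u
      exact div_nonneg this (by linarith))))
    rw [map_smul, smul_eq_mul, div_mul_eq_mul_div, mul_div_assoc, div_neg, div_self hneg.ne,
      mul_neg, mul_one] at h1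
    linarith [neg_abs_le u]
  have hu : u < 0 := by
    have := hfu 0 (subset_closure (by simpa using movesToR_mem_nearCone (zero_mem E)))
    simpa using this
  refine ⟨b, -f (0, 1), fun e he => ?_, ?_⟩
  · have := hdec (movesToR d e)
    have h2 := h0 _ (movesToR_mem_nearCone he)
    change dotZ d b (toZ d e.1) + _ = _ at this
    simp only [movesToR, AddMonoidHom.coe_mk, ZeroHom.coe_mk] at this h2 ⊢
    linarith
  · rw [hdec]
    linarith

/-- Space-time directions along which the Green function from the origin decays at most
at a given exponential rate, locally uniformly. -/
def decayBounds (d : ℕ) (μ μ0 : Zd d → ℝ) (M : ℝ) : Set (Rd d × ℝ) :=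
  {p | ∀ ε : ℝ, 0 < ε → ∃ T : ℝ, ∀ t : ℝ, T ≤ t → ∀ z : St d,
    ENNReal.ofReal (Real.exp (t * (p.2 - ε) - M * ‖toR d (toZ d z) - t • p.1‖)) ≤
      kerGreen (step d μ μ0) 0 z}

lemma isClosed_decayBounds {M : ℝ} (hM : 0 ≤ M) : IsClosed (decayBounds d μ μ0 M) := by
  refine isClosed_of_closure_subset fun p hp ε hε => ?_
  obtain ⟨q, hq, hpq⟩ := Metric.mem_closure_iff.1 hp (ε / (2 * (M + 1))) (by positivity)
  obtain ⟨T, hT⟩ := hq (ε / 2) (by positivity)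
  refine ⟨max T 0, fun t ht z => le_trans (ENNReal.ofReal_le_ofReal (Real.exp_le_exp.2 ?_))
    (hT t ((le_max_left _ _).trans ht) z)⟩
  have ht0 : 0 ≤ t := (le_max_right _ _).trans ht
  rw [dist_eq_norm] at hpq
  have h1 : ‖p.1 - q.1‖ ≤ ‖p - q‖ := norm_fst_le (p - q)
  have h2 : |p.2 - q.2| ≤ ‖p - q‖ := norm_snd_le (p - q)
  have h3 : ‖toR d (toZ d z) - t • q.1‖ ≤ ‖toR d (toZ d z) - t • p.1‖ + t * ‖p - q‖ := by
    have : toR d (toZ d z) - t • q.1 = (toR d (toZ d z) - t • p.1) + t • (p.1 - q.1) := by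
      rw [smul_sub]; abel
    rw [this]
    refine (norm_add_le _ _).trans ?_
    rw [norm_smul, Real.norm_of_nonneg ht0]
    gcongr
  have h4 : (M + 1) * ‖p - q‖ ≤ ε / 2 := by
    rw [lt_div_iff₀ (by positivity)] at hpq
    linarith
  have h5 := mul_le_mul_of_nonneg_left h3 hM
  have h6 := mul_le_mul_of_nonneg_left h4 ht0
  have h7 := mul_le_mul_of_nonneg_left ((le_abs_self _).trans h2) ht0
  linarith

lemma nearCone_subset_decayBounds (H : Assumptions d μ μ0) {M : ℝ} (hM : 0 ≤ M)
    (hH : ∀ z z' : St d, ∃ m, ENNReal.ofReal (Real.exp (-(M * ‖toR d (toZ d z' - toZ d z)‖))) ≤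
      kerIter (step d μ μ0) m z z') :
    nearCone d (boundaryMoves d μ μ0 ⊔ interiorMoves d μ) ⊆ decayBounds d μ μ0 M := by
  rintro p ⟨C, hC⟩ ε hε
  obtain ⟨c, hc⟩ := exists_le_kerGreen_of_mem_moves H
  refine ⟨max 0 ((|c| + C + M * (C + 1)) / ε), fun t ht z => ?_⟩
  have ht0 : 0 ≤ t := (le_max_left _ _).trans ht
  obtain ⟨e, he, hte⟩ := hC t ht0
  obtain ⟨m, hm⟩ := hH (e.1 + (0, 1)) z
  refine le_trans ?_ ((mul_le_mul' (hc e he) hm).trans (kerGreen_mul_kerIter_le _ m 0 _ z))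
  rw [← ENNReal.ofReal_mul (Real.exp_pos _).le, ← Real.exp_add]
  refine ENNReal.ofReal_le_ofReal (Real.exp_le_exp.2 ?_)
  have h1 : ‖toR d (toZ d e.1) - t • p.1‖ ≤ C := (norm_fst_le (movesToR d e - t • p)).trans hte
  have h2 : |e.2 - t * p.2| ≤ C := (norm_snd_le (movesToR d e - t • p)).trans hte
  have h3 : ‖toR d (toZ d z - toZ d (e.1 + (0, 1)))‖ ≤ ‖toR d (toZ d z) - t • p.1‖ + (C + 1) := by
    have h4 : toR d (toZ d z - toZ d (e.1 + (0, 1))) =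
        (toR d (toZ d z) - t • p.1) - ((toR d (toZ d e.1) - t • p.1) + (0, 1)) := by
      ext
      · simp [toR, toZ]
      · simp [toR, toZ]
        ring
    rw [h4]
    refine (norm_sub_le _ _).trans (add_le_add le_rfl ((norm_add_le _ _).trans
      (add_le_add h1 ?_)))
    simp [Prod.norm_def]
  have h4 : |c| + C + M * (C + 1) ≤ t * ε := by
    rw [← div_le_iff₀ hε]
    exact (le_max_right _ _).trans ht
  have h5 := mul_le_mul_of_nonneg_left h3 hM
  linarith [neg_abs_le c, (abs_le.1 h2).1]

end LowerBound

section Separation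

variable {d : ℕ} {μ μ0 : Zd d → ℝ}

lemma tsum_pi_mul (m : ℕ) (g : ℤ → ℝ≥0∞) :
    ∑' x : Fin m → ℤ, ∏ i, g (x i) = (∑' k, g k) ^ m := by
  induction m with
  | zero => simp
  | succ m ih =>
    rw [← (Fin.consEquiv (fun _ => ℤ)).tsum_eq, ENNReal.tsum_prod', pow_succ', ← ih,
      ← ENNReal.tsum_mul_right]
    refine tsum_congr fun k => ?_
    rw [← ENNReal.tsum_mul_left]
    refine tsum_congr fun x => ?_
    simp [Fin.prod_univ_succ, Fin.consEquiv]

lemma tsum_exp_neg_norm_ne_top (hd : 1 ≤ d) {η : ℝ} (hη : 0 < η) :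
    ∑' z : St d, ENNReal.ofReal (Real.exp (-(η * ‖toR d (toZ d z)‖))) ≠ ⊤ := by
  have hd0 : (0 : ℝ) < d := by exact_mod_cast hd
  set c := η / d with hc
  have hc0 : 0 < c := by positivity
  have hbound : ∀ z : St d, ENNReal.ofReal (Real.exp (-(η * ‖toR d (toZ d z)‖))) ≤
      (∏ i, ENNReal.ofReal (Real.exp (-(c * |(z.1 i : ℝ)|)))) *
        ENNReal.ofReal (Real.exp (-(c * z.2))) := by
    intro z
    rw [← ENNReal.ofReal_prod_of_nonneg (fun _ _ => (Real.exp_pos _).le), ← Real.exp_sum,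
      ← ENNReal.ofReal_mul (Real.exp_pos _).le, ← Real.exp_add]
    refine ENNReal.ofReal_le_ofReal (Real.exp_le_exp.2 ?_)
    have h1 : ∀ i, |(z.1 i : ℝ)| ≤ ‖toR d (toZ d z)‖ := fun i =>
      (norm_le_pi_norm (toR d (toZ d z)).1 i).trans (norm_fst_le (toR d (toZ d z)))
    have h2 : (z.2 : ℝ) ≤ ‖toR d (toZ d z)‖ := by
      refine le_trans ?_ ((le_abs_self _).trans (norm_snd_le (toR d (toZ d z))))
      simp [toR, toZ]
    have h3 : ∑ i, |(z.1 i : ℝ)| ≤ ((d - 1 : ℕ) : ℝ) * ‖toR d (toZ d z)‖ := by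
      refine (Finset.sum_le_sum fun i _ => h1 i).trans ?_
      simp
    rw [Finset.sum_neg_distrib, ← Finset.mul_sum]
    have h4 : c * (∑ i, |(z.1 i : ℝ)| + z.2) ≤ c * (d * ‖toR d (toZ d z)‖) := by
      gcongr
      rw [Nat.cast_sub hd] at h3
      push_cast at h3
      linarith
    have h5 : c * (d * ‖toR d (toZ d z)‖) = η * ‖toR d (toZ d z)‖ := by
      rw [hc]; field_simp
    linarith
  refine ne_top_of_le_ne_top ?_ (ENNReal.tsum_le_tsum hbound)
  rw [ENNReal.tsum_prod']
  simp_rw [ENNReal.tsum_mul_left]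
  rw [ENNReal.tsum_mul_right, tsum_pi_mul (d - 1) fun k => ENNReal.ofReal (Real.exp (-(c * |(k : ℝ)|)))]
  have hnat : Summable fun n : ℕ => Real.exp (-(c * n)) := by
    have := Real.summable_exp_nat_mul_iff.2 (neg_neg_of_pos hc0)
    refine this.congr fun n => ?_
    congr 1; ring
  have hint : Summable fun k : ℤ => Real.exp (-(c * |(k : ℝ)|)) := by
    refine Summable.of_nat_of_neg ?_ ?_ <;> simpa using hnat
  exact ENNReal.mul_ne_top (ENNReal.pow_ne_top hint.tsum_ofReal_ne_top) hnat.tsum_ofReal_ne_top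

lemma le_ofReal_exp_of_mul_le {X : ℝ≥0∞} {u A : ℝ}
    (h : X * ENNReal.ofReal (Real.exp u) ≤ ENNReal.ofReal (Real.exp A)) :
    X ≤ ENNReal.ofReal (Real.exp (A - u)) := by
  have h1 := mul_le_mul_left h (ENNReal.ofReal (Real.exp (-u)))
  rwa [mul_assoc, ← ENNReal.ofReal_mul (Real.exp_pos _).le, ← Real.exp_add, add_neg_cancel,
    Real.exp_zero, ENNReal.ofReal_one, mul_one, ← ENNReal.ofReal_mul (Real.exp_pos _).le,
    ← Real.exp_add, ← sub_eq_add_neg] at h1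

lemma le_ofReal_exp_interp {X : ℝ≥0∞} {A B s : ℝ} (hs : 0 ≤ s) (hs1 : s ≤ 1)
    (hA : X ≤ ENNReal.ofReal (Real.exp A)) (hB : X ≤ ENNReal.ofReal (Real.exp B)) :
    X ≤ ENNReal.ofReal (Real.exp ((1 - s) * A + s * B)) := by
  rcases le_total A B with h | h
  · exact hA.trans (ENNReal.ofReal_le_ofReal (Real.exp_le_exp.2 (by nlinarith)))
  · exact hB.trans (ENNReal.ofReal_le_ofReal (Real.exp_le_exp.2 (by nlinarith)))

/-- Interpolating a trivial exponential bound with a strict contraction gives summability. -/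
lemma kerIter_mul_expW_interp {p : St d → St d → ℝ≥0∞} {b c : Rd d} {δ κ s : ℝ} (hδ : 0 ≤ δ)
    (hκ : 0 < κ) (hs : 0 ≤ s) (hs1 : s ≤ 1)
    (hp : ∀ b', ‖b' - c‖ ≤ δ → kerOp p (expW d b') ≤ ENNReal.ofReal κ • expW d b')
    {n : ℕ} {z : St d}
    (hb : kerIter p n 0 z ≤ ENNReal.ofReal (Real.exp (-dotZ d b (toZ d z)))) :
    kerIter p n 0 z * expW d ((1 - s) • b + s • c) z ≤
      ENNReal.ofReal (Real.exp (s * Real.log κ)) ^ n *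
        ENNReal.ofReal (Real.exp (-(s * δ * ‖toR d (toZ d z)‖))) := by
  have h1 := kerIter_le_of_ball hδ hp n 0 z
  have h0 : toZ d z - toZ d 0 = toZ d z := by simp [toZ]
  have hk : ENNReal.ofReal κ ^ n = ENNReal.ofReal (Real.exp (n * Real.log κ)) := by
    rw [Real.exp_nat_mul, Real.exp_log hκ, ENNReal.ofReal_pow hκ.le]
  rw [h0, hk] at h1
  have h2 := le_ofReal_exp_interp hs hs1 hb (le_ofReal_exp_of_mul_le h1)
  refine (mul_le_mul_left h2 _).trans (le_of_eq ?_)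
  rw [expW, ← ENNReal.ofReal_mul (Real.exp_pos _).le, ← Real.exp_add,
    ← ENNReal.ofReal_pow (Real.exp_pos _).le, ← Real.exp_nat_mul,
    ← ENNReal.ofReal_mul (Real.exp_pos _).le, ← Real.exp_add, dotZ_add_left, dotZ_smul_left,
    dotZ_smul_left]
  congr 2
  ring

lemma le_ofReal_exp_neg_of_log {X : ℝ≥0∞} {u : ℝ}
    (h : ∀ w : ℝ, ENNReal.ofReal (Real.exp w) ≤ X → u + w ≤ 0) :
    X ≤ ENNReal.ofReal (Real.exp (-u)) := by
  by_contra! hlt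
  obtain ⟨r, hr1, hr2⟩ := ENNReal.lt_iff_exists_nnreal_btwn.1 hlt
  have hr0 : (0 : ℝ) < r := by
    have := (ENNReal.ofReal_pos.2 (Real.exp_pos (-u))).trans hr1
    exact_mod_cast this
  have h1 := h (Real.log r) (by rw [Real.exp_log hr0, ENNReal.ofReal_coe_nnreal]; exact hr2.le)
  have h2 : Real.exp (-u) < r := by
    rw [ENNReal.ofReal, ENNReal.coe_lt_coe, ← NNReal.coe_lt_coe, Real.coe_toNNReal _ (Real.exp_pos _).le] at hr1
    exact hr1
  have h3 := (Real.lt_log_iff_exp_lt hr0).2 h2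
  linarith

lemma dotR_nonpos_of_mem_Dhat (H : Assumptions d μ μ0) {a q b c : Rd d} {δ κ s : ℝ}
    (hc : IsContraction d μ μ0 c δ κ) (hs : 0 < s) (hs1 : s < 1)
    (hq : q ∈ normalCone d (Dhat d μ μ0) a) (hq2 : 0 ≤ q.2)
    (hbB : ∀ e ∈ boundaryMoves d μ μ0, dotZ d b (toZ d e.1) + e.2 ≤ 0)
    (hbI : ∀ e ∈ interiorMoves d μ, dotZ d b (toZ d e.1) + e.2 ≤ 0) :
    dotR d q ((1 - s) • b + s • c - a) ≤ 0 := by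
  set bs := (1 - s) • b + s • c with hbs
  set κs := ENNReal.ofReal (Real.exp (s * Real.log κ)) with hκs
  have hκs1 : κs < 1 := by
    rw [hκs, ENNReal.ofReal_lt_one, Real.exp_lt_one_iff]
    exact mul_neg_of_pos_of_neg hs (Real.log_neg hc.κ_pos hc.κ_lt)
  set C := ∑' z : St d, ENNReal.ofReal (Real.exp (-(s * δ * ‖toR d (toZ d z)‖))) with hC
  have hCtop : C ≠ ⊤ := tsum_exp_neg_norm_ne_top H.one_le (mul_pos hs hc.δ_pos)
  set ψ : St d → ℝ≥0∞ := fun z => if z.2 = 0 then expW d bs z else 0 with hψ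
  set A := kerOp (step d μ μ0) with hA
  set U : St d → ℝ≥0∞ := fun z => ∑' n : ℕ, (A ^ n) ψ z with hU
  have hUeq : ∀ z, U z = ψ z + A U z := fun z => potential_eq A ψ z (kerOp_tsum _)
  have hsuper : A U ≤ U := fun z => (hUeq z).symm ▸ le_add_self
  have hU0 : U 0 ≠ ⊤ := by
    have h1 : ∀ n, (A ^ n) ψ 0 ≤ κs ^ n * C := by
      intro n
      rw [hA, kerOp_pow_apply, hC, ← ENNReal.tsum_mul_left]
      refine ENNReal.tsum_le_tsum fun z => ?_
      by_cases hz : z.2 = 0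
      · simp only [hψ, if_pos hz]
        refine kerIter_mul_expW_interp hc.δ_pos.le hc.κ_pos hs.le hs1.le (hc.kerOp_step_le H) ?_
        exact le_ofReal_exp_neg_of_log fun w hw => hbB (z, w) ⟨hz, n, hw⟩
      · simp [hψ, if_neg hz]
    refine ne_top_of_le_ne_top ?_ (ENNReal.tsum_le_tsum h1)
    rw [ENNReal.tsum_mul_right, ENNReal.tsum_geometric]
    refine ENNReal.mul_ne_top ?_ hCtop
    rw [ENNReal.inv_ne_top]
    exact (tsub_pos_of_lt hκs1).ne'
  have hpow : ∀ n z z', kerIter (step d μ μ0) n z z' * U z' ≤ U z := fun n z z' =>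
    (kerIter_mul_le_pow _ n z z' U).trans (pow_apply_le (kerOp_mono _) hsuper n z)
  have hUtop : ∀ z, U z ≠ ⊤ := by
    intro z h
    obtain ⟨n, hn⟩ := H.h1 0 z
    have := hpow n 0 z
    rw [h, ENNReal.mul_top (show kerIter (step d μ μ0) n 0 z ≠ 0 from hn.ne'), top_le_iff] at this
    exact hU0 this
  have hUpos : ∀ z, 0 < U z := by
    intro z
    obtain ⟨n, hn⟩ := H.h1 z 0
    have h1 : 0 < U 0 := by
      rw [hUeq]
      refine lt_of_lt_of_le ?_ le_self_add
      simpa [hψ] using expW_pos d bs 0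
    exact (ENNReal.mul_pos hn.ne' h1.ne').trans_le (hpow n z 0)
  have hshift : ∀ k z, U (shiftSt d k z) =
      ENNReal.ofReal (Real.exp (dotZ d bs (k, 0))) * U z := by
    intro k z
    simp only [hU]
    rw [← ENNReal.tsum_mul_left]
    refine tsum_congr fun n => ?_
    rw [hA, kerOp_pow_apply, kerOp_pow_apply, ← (shiftSt d k).tsum_eq, ← ENNReal.tsum_mul_left]
    refine tsum_congr fun w => ?_
    rw [kerIter_step_shiftSt]
    have : ψ (shiftSt d k w) = ENNReal.ofReal (Real.exp (dotZ d bs (k, 0))) * ψ w := by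
      simp only [hψ, expW_shiftSt, mul_ite, mul_zero]
      rfl
    rw [this]
    ring
  obtain ⟨t, ht, ht0, -⟩ := exists_rate_of_superharmonic H bs hUpos hUtop hshift hsuper
  rcases le_or_gt (jgf d μ bs) 1 with hbs1 | hbs1
  · exact hq bs (mem_Dhat_of_le H ht ht0 hbs1)
  have htb : bs.2 ≤ t := by
    by_contra! hlt
    obtain ⟨η, hη, hηle⟩ := exists_le_stepUp_pow H hbs1.le ht hlt
    have h1 : ∀ n, η ≤ κs ^ n * C := by
      intro n
      refine (hηle n).trans ?_
      rw [kerOp_pow_apply, hC, ← ENNReal.tsum_mul_left]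
      refine ENNReal.tsum_le_tsum fun z => ?_
      refine kerIter_mul_expW_interp hc.δ_pos.le hc.κ_pos hs.le hs1.le (hc.kerOp_stepUp_le H) ?_
      exact le_ofReal_exp_neg_of_log fun w hw => hbI (z, w) ⟨n, hw⟩
    have h2 : Tendsto (fun n => κs ^ n * C) atTop (nhds (0 * C)) :=
      ENNReal.Tendsto.mul_const (ENNReal.tendsto_pow_atTop_nhds_zero_of_lt_one hκs1) (Or.inr hCtop)
    rw [zero_mul] at h2
    exact hη (nonpos_iff_eq_zero.1 (ge_of_tendsto' h2 h1))
  have h1 := hq (bs.1, t) (mem_Dhat_of_le H (b := (bs.1, t)) ht ht0 ht)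
  have h2 : dotR d q (bs - a) = dotR d q ((bs.1, t) - a) - q.2 * (t - bs.2) := by
    simp only [dotR, Prod.fst_sub, Prod.snd_sub]
    ring
  have h3 := mul_nonneg hq2 (sub_nonneg.2 htb)
  linarith

lemma dotR_sub_nonpos_of_moves (H : Assumptions d μ μ0) {a q b : Rd d}
    (hq : q ∈ normalCone d (Dhat d μ μ0) a) (hq2 : 0 ≤ q.2)
    (hbB : ∀ e ∈ boundaryMoves d μ μ0, dotZ d b (toZ d e.1) + e.2 ≤ 0)
    (hbI : ∀ e ∈ interiorMoves d μ, dotZ d b (toZ d e.1) + e.2 ≤ 0) :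
    dotR d q (b - a) ≤ 0 := by
  obtain ⟨c, δ, κ, hc⟩ := exists_isContraction H
  by_contra! hpos
  set X := dotR d q (b - a)
  set Y := dotR d q (c - a)
  set s := X / (2 * (X + |Y| + 1)) with hs
  have hY := abs_nonneg Y
  have hs0 : 0 < s := by positivity
  have hs1 : s < 1 := by
    rw [hs, div_lt_one (by positivity)]
    linarith
  have h1 := dotR_nonpos_of_mem_Dhat H hc hs0 hs1 hq hq2 hbB hbI
  have h2 : (1 - s) • b + s • c - a = (1 - s) • (b - a) + s • (c - a) := by module
  rw [h2, dotR_add_right, dotR_smul_right, dotR_smul_right] at h1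
  have h3 : s * (2 * (X + |Y| + 1)) = X := by
    rw [hs]; field_simp
  have h4 := mul_le_mul_of_nonneg_left (neg_abs_le Y) hs0.le
  change (1 - s) * X + s * Y ≤ 0 at h1
  nlinarith

/-- The Green function decays no faster than `e^{-a·z}` in the directions normal to `D̂`
at `a`. -/
lemma normalCone_mem_decayBounds (H : Assumptions d μ μ0) {M : ℝ} (hM : 0 ≤ M)
    (hH : ∀ z z' : St d, ∃ m, ENNReal.ofReal (Real.exp (-(M * ‖toR d (toZ d z' - toZ d z)‖))) ≤
      kerIter (step d μ μ0) m z z') {a q : Rd d}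
    (hq : q ∈ normalCone d (Dhat d μ μ0) a) (hq2 : 0 ≤ q.2) :
    (q, -dotR d a q) ∈ decayBounds d μ μ0 M := by
  refine (isClosed_decayBounds hM).closure_subset_iff.2 (nearCone_subset_decayBounds H hM hH) ?_
  by_contra hx
  obtain ⟨b, s, hbs, hpos⟩ := exists_functional_of_notMem hx
  have hB : ∀ e ∈ boundaryMoves d μ μ0, dotZ d b (toZ d e.1) + s * e.2 ≤ 0 := fun e he =>
    hbs e ((le_sup_left : boundaryMoves d μ μ0 ≤ _) he)
  have hI : ∀ e ∈ interiorMoves d μ, dotZ d b (toZ d e.1) + s * e.2 ≤ 0 := fun e he =>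
    hbs e ((le_sup_right : interiorMoves d μ ≤ _) he)
  have hs0 : 0 ≤ s := by
    have := hB (0, -1) ⟨rfl, 0, by simp [kerIter]⟩
    simpa [toZ, dotZ] using this
  rcases hs0.eq_or_lt with hs | hs
  · subst hs
    have hb1 : ∀ x : Fin (d - 1) → ℤ, dotZ d b (x, 0) ≤ 0 := by
      intro x
      obtain ⟨n, hn⟩ := H.h1 0 (x, 0)
      obtain ⟨r, hr1, hr2⟩ := ENNReal.lt_iff_exists_nnreal_btwn.1 hn
      have hr0 : (0 : ℝ) < r := by exact_mod_cast hr1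
      have := hB ((x, 0), Real.log r) ⟨rfl, n, by
        rw [Real.exp_log hr0, ENNReal.ofReal_coe_nnreal]; exact hr2.le⟩
      simpa [toZ] using this
    have hb0 : b.1 = 0 := by
      funext i
      have h1 := hb1 (Pi.single i 1)
      have h2 := hb1 (-Pi.single i 1)
      simp [dotZ, Pi.single_apply] at h1 h2
      exact le_antisymm h1 h2
    obtain ⟨w, hw, hw2⟩ := H.exists_pos
    obtain ⟨y, hy⟩ := Int.eq_ofNat_of_zero_le (by omega : 0 ≤ w.2)
    have hwz : toZ d (w.1, y) = w := Prod.ext rfl hy.symm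
    have h1 := hI ((w.1, y), Real.log (μ w)) ⟨1, by
      have h0 : w - toZ d 0 = w := by simp [toZ]
      rw [Real.exp_log hw, kerIter_one, stepUp, hwz, h0]⟩
    rw [hwz] at h1
    have hw2' : (1 : ℝ) ≤ w.2 := by exact_mod_cast hw2
    simp only [dotZ, hb0, Pi.zero_apply, zero_mul, Finset.sum_const_zero, zero_add, add_zero] at h1
    simp only [dotR, hb0, Pi.zero_apply, zero_mul, Finset.sum_const_zero, zero_add, add_zero] at hpos
    nlinarith
  · have hscale : ∀ e : St d × ℝ, dotZ d b (toZ d e.1) + s * e.2 ≤ 0 →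
        dotZ d (s⁻¹ • b) (toZ d e.1) + e.2 ≤ 0 := by
      intro e he
      rw [dotZ_smul_left]
      have : s⁻¹ * (dotZ d b (toZ d e.1) + s * e.2) ≤ 0 :=
        mul_nonpos_of_nonneg_of_nonpos (inv_pos.2 hs).le he
      rwa [mul_add, inv_mul_cancel_left₀ hs.ne'] at this
    have h1 := dotR_sub_nonpos_of_moves H hq hq2 (fun e he => hscale e (hB e he))
      (fun e he => hscale e (hI e he))
    rw [dotR_sub_right, dotR_smul_right, dotR_comm q b, dotR_comm q a] at h1
    simp only at hpos
    have h2 := mul_nonpos_of_nonneg_of_nonpos hs.le h1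
    rw [mul_sub, mul_inv_cancel_left₀ hs.ne'] at h2
    linarith

end Separation

section Binomial

lemma exists_inv_pow_add_pow_lt_two (q : ℕ) :
    ∃ u : ℝ, 0 < u ∧ u < 1 ∧ u ^ (q + 1) + (u⁻¹) ^ q < 2 := by
  have hcont : Continuous fun u : ℝ =>
      u ^ (2 * q) - (1 - u) * (∑ i ∈ Finset.range q, u ^ i) ^ 2 := by fun_prop
  have h1 := (hcont.tendsto 1).eventually_const_lt (u := 0) (by simp)
  have h2 : ∀ᶠ u : ℝ in nhdsWithin 1 (Set.Iio 1), 0 < u ∧ u < 1 ∧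
      0 < u ^ (2 * q) - (1 - u) * (∑ i ∈ Finset.range q, u ^ i) ^ 2 := by
    filter_upwards [nhdsWithin_le_nhds h1, self_mem_nhdsWithin,
      nhdsWithin_le_nhds (lt_mem_nhds (zero_lt_one (α := ℝ)))] with u hu hu1 hu0
    exact ⟨hu0, hu1, hu⟩
  obtain ⟨u, hu0, hu1, hu⟩ := h2.exists
  refine ⟨u, hu0, hu1, ?_⟩
  have hg : (1 - u) * ∑ i ∈ Finset.range q, u ^ i = 1 - u ^ q := mul_neg_geom_sum u q
  have hq : 0 < u ^ q := pow_pos hu0 q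
  have h3 : u ^ (q + 1) * u ^ q + 1 < 2 * u ^ q := by
    have h4 := mul_pos (sub_pos.2 hu1) hu
    have h5 : (1 - u) * (u ^ (2 * q) - (1 - u) * (∑ i ∈ Finset.range q, u ^ i) ^ 2) =
        (1 - u) * (u ^ q) ^ 2 - (1 - u ^ q) ^ 2 := by
      rw [← hg]; ring
    rw [h5] at h4
    have h6 : u ^ (q + 1) = u * u ^ q := pow_succ' u q
    rw [h6]
    nlinarith
  rw [inv_pow]
  refine lt_of_mul_lt_mul_right ?_ hq.le
  rw [add_mul, inv_mul_cancel₀ hq.ne']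
  exact h3

/-- A comparison between neighbouring binomial coefficients. -/
lemma exists_choose_le {η : ℝ} (hη : 0 < η) : ∃ x l : ℝ, 0 < x ∧ 0 < l ∧ x + l < 2 ∧
    ∀ i m : ℕ, m ≤ i →
      (i.choose m : ℝ) ≤ (1 + η) * i.choose (m + 1) + l * (i.choose m * (l ^ m * x ^ (i - m))) := by
  obtain ⟨q, hq⟩ := exists_nat_gt (1 / η)
  have hq0 : (0 : ℝ) < q := (by positivity : (0 : ℝ) < 1 / η).trans hq
  have hηq : 1 < η * q := by
    rw [div_lt_iff₀ hη] at hq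
    linarith
  obtain ⟨u, hu0, hu1, hu⟩ := exists_inv_pow_add_pow_lt_two q
  refine ⟨u ^ (q + 1), u⁻¹ ^ q, by positivity, by positivity, hu, fun i m hm => ?_⟩
  obtain ⟨j, rfl⟩ := Nat.exists_eq_add_of_le hm
  rw [Nat.add_sub_cancel_left]
  have hch : ((m + j).choose (m + 1) : ℝ) * (m + 1) = (m + j).choose m * j := by
    have := Nat.choose_succ_right_eq (m + j) m
    rw [Nat.add_sub_cancel_left] at this
    exact_mod_cast this
  have hC : (0 : ℝ) ≤ (m + j).choose m := by positivity
  rcases le_or_gt (q * (m + 1)) ((q + 1) * j) with h | h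
  · have h1 : (q : ℝ) * (m + 1) ≤ (q + 1) * j := by exact_mod_cast h
    have h2 : ((m + j).choose m : ℝ) ≤ (1 + η) * (m + j).choose (m + 1) := by
      have hm0 : (0 : ℝ) < q * (m + 1) := by positivity
      refine le_of_mul_le_mul_right ?_ hm0
      have h3 : (1 + η) * ((m + j).choose (m + 1) : ℝ) * (q * (m + 1)) =
          (m + j).choose m * ((q + η * q) * j) := by
        linear_combination (1 + η) * q * hch
      rw [h3]
      have h4 : ((q : ℝ) + 1) * j ≤ (q + η * q) * j := by gcongr
      exact mul_le_mul_of_nonneg_left (h1.trans h4) hC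
    have h3 : 0 ≤ u⁻¹ ^ q * (((m + j).choose m : ℝ) * ((u⁻¹ ^ q) ^ m * (u ^ (q + 1)) ^ j)) := by
      positivity
    linarith
  · have h1 : 1 ≤ u⁻¹ ^ q * ((u⁻¹ ^ q) ^ m * (u ^ (q + 1)) ^ j) := by
      have h2 : u⁻¹ ^ q * ((u⁻¹ ^ q) ^ m * (u ^ (q + 1)) ^ j) =
          u⁻¹ ^ (q * (m + 1)) * u ^ ((q + 1) * j) := by
        rw [pow_mul, pow_mul, pow_succ (u⁻¹ ^ q)]
        ring
      obtain ⟨r, hr⟩ := Nat.exists_eq_add_of_le h.le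
      rw [h2, hr, pow_add, mul_right_comm, ← mul_pow, inv_mul_cancel₀ hu0.ne', one_pow, one_mul]
      exact one_le_pow₀ (one_le_inv₀ hu0 |>.2 hu1.le)
    have h3 : (0 : ℝ) ≤ (1 + η) * (m + j).choose (m + 1) := by positivity
    nlinarith

variable {S : Type*}

lemma commute_pow_apply_add {A B : Module.End ℝ≥0∞ (S → ℝ≥0∞)} (h : Commute A B) (n : ℕ)
    (f : S → ℝ≥0∞) :
    ((A + B) ^ n) f = ∑ m ∈ Finset.range (n + 1), (n.choose m : ℝ≥0∞) • (A ^ m) ((B ^ (n - m)) f) := by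
  rw [h.add_pow, LinearMap.sum_apply]
  refine Finset.sum_congr rfl fun m _ => ?_
  rw [Module.End.mul_apply, Module.End.mul_apply, Module.End.natCast_apply, map_nsmul, map_nsmul,
    Nat.cast_smul_eq_nsmul]

lemma smul_one_pow (x : ℝ≥0∞) (n : ℕ) (f : S → ℝ≥0∞) :
    ((x • (1 : Module.End ℝ≥0∞ (S → ℝ≥0∞))) ^ n) f = x ^ n • f := by
  rw [smul_pow, one_pow]; rfl

lemma apply_one_add_pow_le (T : Module.End ℝ≥0∞ (S → ℝ≥0∞)) {c x l : ℝ≥0∞} (i : ℕ)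
    (hcoef : ∀ m ≤ i, (i.choose m : ℝ≥0∞) ≤
      c * i.choose (m + 1) + l * (i.choose m * (l ^ m * x ^ (i - m))))
    (f : S → ℝ≥0∞) :
    T (((T + 1) ^ i) f) ≤ c • ((T + 1) ^ i) f + l • T (((l • T + x • 1) ^ i) f) := by
  have h1 : ((T + 1) ^ i) f = ∑ m ∈ Finset.range (i + 1), (i.choose m : ℝ≥0∞) • (T ^ m) f := by
    rw [commute_pow_apply_add (Commute.one_right T)]
    simp
  have h2 : ((l • T + x • (1 : Module.End ℝ≥0∞ (S → ℝ≥0∞))) ^ i) f =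
      ∑ m ∈ Finset.range (i + 1), (i.choose m * (l ^ m * x ^ (i - m)) : ℝ≥0∞) • (T ^ m) f := by
    rw [commute_pow_apply_add (((Commute.one_right T).smul_right x).smul_left l)]
    refine Finset.sum_congr rfl fun m _ => ?_
    rw [smul_one_pow, smul_pow, LinearMap.smul_apply, map_smul, smul_smul, smul_smul, mul_assoc]
  have h3 : ∑ m ∈ Finset.range (i + 1), (i.choose (m + 1) : ℝ≥0∞) • (T ^ (m + 1)) f ≤
      ((T + 1) ^ i) f := by
    have h4 := Finset.sum_range_succ' (fun m => (i.choose m : ℝ≥0∞) • (T ^ m) f) (i + 1)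
    rw [Finset.sum_range_succ, ← h1, Nat.choose_succ_self, Nat.cast_zero, zero_smul, add_zero] at h4
    rw [h4]
    exact le_self_add
  calc T (((T + 1) ^ i) f)
      = ∑ m ∈ Finset.range (i + 1), (i.choose m : ℝ≥0∞) • (T ^ (m + 1)) f := by
        rw [h1, map_sum]
        exact Finset.sum_congr rfl fun m _ => by rw [map_smul, pow_succ']; rfl
    _ ≤ ∑ m ∈ Finset.range (i + 1), (c • ((i.choose (m + 1) : ℝ≥0∞) • (T ^ (m + 1)) f) +
          l • ((i.choose m * (l ^ m * x ^ (i - m)) : ℝ≥0∞) • (T ^ (m + 1)) f)) := by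
        refine Finset.sum_le_sum fun m hm z => ?_
        simp only [Pi.add_apply, Pi.smul_apply, smul_eq_mul]
        rw [← mul_assoc, ← mul_assoc l, ← add_mul]
        gcongr
        exact hcoef m (by simpa [Nat.lt_succ_iff] using hm)
    _ ≤ _ := by
        rw [Finset.sum_add_distrib, ← Finset.smul_sum, ← Finset.smul_sum, h2, map_sum]
        refine add_le_add (fun z => mul_le_mul' le_rfl (h3 z)) (le_of_eq ?_)
        congr 1
        exact Finset.sum_congr rfl fun m _ => by rw [map_smul, pow_succ']; rfl

/-- One extra application of a commuting operator is almost absorbed by a power of an operator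
of which it is a summand. -/
lemma apply_pow_le_of_commute {R T : Module.End ℝ≥0∞ (S → ℝ≥0∞)} (hR : Monotone R)
    (hcomm : Commute R T) {c x l ε : ℝ≥0∞}
    (hcoef : ∀ i m : ℕ, m ≤ i → (i.choose m : ℝ≥0∞) ≤
      c * i.choose (m + 1) + l * (i.choose m * (l ^ m * x ^ (i - m))))
    (j : ℕ) (f : S → ℝ≥0∞) :
    T (((R + ε • (T + 1)) ^ j) f) ≤
      c • ((R + ε • (T + 1)) ^ j) f + l • T (((R + ε • (l • T + x • 1)) ^ j) f) := by
  have hc1 : Commute R (ε • (T + 1)) := (hcomm.add_right (Commute.one_right R)).smul_right ε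
  have hc2 : Commute R (ε • (l • T + x • (1 : Module.End ℝ≥0∞ (S → ℝ≥0∞)))) :=
    ((hcomm.smul_right l).add_right ((Commute.one_right R).smul_right x)).smul_right ε
  have hcT : ∀ (m : ℕ) (g : S → ℝ≥0∞), T ((R ^ m) g) = (R ^ m) (T g) := fun m g =>
    (LinearMap.congr_fun ((hcomm.pow_left m).eq) g).symm
  rw [commute_pow_apply_add hc1, commute_pow_apply_add hc2, map_sum, map_sum, Finset.smul_sum,
    Finset.smul_sum, ← Finset.sum_add_distrib]
  refine Finset.sum_le_sum fun m _ => ?_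
  simp only [smul_pow, LinearMap.smul_apply, map_smul, hcT]
  have h1 := monotone_pow hR m (apply_one_add_pow_le T (j - m) (hcoef (j - m)) f)
  rw [map_add, map_smul, map_smul] at h1
  intro z
  have h2 := h1 z
  simp only [Pi.add_apply, Pi.smul_apply, smul_eq_mul] at h2 ⊢
  calc _ ≤ _ := mul_le_mul_right (mul_le_mul_right h2 _) _
    _ = _ := by ring

end Binomial

section Lazy

/-- The weighted translation operator `f ↦ τ f ∘ σ`. -/
noncomputable def shiftOp {S : Type*} (σ : S ≃ S) (τ : ℝ≥0∞) : Module.End ℝ≥0∞ (S → ℝ≥0∞) :=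
  τ • LinearMap.funLeft ℝ≥0∞ ℝ≥0∞ σ

lemma shiftOp_apply {S : Type*} (σ : S ≃ S) (τ : ℝ≥0∞) (f : S → ℝ≥0∞) (z : S) :
    shiftOp σ τ f z = τ * f (σ z) := rfl

variable {S : Type*} [DecidableEq S]

/-- The lazy version of a kernel. -/
noncomputable def lazyKer (p : S → S → ℝ≥0∞) (z z' : S) : ℝ≥0∞ :=
  2⁻¹ * (if z = z' then 1 else 0) + 2⁻¹ * p z z'

lemma kerOp_lazyKer (p : S → S → ℝ≥0∞) :
    kerOp (lazyKer p) = (2⁻¹ : ℝ≥0∞) • (kerOp p + 1) := by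
  ext f z
  simp only [kerOp_apply, lazyKer, LinearMap.smul_apply, LinearMap.add_apply, Pi.smul_apply,
    Pi.add_apply, smul_eq_mul, Module.End.one_apply]
  simp_rw [add_mul, mul_assoc]
  rw [ENNReal.tsum_add, ENNReal.tsum_mul_left, ENNReal.tsum_mul_left, mul_add, add_comm]
  congr 2
  rw [tsum_eq_single z (fun w hw => by simp [Ne.symm hw])]
  simp

lemma kerIter_le_kerIter_lazyKer (p : S → S → ℝ≥0∞) {m N : ℕ} (h : m ≤ N) (z z' : S) :
    2⁻¹ ^ N * kerIter p m z z' ≤ kerIter (lazyKer p) N z z' := by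
  rw [kerIter_eq_pow, kerIter_eq_pow, kerOp_lazyKer, smul_pow, LinearMap.smul_apply,
    commute_pow_apply_add (Commute.one_right _), Pi.smul_apply, smul_eq_mul, Finset.sum_apply]
  refine mul_le_mul' le_rfl ?_
  refine le_trans ?_ (Finset.single_le_sum (fun _ _ => zero_le)
    (Finset.mem_range.2 (Nat.lt_succ_of_le h)))
  simp only [one_pow, Module.End.one_apply, Pi.smul_apply, smul_eq_mul]
  refine le_mul_of_one_le_left' ?_
  exact_mod_cast Nat.choose_pos h

lemma lazyKer_equivariant {p : S → S → ℝ≥0∞} {e : S ≃ S} (hp : ∀ z z', p (e z) (e z') = p z z')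
    (z z' : S) : lazyKer p (e z) (e z') = lazyKer p z z' := by
  simp [lazyKer, hp]

lemma kerOp_lazyKer_le {p : S → S → ℝ≥0∞} {f : S → ℝ≥0∞} {c c' : ℝ} (hc0 : 0 ≤ c)
    (hc : (1 + c) / 2 ≤ c') (hf : kerOp p f ≤ ENNReal.ofReal c • f) :
    kerOp (lazyKer p) f ≤ ENNReal.ofReal c' • f := by
  intro z
  rw [kerOp_lazyKer]
  simp only [LinearMap.smul_apply, LinearMap.add_apply, Pi.smul_apply,
    Pi.add_apply, smul_eq_mul, Module.End.one_apply]
  have h1 : (2⁻¹ : ℝ≥0∞) = ENNReal.ofReal 2⁻¹ := by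
    rw [ENNReal.ofReal_inv_of_pos two_pos, ENNReal.ofReal_ofNat]
  calc 2⁻¹ * (kerOp p f z + f z) ≤ ENNReal.ofReal 2⁻¹ * (ENNReal.ofReal c * f z + f z) := by
        rw [h1]; gcongr; exact hf z
    _ = ENNReal.ofReal (2⁻¹ * (c + 1)) * f z := by
        rw [ENNReal.ofReal_mul (by norm_num), ENNReal.ofReal_add hc0 zero_le_one,
          ENNReal.ofReal_one]
        ring
    _ ≤ ENNReal.ofReal c' * f z := by
        gcongr
        linarith

lemma kerGreen_eq_lazy (p : S → S → ℝ≥0∞) (z' : S) (N : ℕ) :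
    (fun z => kerGreen p z z') =
      (2⁻¹ : ℝ≥0∞) • ∑ r ∈ Finset.range N, (kerOp (lazyKer p) ^ r) (Pi.single z' 1) +
        (kerOp (lazyKer p) ^ N) (fun z => kerGreen p z z') := by
  set u : S → ℝ≥0∞ := fun z => kerGreen p z z' with hu
  have h1 : u = Pi.single z' 1 + kerOp p u := by
    funext z
    rw [hu, Pi.add_apply, kerOp_apply]
    simp only
    rw [kerGreen_eq, Pi.single_apply]
  have h2 : u = (2⁻¹ : ℝ≥0∞) • Pi.single z' 1 + kerOp (lazyKer p) u := by
    rw [kerOp_lazyKer, LinearMap.smul_apply, LinearMap.add_apply, Module.End.one_apply,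
      ← smul_add, ← add_assoc, ← h1]
    funext z
    simp only [Pi.smul_apply, Pi.add_apply, smul_eq_mul, mul_add]
    rw [← add_mul, ENNReal.inv_two_add_inv_two, one_mul]
  induction N with
  | zero => simp
  | succ N ih =>
    conv_lhs => rw [ih]
    conv_lhs => enter [2]; rw [h2]
    rw [map_add, map_smul, Finset.sum_range_succ, smul_add, pow_succ, Module.End.mul_apply,
      add_assoc]

/-- The kernel obtained from `k` by removing a small mass at `z` and at `σ z`. -/
noncomputable def trimKer (k : S → S → ℝ≥0∞) (σ : S ≃ S) (ε τ : ℝ≥0∞) (z z' : S) : ℝ≥0∞ :=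
  k z z' - ((if z' = z then ε else 0) + if z' = σ z then ε * τ else 0)

lemma kerOp_trimKer_add {k : S → S → ℝ≥0∞} {σ : S ≃ S} {ε τ : ℝ≥0∞}
    (h1 : ∀ z, ε * (1 + τ) ≤ k z z) (h2 : ∀ z, ε * (1 + τ) ≤ k z (σ z)) :
    kerOp k = kerOp (trimKer k σ ε τ) + ε • (shiftOp σ τ + 1) := by
  ext f z
  have h3 : ∀ z', k z z' = trimKer k σ ε τ z z' +
      ((if z' = z then ε else 0) + if z' = σ z then ε * τ else 0) := by
    intro z'
    rw [trimKer, tsub_add_cancel_of_le]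
    rw [mul_add, mul_one] at h1 h2
    split_ifs with h h' h'
    · rw [h]; exact h1 z
    · rw [add_zero, h]; exact le_self_add.trans (h1 z)
    · rw [zero_add, h']; exact le_add_self.trans (h2 z)
    · simp
  simp only [kerOp_apply, LinearMap.smul_apply, LinearMap.add_apply, Pi.smul_apply,
    Pi.add_apply, smul_eq_mul, Module.End.one_apply, shiftOp_apply]
  simp_rw [h3, add_mul]
  have h4 : ∀ (v : S) (b : ℝ≥0∞), ∑' w, (if w = v then b else 0) * f w = b * f v := by
    intro v b
    rw [tsum_eq_single v (fun w hw => by simp [hw])]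
    simp
  rw [ENNReal.tsum_add, ENNReal.tsum_add, h4, h4]
  ring

lemma commute_trimKer_shiftOp {k : S → S → ℝ≥0∞} {σ : S ≃ S} {ε τ : ℝ≥0∞}
    (hk : ∀ z z', k (σ z) (σ z') = k z z') :
    Commute (kerOp (trimKer k σ ε τ)) (shiftOp σ τ) := by
  ext f z
  simp only [Module.End.mul_apply, kerOp_apply, shiftOp_apply]
  rw [← σ.tsum_eq (fun w => trimKer k σ ε τ (σ z) w * f w), ← ENNReal.tsum_mul_left]
  refine tsum_congr fun w => ?_
  simp only [trimKer, hk, σ.apply_eq_iff_eq]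
  ring

end Lazy

section RatioBound

variable {S : Type*}

lemma pow_apply_le_mul_smul {B : Module.End ℝ≥0∞ (S → ℝ≥0∞)} (hB : Monotone B) {c C : ℝ≥0∞}
    {f Φ : S → ℝ≥0∞} (hf : B f ≤ c • f) (hΦ : Φ ≤ C • f) (j : ℕ) :
    (B ^ j) Φ ≤ (C * c ^ j) • f := by
  refine (monotone_pow hB j hΦ).trans ?_
  rw [map_smul, mul_smul]
  exact fun z => mul_le_mul' le_rfl (pow_apply_le_smul hB hf j z)

variable [DecidableEq S]

lemma exists_uniform_contraction {ε x l : ℝ} (hε : 0 < ε) (h : x + l < 2)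
    (N : ℕ) : ∃ κ η : ℝ, 0 < κ ∧ κ < 1 ∧ 0 < η ∧ η < 1 ∧ ∀ θ : ℝ, |θ - 1| ≤ η →
      (1 + η) ^ N + ε * (l * θ + x) ≤ κ + ε * (θ + 1) := by
  have hcont : Continuous fun η : ℝ => (1 + η) ^ N + ε * (x + l - 2 + |l - 1| * η) := by fun_prop
  have h0 : (1 + (0 : ℝ)) ^ N + ε * (x + l - 2 + |l - 1| * 0) < 1 := by
    simp only [add_zero, one_pow, mul_zero]
    nlinarith
  obtain ⟨κ, hκ, hκ1⟩ := exists_between (max_lt h0 one_pos)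
  have h1 := (hcont.tendsto 0).eventually_lt_const (max_lt_iff.1 hκ).1
  have h2 : ∀ᶠ η : ℝ in nhdsWithin 0 (Set.Ioi 0), (0 < η ∧ η < 1) ∧
      (1 + η) ^ N + ε * (x + l - 2 + |l - 1| * η) < κ := by
    filter_upwards [nhdsWithin_le_nhds h1, self_mem_nhdsWithin,
      nhdsWithin_le_nhds (gt_mem_nhds (zero_lt_one (α := ℝ)))] with η h3 h4 h5
    exact ⟨⟨h4, h5⟩, h3⟩
  obtain ⟨η, ⟨hη, hη1⟩, hlt⟩ := h2.exists
  refine ⟨κ, η, (max_lt_iff.1 hκ).2, hκ1, hη, hη1, fun θ hθ => ?_⟩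
  have h3 : (l - 1) * (θ - 1) ≤ |l - 1| * η := by
    refine (le_abs_self _).trans ?_
    rw [abs_mul]
    gcongr
  have h4 := mul_le_mul_of_nonneg_left h3 hε.le
  linarith

lemma choose_le_ennreal {c x l : ℝ} (hc : 0 ≤ c) (hx : 0 ≤ x) (hl : 0 ≤ l)
    (h : ∀ i m : ℕ, m ≤ i →
      (i.choose m : ℝ) ≤ c * i.choose (m + 1) + l * (i.choose m * (l ^ m * x ^ (i - m))))
    (i m : ℕ) (hm : m ≤ i) :
    (i.choose m : ℝ≥0∞) ≤ ENNReal.ofReal c * i.choose (m + 1) +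
      ENNReal.ofReal l * (i.choose m * (ENNReal.ofReal l ^ m * ENNReal.ofReal x ^ (i - m))) := by
  have h1 := ENNReal.ofReal_le_ofReal (h i m hm)
  rw [ENNReal.ofReal_add (by positivity) (by positivity), ENNReal.ofReal_mul hc,
    ENNReal.ofReal_mul hl, ENNReal.ofReal_mul (by positivity), ENNReal.ofReal_mul (by positivity),
    ENNReal.ofReal_pow hl, ENNReal.ofReal_pow hx, ENNReal.ofReal_natCast,
    ENNReal.ofReal_natCast] at h1
  exact h1

/-- Translating the starting point of the Green function of a translation invariant kernel
increases it by at most a factor close to `1`, up to an error controlled by any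
almost-superharmonic function that is almost invariant under the same translation. -/
lemma exists_kerGreen_shift_le {p : S → S → ℝ≥0∞} {σ : S ≃ S}
    (hσ : ∀ z z', p (σ z) (σ z') = p z z') {τ : ℝ} (hτ : 0 < τ)
    {ε₀ : ℝ} (hε₀ : 0 < ε₀) {N : ℕ}
    (hmove : ∀ z, ∃ m ≤ N, ENNReal.ofReal ε₀ ≤ kerIter p m z (σ z))
    {g : S → ℝ≥0∞} (hgtop : ∀ z, g z ≠ ⊤) {κ₀ : ℝ} (hκ₀ : 0 ≤ κ₀) (hκ₀1 : κ₀ < 1)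
    (hg : kerOp p g ≤ ENNReal.ofReal κ₀ • g)
    (hGg : ∀ z', ∃ C : ℝ≥0∞, C ≠ ⊤ ∧ ∀ z, kerGreen p z z' ≤ C * g z) {η : ℝ} (hη : 0 < η) :
    ∃ η' : ℝ, 0 < η' ∧ ∃ C : ℝ≥0∞, C ≠ ⊤ ∧ ∀ (θ : ℝ) (f : S → ℝ≥0∞), |θ - 1| ≤ η' →
      (∀ z, f z ≠ 0) → (∀ z, f z ≠ ⊤) → kerOp p f ≤ ENNReal.ofReal (1 + η') • f →
      (∀ z, ENNReal.ofReal τ * f (σ z) = ENNReal.ofReal θ * f z) →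
      ∀ z z', ENNReal.ofReal τ * kerGreen p (σ z) z' ≤
        ENNReal.ofReal (1 + η) * kerGreen p z z' + C * (f z / f z') := by
  obtain ⟨x, l, hx, hl, hxl, hcoef⟩ := exists_choose_le hη
  have hcoef' := choose_le_ennreal (by positivity) hx.le hl.le hcoef
  set ε₁ := min ε₀ 1 with hε₁
  have hε₁0 : 0 < ε₁ := lt_min hε₀ one_pos
  set ε : ℝ := 2⁻¹ ^ (N + 1) * ε₁ / (1 + τ) with hε
  have hε0 : 0 < ε := by positivity
  obtain ⟨κ, η', hκ0, hκ1, hη', hη'1, hκ⟩ := exists_uniform_contraction hε0 hxl (N + 1)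
  set k := kerIter (lazyKer p) (N + 1) with hk
  have hkσ : ∀ z z', k (σ z) (σ z') = k z z' := fun z z' =>
    kerIter_equivariant (lazyKer p) σ (lazyKer_equivariant hσ) (N + 1) z z'
  have hεeq : ENNReal.ofReal ε * (1 + ENNReal.ofReal τ) = 2⁻¹ ^ (N + 1) * ENNReal.ofReal ε₁ := by
    rw [← ENNReal.ofReal_one, ← ENNReal.ofReal_add zero_le_one hτ.le, ← ENNReal.ofReal_mul hε0.le,
      hε, div_mul_cancel₀ _ (by positivity), ENNReal.ofReal_mul (by positivity),
      ENNReal.ofReal_pow (by positivity), ENNReal.ofReal_inv_of_pos two_pos, ENNReal.ofReal_ofNat]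
  have hlow : ∀ z z' m, m ≤ N → ENNReal.ofReal ε₁ ≤ kerIter p m z z' →
      ENNReal.ofReal ε * (1 + ENNReal.ofReal τ) ≤ k z z' := by
    intro z z' m hm h
    rw [hεeq]
    exact (mul_le_mul' le_rfl h).trans (kerIter_le_kerIter_lazyKer p (hm.trans N.le_succ) z z')
  have hk1 : ∀ z, ENNReal.ofReal ε * (1 + ENNReal.ofReal τ) ≤ k z z := fun z =>
    hlow z z 0 N.zero_le (by simp [kerIter, hε₁])
  have hk2 : ∀ z, ENNReal.ofReal ε * (1 + ENNReal.ofReal τ) ≤ k z (σ z) := by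
    intro z
    obtain ⟨m, hm, h⟩ := hmove z
    exact hlow z _ m hm ((ENNReal.ofReal_le_ofReal (min_le_left _ _)).trans h)
  set R' := kerOp (trimKer k σ (ENNReal.ofReal ε) (ENNReal.ofReal τ)) with hR'
  set T := shiftOp σ (ENNReal.ofReal τ) with hT
  set Q := kerOp (lazyKer p) with hQ
  have hRQ : Q ^ (N + 1) = R' + ENNReal.ofReal ε • (T + 1) := by
    rw [hR', ← kerOp_trimKer_add hk1 hk2]
    ext f z
    rw [hQ, kerOp_pow_apply, kerOp_apply]
  have hcomm : Commute R' T := commute_trimKer_shiftOp hkσ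
  set R := R' + ENNReal.ofReal ε • (T + 1) with hR
  set B := R' + ENNReal.ofReal ε • (ENNReal.ofReal l • T + ENNReal.ofReal x • 1) with hB
  have hTmono : Monotone T := fun f h hfh z => mul_le_mul' le_rfl (hfh (σ z))
  have hBmono : Monotone B := by
    intro f h hfh z
    simp only [hB, LinearMap.add_apply, LinearMap.smul_apply, Pi.add_apply, Pi.smul_apply,
      smul_eq_mul, Module.End.one_apply]
    exact add_le_add (kerOp_mono _ hfh z) (mul_le_mul' le_rfl
      (add_le_add (mul_le_mul' le_rfl (hTmono hfh z)) (mul_le_mul' le_rfl (hfh z))))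
  set C1 : ℝ≥0∞ := 2⁻¹ * ∑ r ∈ Finset.range (N + 1), ENNReal.ofReal (1 + η') ^ r with hC1
  have hC1top : C1 ≠ ⊤ := ENNReal.mul_ne_top (by simp)
    (ENNReal.sum_ne_top.2 fun r _ => ENNReal.pow_ne_top ENNReal.ofReal_ne_top)
  have hgeom : (1 - ENNReal.ofReal κ)⁻¹ ≠ ⊤ := by
    rw [ENNReal.inv_ne_top]
    exact (tsub_pos_of_lt (by simpa using hκ1)).ne'
  refine ⟨η', hη', ENNReal.ofReal l * (C1 * (1 - ENNReal.ofReal κ)⁻¹ * 2),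
    ENNReal.mul_ne_top ENNReal.ofReal_ne_top
      (ENNReal.mul_ne_top (ENNReal.mul_ne_top hC1top hgeom) (by simp)),
    fun θ f hθ hf0 hftop hf hfσ z z' => ?_⟩
  have hθ' := abs_le.1 hθ
  have hθ0 : 0 < θ := by linarith
  have hTf : T f = ENNReal.ofReal θ • f := funext hfσ
  have hQf : Q f ≤ ENNReal.ofReal (1 + η') • f :=
    kerOp_lazyKer_le (by positivity) (by linarith) hf
  have hQpow : ∀ r, (Q ^ r) f ≤ ENNReal.ofReal (1 + η') ^ r • f := fun r =>
    pow_apply_le_smul (kerOp_mono _) hQf r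
  have hBf : B f ≤ ENNReal.ofReal κ • f := by
    intro w
    have h1 := hQpow (N + 1) w
    rw [hRQ] at h1
    simp only [hR, hB, LinearMap.add_apply, LinearMap.smul_apply, Pi.add_apply, Pi.smul_apply,
      smul_eq_mul, Module.End.one_apply, hTf] at h1 ⊢
    have hfin : ENNReal.ofReal (ε * (θ + 1)) * f w ≠ ⊤ :=
      ENNReal.mul_ne_top ENNReal.ofReal_ne_top (hftop w)
    rw [← ENNReal.add_le_add_iff_right hfin]
    calc _ = (R' f w + ENNReal.ofReal ε * (ENNReal.ofReal θ * f w + f w)) +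
          ENNReal.ofReal (ε * (l * θ + x)) * f w := by
          rw [ENNReal.ofReal_mul hε0.le, ENNReal.ofReal_mul hε0.le,
            ENNReal.ofReal_add hθ0.le zero_le_one, ENNReal.ofReal_add (by positivity) hx.le,
            ENNReal.ofReal_mul hl.le, ENNReal.ofReal_one]
          ring
      _ ≤ ENNReal.ofReal (1 + η') ^ (N + 1) * f w + ENNReal.ofReal (ε * (l * θ + x)) * f w := by
          gcongr
      _ = ENNReal.ofReal ((1 + η') ^ (N + 1) + ε * (l * θ + x)) * f w := by
          rw [← ENNReal.ofReal_pow (by positivity), ← add_mul,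
            ENNReal.ofReal_add (p := (1 + η') ^ (N + 1)) (by positivity) (by positivity)]
      _ ≤ ENNReal.ofReal (κ + ε * (θ + 1)) * f w := by
          exact mul_le_mul' (ENNReal.ofReal_le_ofReal (hκ θ hθ)) le_rfl
      _ = _ := by rw [ENNReal.ofReal_add hκ0.le (by positivity), add_mul]
  set u : S → ℝ≥0∞ := fun w => kerGreen p w z' with hu
  set Φ : S → ℝ≥0∞ := (2⁻¹ : ℝ≥0∞) •
    ∑ r ∈ Finset.range (N + 1), (Q ^ r) (Pi.single z' 1) with hΦ
  have hueq : u = Φ + R u := by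
    rw [← hRQ]
    exact kerGreen_eq_lazy p z' (N + 1)
  have hupot : ∀ w, u w = ∑' j : ℕ, (R ^ j) Φ w := by
    intro w
    refine eq_potential R hueq w ?_
    obtain ⟨C, hC, hCg⟩ := hGg z'
    set κ₁ := (1 + κ₀) / 2 with hκ₁
    have hκ₁1 : ENNReal.ofReal κ₁ ^ (N + 1) < 1 := by
      rw [← ENNReal.ofReal_pow (by positivity), ENNReal.ofReal_lt_one]
      exact pow_lt_one₀ (by positivity) (by linarith) N.succ_ne_zero
    have h1 : R g ≤ ENNReal.ofReal κ₁ ^ (N + 1) • g := by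
      rw [← hRQ]
      exact pow_apply_le_smul (kerOp_mono _) (kerOp_lazyKer_le hκ₀ le_rfl hg) _
    have h2 : ∀ j, (R ^ j) u w ≤ C * (ENNReal.ofReal κ₁ ^ (N + 1)) ^ j * g w := fun j =>
      pow_apply_le_mul_smul (hRQ ▸ monotone_pow (kerOp_mono _) _) h1 (C := C) (fun w => hCg w) j w
    have h3 : Tendsto (fun j => C * (ENNReal.ofReal κ₁ ^ (N + 1)) ^ j * g w) atTop (nhds 0) := by
      have h4 := ENNReal.tendsto_pow_atTop_nhds_zero_of_lt_one hκ₁1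
      have h5 := ENNReal.Tendsto.mul_const (b := g w)
        (ENNReal.Tendsto.const_mul (a := C) h4 (Or.inr hC)) (Or.inr (hgtop w))
      simpa using h5
    exact tendsto_of_tendsto_of_tendsto_of_le_of_le tendsto_const_nhds h3 (fun _ => zero_le) h2
  have hδ : (Pi.single z' 1 : S → ℝ≥0∞) ≤ (f z')⁻¹ • f := by
    intro w
    rcases eq_or_ne w z' with rfl | hw
    · simp [ENNReal.inv_mul_cancel (hf0 w) (hftop w)]
    · simp [hw]
  have hΦle : Φ ≤ (C1 * (f z')⁻¹) • f := by
    intro w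
    simp only [hΦ, hC1, Pi.smul_apply, Finset.sum_apply, smul_eq_mul, mul_assoc]
    refine mul_le_mul' le_rfl ?_
    rw [Finset.sum_mul]
    refine Finset.sum_le_sum fun r _ => ?_
    have h1 := pow_apply_le_mul_smul (kerOp_mono (lazyKer p)) hQf hδ r w
    simp only [Pi.smul_apply, smul_eq_mul] at h1
    calc _ ≤ _ := h1
      _ = _ := by ring
  have hTB : ∀ j, T ((B ^ j) Φ) z ≤ ENNReal.ofReal κ ^ j * (C1 * 2 * (f z / f z')) := by
    intro j
    have h1 : T ((B ^ j) Φ) z ≤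
        C1 * (f z')⁻¹ * ENNReal.ofReal κ ^ j * (ENNReal.ofReal θ * f z) := by
      refine (hTmono (pow_apply_le_mul_smul hBmono hBf hΦle j) z).trans_eq ?_
      rw [map_smul T _ f, hTf]
      rfl
    have h2 : ENNReal.ofReal θ ≤ 2 := by
      rw [← ENNReal.ofReal_ofNat]
      exact ENNReal.ofReal_le_ofReal (by linarith)
    refine h1.trans ?_
    calc _ ≤ C1 * (f z')⁻¹ * ENNReal.ofReal κ ^ j * (2 * f z) := by gcongr
      _ = _ := by rw [div_eq_mul_inv]; ring
  calc ENNReal.ofReal τ * kerGreen p (σ z) z' = ∑' j : ℕ, T ((R ^ j) Φ) z := by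
        change ENNReal.ofReal τ * u (σ z) = _
        rw [hupot, ← ENNReal.tsum_mul_left]
        rfl
    _ ≤ ∑' j : ℕ, (ENNReal.ofReal (1 + η) * (R ^ j) Φ z +
          ENNReal.ofReal l * (ENNReal.ofReal κ ^ j * (C1 * 2 * (f z / f z')))) := by
        refine ENNReal.tsum_le_tsum fun j => ?_
        refine (apply_pow_le_of_commute (kerOp_mono _) hcomm hcoef' j Φ z).trans ?_
        simp only [Pi.add_apply, Pi.smul_apply, smul_eq_mul]
        gcongr
        exact hTB j
    _ = _ := by
        rw [ENNReal.tsum_add, ENNReal.tsum_mul_left, ENNReal.tsum_mul_left, ENNReal.tsum_mul_right,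
          ENNReal.tsum_geometric, ← hupot]
        ring

end RatioBound

section ShiftRatio

variable {d : ℕ} {μ μ0 : Zd d → ℝ}

lemma continuous_dotZ (w : Zd d) : Continuous fun v : Rd d => dotZ d v w := by
  unfold dotZ
  fun_prop

lemma expW_congr_of_snd_eq_zero {b b' : Rd d} (h : b.1 = b'.1) {z : St d} (hz : z.2 = 0) :
    expW d b z = expW d b' z := by
  simp [expW, dotZ, toZ, h, hz]

lemma kerOp_step_tilt_le (H : Assumptions d μ μ0) {b b' : Rd d} (hb : b.1 = b'.1) {η C : ℝ}
    (hη : 0 ≤ η) (hC : 0 ≤ C) (h1 : jgf d μ b ≤ 1 + η) (h2 : jgf d μ b' ≤ 1 + η)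
    (h3 : jgf d μ0 b + C * jgf d μ0 b' ≤ (1 + η) * (1 + C)) :
    kerOp (step d μ μ0) (expW d b + ENNReal.ofReal C • expW d b') ≤
      ENNReal.ofReal (1 + η) • (expW d b + ENNReal.ofReal C • expW d b') := by
  intro z
  rw [map_add, map_smul]
  simp only [Pi.add_apply, Pi.smul_apply, smul_eq_mul, kerOp_step_expW H]
  by_cases hz : z.2 = 0
  · rw [expW_congr_of_snd_eq_zero hb hz]
    simp only [jgfAt, hz, if_true]
    have h4 : ENNReal.ofReal (jgf d μ0 b) + ENNReal.ofReal C * ENNReal.ofReal (jgf d μ0 b') ≤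
        ENNReal.ofReal (1 + η) * (1 + ENNReal.ofReal C) := by
      rw [← ENNReal.ofReal_mul hC, ← ENNReal.ofReal_add (jgf_nonneg H.prob0.1 _)
        (mul_nonneg hC (jgf_nonneg H.prob0.1 _)), ← ENNReal.ofReal_one,
        ← ENNReal.ofReal_add zero_le_one hC, ← ENNReal.ofReal_mul (by positivity)]
      exact ENNReal.ofReal_le_ofReal (by simpa using h3)
    calc _ = (ENNReal.ofReal (jgf d μ0 b) + ENNReal.ofReal C * ENNReal.ofReal (jgf d μ0 b')) *
          expW d b' z := by ring
      _ ≤ (ENNReal.ofReal (1 + η) * (1 + ENNReal.ofReal C)) * expW d b' z := by gcongr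
      _ = _ := by ring
  · simp only [jgfAt, hz, if_false]
    calc _ ≤ ENNReal.ofReal (1 + η) * expW d b z +
          ENNReal.ofReal C * (ENNReal.ofReal (1 + η) * expW d b' z) := by gcongr
      _ = _ := by ring

lemma expW_shift_add (b v : Rd d) (k : Fin (d - 1) → ℤ) (z : St d) :
    ENNReal.ofReal (Real.exp (-dotZ d b (k, 0))) * expW d (b + v) (shiftSt d k z) =
      ENNReal.ofReal (Real.exp (dotZ d v (k, 0))) * expW d (b + v) z := by
  rw [expW_shiftSt, ← mul_assoc, ← ENNReal.ofReal_mul (Real.exp_pos _).le, ← Real.exp_add,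
    dotZ_add_left]
  congr 3
  ring

/-- Shifting the starting point along the boundary multiplies the Green function by at most
`e^{a·k}` asymptotically, up to an error which is exponentially smaller than `e^{-a·z'}`. -/
lemma kerGreen_shiftSt_le (H : Assumptions d μ μ0) {a b : Rd d} (hab : b.1 = a.1)
    (ha : jgf d μ a ≤ 1) (hb : jgf d μ b ≤ 1) (hb0 : jgf d μ0 b ≤ 1) (k : Fin (d - 1) → ℤ)
    {η : ℝ} (hη : 0 < η) :
    ∃ δ : ℝ, 0 < δ ∧ ∀ z : St d, ∃ C : ℝ≥0∞, C ≠ ⊤ ∧ ∀ z' : St d,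
      ENNReal.ofReal (Real.exp (-dotZ d a (k, 0))) *
          kerGreen (step d μ μ0) (shiftSt d k z) z' ≤
        ENNReal.ofReal (1 + η) * kerGreen (step d μ μ0) z z' +
          C * ENNReal.ofReal (Real.exp (-(dotZ d a (toZ d z') + δ * ‖toR d (toZ d z')‖))) := by
  obtain ⟨ε₀, hε₀, -, N, hmove⟩ := exists_uniform_localMoves H (Set.finite_singleton ((k, 0) : Zd d))
  obtain ⟨c, δ₀, κ, hc⟩ := exists_isContraction H
  obtain ⟨η', hη', C, hC, hmain⟩ := exists_kerGreen_shift_le (p := step d μ μ0)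
    (σ := shiftSt d k) (step_shiftSt k) (Real.exp_pos (-dotZ d a (k, 0))) hε₀ (N := N)
    (fun z => hmove z _ (by simp [toZ_shiftSt])) (g := expW d c) (expW_ne_top d c) hc.κ_pos.le
    hc.κ_lt (hc.kerOp_step_le H c (by simpa using hc.δ_pos.le))
    (fun z' => ⟨(1 - ENNReal.ofReal κ)⁻¹ * (expW d c z')⁻¹,
      ENNReal.mul_ne_top hc.inv_ne_top (ENNReal.inv_ne_top.2 (expW_pos d c z').ne'), fun z => by
        have h1 := hc.kerGreen_mul_le H z z'
        rw [← ENNReal.le_div_iff_mul_le (Or.inl (expW_pos d c z').ne')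
          (Or.inl (expW_ne_top d c z')), div_eq_mul_inv] at h1
        exact h1.trans_eq (by ring)⟩) hη
  set C0 : ℝ := 2 * (jgf d μ0 a + 1) / η' with hC0
  have hja : 0 ≤ jgf d μ0 a := jgf_nonneg H.prob0.1 a
  have hC0pos : 0 ≤ C0 := by positivity
  have hcont : ∀ {ν : Zd d → ℝ}, Continuous (jgf d ν) → ∀ (x : Rd d) {s : ℝ}, jgf d ν x < s →
      ∀ᶠ v in nhds (0 : Rd d), jgf d ν (x + v) < s := fun hν x s hs => by
    have h1 : Continuous fun v => jgf d _ (x + v) := hν.comp (continuous_const.add continuous_id)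
    exact h1.continuousAt.eventually_lt continuousAt_const (by simpa using hs)
  have hθ : ∀ᶠ v in nhds (0 : Rd d), |Real.exp (dotZ d v (k, 0)) - 1| < η' := by
    have h1 : Continuous fun v : Rd d => |Real.exp (dotZ d v (k, 0)) - 1| :=
      ((Real.continuous_exp.comp (continuous_dotZ _)).sub continuous_const).abs
    exact h1.continuousAt.eventually_lt continuousAt_const (by simpa [dotZ_zero_left] using hη')
  have hall := (hcont H.continuous a (s := 1 + η') (by linarith)).and
    ((hcont H.continuous b (s := 1 + η') (by linarith)).and
    ((hcont H.continuous0 b (s := 1 + η' / 2) (by linarith)).and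
    ((hcont H.continuous0 a (s := jgf d μ0 a + 1) (by linarith)).and hθ)))
  obtain ⟨δ₁, hδ₁, hball⟩ := Metric.eventually_nhds_iff.1 hall
  set δ := δ₁ / 2 with hδ
  have hδ0 : 0 < δ := by positivity
  refine ⟨δ, hδ0, fun z => ?_⟩
  set L : ℝ := d * (δ * ‖toR d (toZ d z)‖) with hL
  refine ⟨C * ((expW d a z + ENNReal.ofReal C0 * expW d b z) * ENNReal.ofReal (Real.exp L)), ?_,
    fun z' => ?_⟩
  · refine ENNReal.mul_ne_top hC (ENNReal.mul_ne_top (ENNReal.add_ne_top.2 ⟨expW_ne_top d a z, ?_⟩)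
      ENNReal.ofReal_ne_top)
    exact ENNReal.mul_ne_top ENNReal.ofReal_ne_top (expW_ne_top d b z)
  obtain ⟨s, hs⟩ := exists_dirVec d (toZ d z')
  set v : Rd d := δ • dirVec d s with hv
  have hvn : ‖v‖ ≤ δ := by
    rw [hv, norm_smul, Real.norm_of_nonneg hδ0.le]
    exact mul_le_of_le_one_right hδ0.le (norm_dirVec_le d s)
  obtain ⟨h1, h2, h3, h4, h5⟩ := hball (y := v)
    (by rw [dist_zero_right]; exact hvn.trans_lt (by rw [hδ]; linarith))
  have hηC : η' * C0 = 2 * (jgf d μ0 a + 1) := by rw [hC0]; field_simp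
  set f : St d → ℝ≥0∞ := expW d (a + v) + ENNReal.ofReal C0 • expW d (b + v) with hf
  have hPf := kerOp_step_tilt_le H (b := a + v) (b' := b + v) (by simp [hab]) hη'.le hC0pos
    h1.le h2.le (by nlinarith [mul_le_mul_of_nonneg_left h3.le hC0pos])
  have hfpos : ∀ w, f w ≠ 0 := fun w h => (expW_pos d (a + v) w).ne' (by
    simp only [hf, Pi.add_apply, add_eq_zero] at h
    exact h.1)
  have hftop : ∀ w, f w ≠ ⊤ := fun w => ENNReal.add_ne_top.2 ⟨expW_ne_top d _ w,
    ENNReal.mul_ne_top ENNReal.ofReal_ne_top (expW_ne_top d _ w)⟩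
  have hkk : dotZ d b (k, 0) = dotZ d a (k, 0) := by simp [dotZ, hab]
  have hfσ : ∀ w, ENNReal.ofReal (Real.exp (-dotZ d a (k, 0))) * f (shiftSt d k w) =
      ENNReal.ofReal (Real.exp (dotZ d v (k, 0))) * f w := by
    intro w
    simp only [hf, Pi.add_apply, Pi.smul_apply, smul_eq_mul, mul_add, mul_left_comm _ (ENNReal.ofReal C0)]
    rw [expW_shift_add a v k w]
    congr 2
    rw [← hkk, expW_shift_add b v k w]
  refine (hmain _ f h5.le hfpos hftop hPf hfσ z z').trans (add_le_add le_rfl ?_)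
  rw [mul_assoc]
  refine mul_le_mul' le_rfl ?_
  rw [div_eq_mul_inv]
  have hvz : ENNReal.ofReal (Real.exp (dotZ d v (toZ d z))) ≤ ENNReal.ofReal (Real.exp L) := by
    refine ENNReal.ofReal_le_ofReal (Real.exp_le_exp.2 ((le_abs_self _).trans
      ((abs_dotZ_le d H.one_le v _).trans ?_)))
    rw [hL]
    gcongr
  refine mul_le_mul' ?_ ?_
  · simp only [hf, Pi.add_apply, Pi.smul_apply, smul_eq_mul, expW_add]
    rw [← mul_assoc, ← add_mul]
    exact mul_le_mul' le_rfl hvz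
  · rw [Real.exp_neg, ENNReal.ofReal_inv_of_pos (Real.exp_pos _)]
    refine ENNReal.inv_le_inv.2 (le_trans (le_of_eq ?_) (le_self_add (a := expW d (a + v) z')))
    rw [expW_add, expW, ← ENNReal.ofReal_mul (Real.exp_pos _).le, ← Real.exp_add, hv,
      dotZ_smul_left, hs]

end ShiftRatio

section MartinLimit

variable {d : ℕ} {μ μ0 : Zd d → ℝ}

/-- The Martin kernel `G(z,w)/G(z₀,w)`. -/
noncomputable def martinRatio (d : ℕ) (μ μ0 : Zd d → ℝ) (z0 z w : St d) : ℝ :=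
  (kerGreen (step d μ μ0) z w).toReal / (kerGreen (step d μ μ0) z0 w).toReal

lemma toReal_kerGreen_pos (H : Assumptions d μ μ0) (z w : St d) :
    0 < (kerGreen (step d μ μ0) z w).toReal :=
  ENNReal.toReal_pos (kerGreen_pos H z w).ne' (kerGreen_ne_top H z w)

lemma martinRatio_pos (H : Assumptions d μ μ0) (z0 z w : St d) : 0 < martinRatio d μ μ0 z0 z w :=
  div_pos (toReal_kerGreen_pos H z w) (toReal_kerGreen_pos H z0 w)

lemma norm_toR_neg (z : Zd d) : ‖toR d (-z)‖ = ‖toR d z‖ := by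
  rw [← norm_neg]
  congr 1
  ext <;> simp [toR]

lemma norm_toR_add_le (z w : Zd d) : ‖toR d (z + w)‖ ≤ ‖toR d z‖ + ‖toR d w‖ := by
  refine le_trans (le_of_eq ?_) (norm_add_le _ _)
  congr 1
  ext <;> simp [toR]

lemma exists_toReal_kerGreen_ge (H : Assumptions d μ μ0) : ∃ M : ℝ, 0 ≤ M ∧ ∀ z z' w : St d,
    Real.exp (-(M * ‖toR d (toZ d z' - toZ d z)‖)) * (kerGreen (step d μ μ0) z' w).toReal ≤
      (kerGreen (step d μ μ0) z w).toReal := by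
  obtain ⟨M, hM, hle⟩ := exists_kerIter_ge H
  refine ⟨M, hM, fun z z' w => ?_⟩
  obtain ⟨m, hm⟩ := hle z z'
  rw [← ENNReal.toReal_ofReal (Real.exp_pos _).le, ← ENNReal.toReal_mul]
  exact ENNReal.toReal_mono (kerGreen_ne_top H z w)
    ((mul_le_mul' hm le_rfl).trans (kerIter_mul_kerGreen_le _ m z z' w))

lemma exists_martinRatio_bounds (H : Assumptions d μ μ0) (z0 : St d) : ∃ M : ℝ, 0 ≤ M ∧
    ∀ z w : St d, martinRatio d μ μ0 z0 z w ∈ Set.Icc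
      (Real.exp (-(M * ‖toR d (toZ d z - toZ d z0)‖)))
      (Real.exp (M * ‖toR d (toZ d z - toZ d z0)‖)) := by
  obtain ⟨M, hM, hle⟩ := exists_toReal_kerGreen_ge H
  refine ⟨M, hM, fun z w => ⟨?_, ?_⟩⟩
  · rw [martinRatio, le_div_iff₀ (toReal_kerGreen_pos H z0 w), ← norm_toR_neg, neg_sub]
    exact hle z z0 w
  · rw [martinRatio, div_le_iff₀ (toReal_kerGreen_pos H z0 w)]
    have h1 := hle z0 z w
    rw [Real.exp_neg, inv_mul_le_iff₀ (Real.exp_pos _)] at h1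
    exact h1

lemma exists_kerGreen_direction_ge (H : Assumptions d μ μ0) {a q : Rd d}
    (hq : q ∈ normalCone d (Dhat d μ μ0) a) (z0 : St d) {zn : ℕ → St d} {l : Filter ℕ}
    (hnorm : Tendsto (fun n => ‖toR d (toZ d (zn n))‖) l atTop)
    (hdir : Tendsto (fun n => ‖toR d (toZ d (zn n))‖⁻¹ • toR d (toZ d (zn n))) l (nhds q))
    [l.NeBot] {ε : ℝ} (hε : 0 < ε) :
    ∃ c : ℝ, 0 < c ∧ ∀ᶠ n in l,
      c * Real.exp (-(dotZ d a (toZ d (zn n)) + ε * ‖toR d (toZ d (zn n))‖)) ≤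
        (kerGreen (step d μ μ0) z0 (zn n)).toReal := by
  obtain ⟨M, hM, hle⟩ := exists_kerIter_ge H
  obtain ⟨M', hM', hle'⟩ := exists_toReal_kerGreen_ge H
  have hq2 : 0 ≤ q.2 := by
    refine ge_of_tendsto' ((continuous_snd.tendsto q).comp hdir) fun n => ?_
    simp only [Function.comp, Prod.smul_snd, smul_eq_mul, toR, toZ]
    positivity
  have hdec := normalCone_mem_decayBounds H hM hle hq hq2
  set ρ : ℝ := ε / (2 * (M + d * ‖a‖ + 1)) with hρ
  have hpos : 0 < M + d * ‖a‖ + 1 := by positivity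
  have hρ0 : 0 < ρ := by positivity
  obtain ⟨T, hT⟩ := hdec (ε / 2) (by positivity)
  refine ⟨_, Real.exp_pos (-(M' * ‖toR d (toZ d (0 : St d) - toZ d z0)‖)), ?_⟩
  filter_upwards [hnorm.eventually_ge_atTop T, hnorm.eventually_gt_atTop 0,
    Metric.tendsto_nhds.1 hdir ρ hρ0] with n h1 h2 h3
  refine le_trans (mul_le_mul_of_nonneg_left ?_ (Real.exp_pos _).le) (hle' z0 0 (zn n))
  rw [← ENNReal.ofReal_le_iff_le_toReal (kerGreen_ne_top H _ _)]
  refine le_trans (ENNReal.ofReal_le_ofReal (Real.exp_le_exp.2 ?_)) (hT _ h1 (zn n))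
  set t := ‖toR d (toZ d (zn n))‖ with ht
  have h4 : ‖toR d (toZ d (zn n)) - t • q‖ ≤ ρ * t := by
    have h5 : toR d (toZ d (zn n)) - t • q = t • (t⁻¹ • toR d (toZ d (zn n)) - q) := by
      rw [smul_sub, smul_inv_smul₀ h2.ne']
    rw [h5, norm_smul, Real.norm_of_nonneg h2.le, mul_comm]
    rw [dist_eq_norm] at h3
    exact mul_le_mul_of_nonneg_right h3.le h2.le
  have h6 : |dotR d a (toR d (toZ d (zn n)) - t • q)| ≤ d * (‖a‖ * (ρ * t)) := by
    refine (abs_dotR_le d H.one_le _ _).trans ?_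
    gcongr
  rw [dotR_sub_right, dotR_smul_right] at h6
  have h7 : (M + d * ‖a‖ + 1) * ρ = ε / 2 := by rw [hρ]; field_simp
  have h8 := (abs_le.1 h6).1
  rw [dotZ_eq_dotR]
  have h9 : M * ‖toR d (toZ d (zn n)) - t • q‖ ≤ M * (ρ * t) := by gcongr
  have h10 : (M * ρ + d * ‖a‖ * ρ) * t ≤ ε / 2 * t := by
    gcongr
    linarith
  simp only
  linarith

end MartinLimit

section MartinLimitProperties

variable {d : ℕ} {μ μ0 : Zd d → ℝ}

lemma martinLimit_shift_le (H : Assumptions d μ μ0) {a b q : Rd d} (hab : b.1 = a.1)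
    (ha : jgf d μ a ≤ 1) (hb : jgf d μ b ≤ 1) (hb0 : jgf d μ0 b ≤ 1)
    (hq : q ∈ normalCone d (Dhat d μ μ0) a) (z0 : St d) {zn : ℕ → St d} {l : Filter ℕ} [l.NeBot]
    (hnorm : Tendsto (fun n => ‖toR d (toZ d (zn n))‖) l atTop)
    (hdir : Tendsto (fun n => ‖toR d (toZ d (zn n))‖⁻¹ • toR d (toZ d (zn n))) l (nhds q))
    {K : St d → ℝ} (hK : ∀ z, Tendsto (fun n => martinRatio d μ μ0 z0 z (zn n)) l (nhds (K z)))
    (k : Fin (d - 1) → ℤ) (z : St d) :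
    Real.exp (-dotZ d a (k, 0)) * K (shiftSt d k z) ≤ K z := by
  have key : ∀ η : ℝ, 0 < η → Real.exp (-dotZ d a (k, 0)) * K (shiftSt d k z) ≤ (1 + η) * K z := by
    intro η hη
    obtain ⟨δ, hδ, hall⟩ := kerGreen_shiftSt_le H hab ha hb hb0 k hη
    obtain ⟨C, hC, hle⟩ := hall z
    obtain ⟨c, hc, hlow⟩ := exists_kerGreen_direction_ge H hq z0 hnorm hdir (half_pos hδ)
    have herr : Tendsto (fun n => C.toReal / c * Real.exp (-(δ / 2 * ‖toR d (toZ d (zn n))‖))) l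
        (nhds 0) := by
      have h1 := Real.tendsto_exp_neg_atTop_nhds_zero.comp
        (hnorm.const_mul_atTop (half_pos hδ))
      simpa using h1.const_mul (C.toReal / c)
    have hR := ((hK z).const_mul (1 + η)).add herr
    rw [add_zero] at hR
    refine le_of_tendsto_of_tendsto ((hK (shiftSt d k z)).const_mul _) hR ?_
    filter_upwards [hlow] with n hn
    have h1 := ENNReal.toReal_mono (ENNReal.add_ne_top.2
      ⟨ENNReal.mul_ne_top ENNReal.ofReal_ne_top (kerGreen_ne_top H z (zn n)),
      ENNReal.mul_ne_top hC ENNReal.ofReal_ne_top⟩) (hle (zn n))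
    rw [ENNReal.toReal_add (ENNReal.mul_ne_top ENNReal.ofReal_ne_top (kerGreen_ne_top H z (zn n)))
      (ENNReal.mul_ne_top hC ENNReal.ofReal_ne_top), ENNReal.toReal_mul, ENNReal.toReal_mul,
      ENNReal.toReal_mul, ENNReal.toReal_ofReal (Real.exp_pos _).le,
      ENNReal.toReal_ofReal (Real.exp_pos _).le, ENNReal.toReal_ofReal (by positivity)] at h1
    have hG := toReal_kerGreen_pos H z0 (zn n)
    simp only [martinRatio]
    rw [← mul_div_assoc, ← mul_div_assoc, div_add' _ _ _ hG.ne', div_le_div_iff_of_pos_right hG]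
    refine h1.trans (add_le_add le_rfl ?_)
    calc C.toReal * Real.exp (-(dotZ d a (toZ d (zn n)) + δ * ‖toR d (toZ d (zn n))‖)) =
          C.toReal / c * Real.exp (-(δ / 2 * ‖toR d (toZ d (zn n))‖)) *
            (c * Real.exp (-(dotZ d a (toZ d (zn n)) + δ / 2 * ‖toR d (toZ d (zn n))‖))) := by
          rw [show -(dotZ d a (toZ d (zn n)) + δ * ‖toR d (toZ d (zn n))‖) =
            -(δ / 2 * ‖toR d (toZ d (zn n))‖) +
              -(dotZ d a (toZ d (zn n)) + δ / 2 * ‖toR d (toZ d (zn n))‖) by ring, Real.exp_add]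
          field_simp
      _ ≤ _ := by gcongr
  have h1 : Tendsto (fun η : ℝ => (1 + η) * K z) (nhdsWithin 0 (Set.Ioi 0)) (nhds (K z)) := by
    have h2 : Continuous fun η : ℝ => (1 + η) * K z := by fun_prop
    exact (by simpa using h2.tendsto 0 : Tendsto (fun η : ℝ => (1 + η) * K z) (nhds 0) (nhds (K z))).mono_left
      nhdsWithin_le_nhds
  exact ge_of_tendsto h1 (eventually_nhdsWithin_of_forall fun η hη => key η hη)

lemma martinLimit_shift (H : Assumptions d μ μ0) {a b q : Rd d} (hab : b.1 = a.1)
    (ha : jgf d μ a ≤ 1) (hb : jgf d μ b ≤ 1) (hb0 : jgf d μ0 b ≤ 1)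
    (hq : q ∈ normalCone d (Dhat d μ μ0) a) (z0 : St d) {zn : ℕ → St d} {l : Filter ℕ} [l.NeBot]
    (hnorm : Tendsto (fun n => ‖toR d (toZ d (zn n))‖) l atTop)
    (hdir : Tendsto (fun n => ‖toR d (toZ d (zn n))‖⁻¹ • toR d (toZ d (zn n))) l (nhds q))
    {K : St d → ℝ} (hK : ∀ z, Tendsto (fun n => martinRatio d μ μ0 z0 z (zn n)) l (nhds (K z)))
    (k : Fin (d - 1) → ℤ) (z : St d) :
    K (shiftSt d k z) = Real.exp (dotZ d a (k, 0)) * K z := by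
  have hle := martinLimit_shift_le H hab ha hb hb0 hq z0 hnorm hdir hK
  have h1 := hle k z
  have h2 := hle (-k) (shiftSt d k z)
  have h3 : dotZ d a (-k, 0) = -dotZ d a (k, 0) := by simp [dotZ]
  have h4 : shiftSt d (-k) (shiftSt d k z) = z := by simp [shiftSt]
  rw [h3, h4, neg_neg] at h2
  rw [Real.exp_neg, inv_mul_le_iff₀ (Real.exp_pos _)] at h1
  exact le_antisymm h1 h2

lemma step_eq_ofReal_stepR (z w : St d) :
    step d μ μ0 z w = ENNReal.ofReal (stepR d μ μ0 z w) := by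
  unfold step stepR
  split_ifs <;> rfl

lemma stepR_nonneg (H : Assumptions d μ μ0) (z w : St d) : 0 ≤ stepR d μ μ0 z w := by
  unfold stepR
  split_ifs
  exacts [H.prob0.1 _, H.prob.1 _]

lemma summable_stepR_mul_exp (H : Assumptions d μ μ0) {M : ℝ} (hM : 0 ≤ M) (z z0 : St d) :
    Summable fun w => stepR d μ μ0 z w * Real.exp (M * ‖toR d (toZ d w - toZ d z0)‖) := by
  have main : ∀ ν : Zd d → ℝ, (∀ x, 0 ≤ ν x) →
      (∀ a : Rd d, Summable fun x => ν x * Real.exp (dotZ d a x)) →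
      Summable fun w : St d =>
        ν (toZ d w - toZ d z) * Real.exp (M * ‖toR d (toZ d w - toZ d z0)‖) := by
    intro ν hν hs
    have h1 := ((summable_mul_exp_norm hν hs 0 M).comp_injective
      (toZ_sub_injective (d := d) z)).mul_right (Real.exp (M * ‖toR d (toZ d z - toZ d z0)‖))
    refine Summable.of_nonneg_of_le (fun w => mul_nonneg (hν _) (Real.exp_pos _).le)
      (fun w => ?_) h1
    simp only [Function.comp, dotZ_zero_left, Real.exp_zero, mul_one]
    rw [mul_assoc, ← Real.exp_add, ← mul_add]
    refine mul_le_mul_of_nonneg_left (Real.exp_le_exp.2 (mul_le_mul_of_nonneg_left ?_ hM)) (hν _)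
    rw [← sub_add_sub_cancel (toZ d w) (toZ d z) (toZ d z0)]
    exact norm_toR_add_le _ _
  unfold stepR
  split_ifs
  · exact main μ0 H.prob0.1 H.summable0
  · exact main μ H.prob.1 H.summable

lemma toReal_kerGreen_eq (H : Assumptions d μ μ0) {z z' : St d} (h : z ≠ z') :
    (kerGreen (step d μ μ0) z z').toReal =
      ∑' w, stepR d μ μ0 z w * (kerGreen (step d μ μ0) w z').toReal := by
  rw [kerGreen_eq, if_neg h, zero_add, ENNReal.tsum_toReal_eq fun w => ?_]
  · congr with w
    rw [ENNReal.toReal_mul, step_eq_ofReal_stepR, ENNReal.toReal_ofReal (stepR_nonneg H z w)]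
  · rw [step_eq_ofReal_stepR]
    exact ENNReal.mul_ne_top ENNReal.ofReal_ne_top (kerGreen_ne_top H w z')

lemma martinLimit_harmonic (H : Assumptions d μ μ0) (z0 : St d) {zn : ℕ → St d} {l : Filter ℕ}
    [l.NeBot] (hnorm : Tendsto (fun n => ‖toR d (toZ d (zn n))‖) l atTop)
    {K : St d → ℝ} (hK : ∀ z, Tendsto (fun n => martinRatio d μ μ0 z0 z (zn n)) l (nhds (K z)))
    (z : St d) : HasSum (fun w => stepR d μ μ0 z w * K w) (K z) := by
  obtain ⟨M, hM, hbd⟩ := exists_martinRatio_bounds H z0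
  have hs := summable_stepR_mul_exp H hM z z0
  have h0 : ∀ w, 0 ≤ K w := fun w =>
    ge_of_tendsto' (hK w) fun n => (martinRatio_pos H z0 w (zn n)).le
  have h1 := tendsto_tsum_of_dominated_convergence hs (𝓕 := l)
    (f := fun n w => stepR d μ μ0 z w * martinRatio d μ μ0 z0 w (zn n))
    (fun w => (hK w).const_mul (stepR d μ μ0 z w)) (Eventually.of_forall fun n w => by
      rw [Real.norm_of_nonneg (mul_nonneg (stepR_nonneg H z w) (martinRatio_pos H z0 w (zn n)).le)]
      exact mul_le_mul_of_nonneg_left (hbd w (zn n)).2 (stepR_nonneg H z w))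
  have h2 : (fun n => ∑' w, stepR d μ μ0 z w * martinRatio d μ μ0 z0 w (zn n)) =ᶠ[l]
      fun n => martinRatio d μ μ0 z0 z (zn n) := by
    filter_upwards [hnorm.eventually_gt_atTop ‖toR d (toZ d z)‖] with n hn
    have hz : z ≠ zn n := by
      rintro rfl
      exact lt_irrefl _ hn
    simp only [martinRatio, ← mul_div_assoc]
    rw [tsum_div_const, toReal_kerGreen_eq H hz]
  rw [tendsto_nhds_unique (hK z) (h1.congr' h2)]
  refine Summable.hasSum (Summable.of_nonneg_of_le
    (fun w => mul_nonneg (stepR_nonneg H z w) (h0 w)) (fun w => ?_) hs)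
  exact mul_le_mul_of_nonneg_left (le_of_tendsto' (hK w) fun n => (hbd w (zn n)).2)
    (stepR_nonneg H z w)

lemma martinLimit_pos (H : Assumptions d μ μ0) (z0 : St d) {zn : ℕ → St d} {l : Filter ℕ}
    [l.NeBot] {K : St d → ℝ}
    (hK : ∀ z, Tendsto (fun n => martinRatio d μ μ0 z0 z (zn n)) l (nhds (K z)))
    (z : St d) : 0 < K z := by
  obtain ⟨M, -, hbd⟩ := exists_martinRatio_bounds H z0
  exact (Real.exp_pos _).trans_le (ge_of_tendsto' (hK z) fun n => (hbd z (zn n)).1)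

end MartinLimitProperties

section RenewalSequences

/-- A nonnegative sequence which is an average of its forward translates is constant. -/
lemma eq_of_hasSum_translates {ω c : ℕ → ℝ} (hω : ∀ l, 0 ≤ ω l) (hω1 : 0 < ω 1)
    (hsum : HasSum ω 1) (hc : ∀ n, 0 ≤ c n) (h : ∀ n, HasSum (fun l => ω l * c (n + l)) (c n)) :
    ∀ n, c (n + 1) = c n := by
  have hstep : ∀ e : ℕ → ℝ, (∀ n, 0 ≤ e n) → (∀ n, HasSum (fun l => ω l * e (n + l)) (e n)) →
      ∀ n, e (n + 1) ≤ (ω 1)⁻¹ * e n := by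
    intro e he hE n
    rw [le_inv_mul_iff₀ hω1]
    exact le_hasSum (hE n) 1 fun l _ => mul_nonneg (hω l) (he _)
  set A : Set ℝ := {t | 0 ≤ t ∧ ∀ n, c (n + 1) ≤ t * c n} with hA
  have hAne : A.Nonempty := ⟨(ω 1)⁻¹, (inv_pos.2 hω1).le, hstep c hc h⟩
  have hAbdd : BddBelow A := ⟨0, fun t ht => ht.1⟩
  have hAcl : IsClosed A := by
    have h1 : A = {t | 0 ≤ t} ∩ ⋂ n, {t | c (n + 1) ≤ t * c n} := by
      ext t
      simp [hA]
    rw [h1]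
    exact (isClosed_le continuous_const continuous_id).inter (isClosed_iInter fun n =>
      isClosed_le continuous_const (continuous_id.mul continuous_const))
  set s := sInf A with hs
  obtain ⟨hs0, hsc⟩ : s ∈ A := hAcl.csInf_mem hAne hAbdd
  have hs1 : s ≤ 1 := by
    by_contra! hs1
    set e : ℕ → ℝ := fun n => s * c n - c (n + 1) with he
    have he0 : ∀ n, 0 ≤ e n := fun n => sub_nonneg.2 (hsc n)
    have hE : ∀ n, HasSum (fun l => ω l * e (n + l)) (e n) := by
      intro n
      have h1 := ((h n).mul_left s).sub (h (n + 1))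
      refine (congrArg (HasSum · _) (funext fun l => ?_)).mp h1
      simp only [he]
      rw [show n + 1 + l = n + l + 1 by ring]
      ring
    have heκ : ∀ l n, e (n + l) ≤ (ω 1)⁻¹ ^ l * e n := by
      intro l
      induction l with
      | zero => simp
      | succ l ih =>
        intro n
        rw [← add_assoc, pow_succ', mul_assoc]
        exact (hstep e he0 hE _).trans (mul_le_mul_of_nonneg_left (ih n) (inv_pos.2 hω1).le)
    have hlow : ∀ l, ∃ C : ℝ, 0 ≤ C ∧ ∀ n, s ^ l * c n - C * e n ≤ c (n + l) := by
      intro l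
      induction l with
      | zero => exact ⟨0, le_rfl, fun n => by simp⟩
      | succ l ih =>
        obtain ⟨C, hC, hCn⟩ := ih
        refine ⟨s * C + (ω 1)⁻¹ ^ l, by positivity, fun n => ?_⟩
        have h1 := mul_le_mul_of_nonneg_left (hCn n) hs0
        have h2 := heκ l n
        have h3 : e (n + l) = s * c (n + l) - c (n + (l + 1)) := rfl
        rw [pow_succ']
        linarith
    choose C hC0 hC using hlow
    obtain ⟨m, hm2, hm⟩ : ∃ m, 2 ≤ m ∧
        1 - ω 1 * (s - 1) < ∑ l ∈ Finset.range m, ω l := by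
      have h1 := hsum.tendsto_sum_nat.eventually_const_lt
        (show 1 - ω 1 * (s - 1) < 1 by nlinarith)
      exact ((eventually_ge_atTop 2).and h1).exists
    set Λ := ∑ l ∈ Finset.range m, ω l * s ^ l with hΛ
    have hΛ1 : 1 < Λ := by
      have h1 : ω 1 * s ^ 1 - ω 1 ≤ ∑ l ∈ Finset.range m, (ω l * s ^ l - ω l) :=
        Finset.single_le_sum (f := fun l => ω l * s ^ l - ω l) (fun l _ => by
          have := mul_le_mul_of_nonneg_left (one_le_pow₀ hs1.le : 1 ≤ s ^ l) (hω l)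
          linarith) (Finset.mem_range.2 hm2)
      rw [Finset.sum_sub_distrib, pow_one] at h1
      linarith
    set B := ∑ l ∈ Finset.range m, ω l * C l with hB
    have hB0 : 0 ≤ B := Finset.sum_nonneg fun l _ => mul_nonneg (hω l) (hC0 l)
    have hkey : ∀ n, (Λ - 1) * c n ≤ B * e n := by
      intro n
      have h1 : ∑ l ∈ Finset.range m, ω l * c (n + l) ≤ c n :=
        sum_le_hasSum _ (fun l _ => mul_nonneg (hω l) (hc _)) (h n)
      have h2 : ∑ l ∈ Finset.range m, ω l * (s ^ l * c n - C l * e n) ≤ c n :=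
        (Finset.sum_le_sum fun l _ => mul_le_mul_of_nonneg_left (hC l n) (hω l)).trans h1
      simp only [mul_sub, Finset.sum_sub_distrib, ← mul_assoc, ← Finset.sum_mul] at h2
      linarith
    have hmem : max 0 (s - (Λ - 1) / (B + 1)) ∈ A := by
      refine ⟨le_max_left _ _, fun n => le_trans ?_
        (mul_le_mul_of_nonneg_right (le_max_right _ _) (hc n))⟩
      have h1 : (Λ - 1) / (B + 1) * c n ≤ e n := by
        rw [div_mul_eq_mul_div, div_le_iff₀ (by positivity)]
        have := hkey n
        have := he0 n
        linarith
      simp only [he] at h1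
      linarith
    have h1 := csInf_le hAbdd hmem
    rw [← hs, le_max_iff] at h1
    have h2 : 0 < (Λ - 1) / (B + 1) := div_pos (by linarith) (by positivity)
    rcases h1 with h1 | h1 <;> linarith
  have hanti : Antitone c := antitone_nat_of_succ_le fun n =>
    (hsc n).trans (mul_le_of_le_one_left (hc n) hs1)
  intro n
  have h1 := (hsum.mul_right (c n)).sub (h n)
  rw [one_mul, sub_self] at h1
  have h2 : ∀ l, 0 ≤ ω l * c n - ω l * c (n + l) := fun l => by
    have := mul_le_mul_of_nonneg_left (hanti (Nat.le_add_right n l)) (hω l)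
    linarith
  have h3 := congrFun ((hasSum_zero_iff_of_nonneg h2).1 h1) 1
  simp only [Pi.zero_apply, ← mul_sub] at h3
  linarith [(mul_eq_zero.1 h3).resolve_left hω1.ne']

lemma hasSum_swap_of_nonneg {F : ℕ → ℕ → ℝ} (h0 : ∀ i j, 0 ≤ F i j) {G : ℕ → ℝ} {c : ℝ}
    (h1 : ∀ i, HasSum (F i) (G i)) (h2 : HasSum G c) :
    (∀ j, Summable fun i => F i j) ∧ HasSum (fun j => ∑' i, F i j) c := by
  have hs : Summable fun x : ℕ × ℕ => F x.1 x.2 := by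
    rw [summable_prod_of_nonneg fun x => h0 x.1 x.2]
    exact ⟨fun i => (h1 i).summable, by simpa only [(h1 _).tsum_eq] using h2.summable⟩
  have hsw : Summable fun x : ℕ × ℕ => F x.2 x.1 := hs.prod_symm
  have hfib : ∀ j, Summable fun i => F i j := fun j => hsw.prod_factor j
  refine ⟨hfib, ?_⟩
  have h3 : HasSum (fun x : ℕ × ℕ => F x.1 x.2) c := by
    have h4 := hs.hasSum.prod_fiberwise h1
    rw [h2.unique h4]
    exact hs.hasSum
  have h5 : HasSum (fun x : ℕ × ℕ => F x.2 x.1) c := by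
    rw [← (Equiv.prodComm ℕ ℕ).hasSum_iff] at h3
    exact h3
  exact h5.prod_fiberwise fun j => (hfib j).hasSum

lemma eq_geom_sum_add (f : ℕ → ℝ) (s : ℝ) (n i : ℕ) :
    f (n + i) = s ^ i * f n +
      ∑ j ∈ Finset.range i, s ^ (i - 1 - j) * (f (n + j + 1) - s * f (n + j)) := by
  induction i with
  | zero => simp
  | succ i ih =>
    rw [Finset.sum_range_succ]
    have h1 : ∑ j ∈ Finset.range i, s ^ (i + 1 - 1 - j) * (f (n + j + 1) - s * f (n + j)) =
        s * ∑ j ∈ Finset.range i, s ^ (i - 1 - j) * (f (n + j + 1) - s * f (n + j)) := by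
      rw [Finset.mul_sum]
      refine Finset.sum_congr rfl fun j hj => ?_
      rw [← mul_assoc, ← pow_succ']
      congr 2
      have := Finset.mem_range.1 hj
      omega
    rw [h1]
    simp only [Nat.add_sub_cancel, Nat.sub_self, pow_zero, one_mul]
    rw [← add_assoc n i 1]
    linear_combination s * ih

/-- Solutions of a skip-free convolution equation growing at least like `s^n`, where `s` is one
root of the characteristic equation and `r` the other one. -/
lemma sub_mul_eq_of_hasSum {p f : ℕ → ℝ} {r s : ℝ} (hr : 0 < r) (hs : 0 < s)
    (hp : ∀ i, 0 ≤ p i) (hp2 : ∃ i, 2 ≤ i ∧ 0 < p i) (hroot : HasSum (fun i => p i * s ^ i) s)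
    (hgeom : HasSum (fun i => p i * ∑ j ∈ Finset.range i, r ^ j * s ^ (i - 1 - j)) 1)
    (hf : ∀ n, HasSum (fun i => p i * f (n + i)) (f (n + 1)))
    (hgrow : ∀ n, s * f n ≤ f (n + 1)) (n : ℕ) :
    f (n + 1) - s * f n = (f 1 - s * f 0) * r ^ n := by
  set g : ℕ → ℝ := fun n => f (n + 1) - s * f n with hg
  have hg0 : ∀ n, 0 ≤ g n := fun n => sub_nonneg.2 (hgrow n)
  set u : ℕ → ℕ → ℝ := fun i j => p i * if j < i then s ^ (i - 1 - j) else 0 with hu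
  have hu0 : ∀ i j, 0 ≤ u i j := fun i j => mul_nonneg (hp i) (by split_ifs <;> positivity)
  have hrow : ∀ (x : ℕ → ℝ) (i : ℕ), HasSum (fun j => u i j * x j)
      (p i * ∑ j ∈ Finset.range i, x j * s ^ (i - 1 - j)) := by
    intro x i
    rw [Finset.mul_sum]
    have h1 : HasSum (fun j => u i j * x j) (∑ j ∈ Finset.range i, u i j * x j) :=
      hasSum_sum_of_ne_finset_zero fun j hj => by simp [hu, Finset.mem_range.not.1 hj]
    refine (congrArg (HasSum _ ·) (Finset.sum_congr rfl fun j hj => ?_)).mp h1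
    simp only [hu, Finset.mem_range.1 hj, if_true]
    ring
  have hgn : ∀ n, HasSum (fun i => p i * ∑ j ∈ Finset.range i, g (n + j) * s ^ (i - 1 - j))
      (g n) := by
    intro n
    have h1 := (hf n).sub (hroot.mul_right (f n))
    refine (congrArg (HasSum · _) (funext fun i => ?_)).mp h1
    rw [eq_geom_sum_add f s n i]
    simp only [hg, mul_comm _ (s ^ (_ - 1 - _))]
    ring
  obtain ⟨hsum1, hω⟩ := hasSum_swap_of_nonneg (fun i j => mul_nonneg (hu0 i j)
    (pow_nonneg hr.le j)) (hrow fun j => r ^ j) hgeom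
  set ω : ℕ → ℝ := fun j => ∑' i, u i j * r ^ j with hωdef
  have hω1 : 0 < ω 1 := by
    obtain ⟨i, hi, hpi⟩ := hp2
    refine (hsum1 1).tsum_pos (fun i => mul_nonneg (hu0 i 1) (pow_nonneg hr.le 1)) i ?_
    have h1 : 1 < i := hi
    simp only [hu, h1, if_true]
    positivity
  have hconst := eq_of_hasSum_translates (ω := ω) (c := fun n => g n / r ^ n)
    (fun l => tsum_nonneg fun i => mul_nonneg (hu0 i l) (pow_nonneg hr.le l)) hω1 hω
    (fun n => div_nonneg (hg0 n) (pow_nonneg hr.le n)) (fun n => by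
      have h1 := (hasSum_swap_of_nonneg (fun i j => mul_nonneg (hu0 i j) (hg0 (n + j)))
        (hrow fun j => g (n + j)) (hgn n)).2.div_const (r ^ n)
      refine (congrArg (HasSum · _) (funext fun l => ?_)).mp h1
      simp only [hωdef]
      rw [tsum_mul_right, tsum_mul_right, pow_add]
      have := pow_pos hr n
      have := pow_pos hr l
      field_simp)
  have h1 : ∀ n, g n / r ^ n = g 0 := by
    intro n
    induction n with
    | zero => simp
    | succ n ih => rw [hconst n, ih]
  have h2 := h1 n
  rw [div_eq_iff (pow_pos hr n).ne'] at h2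
  simpa [hg] using h2

lemma eq_add_of_sub_mul_eq {f : ℕ → ℝ} {r s B : ℝ} (hrs : r ≠ s)
    (h : ∀ n, f (n + 1) - s * f n = B * r ^ n) (n : ℕ) :
    f n = B / (r - s) * r ^ n + (f 0 - B / (r - s)) * s ^ n := by
  have hne : r - s ≠ 0 := sub_ne_zero.2 hrs
  induction n with
  | zero => simp
  | succ n ih =>
    have h1 : B = B / (r - s) * (r - s) := by field_simp
    have h2 := h n
    rw [pow_succ, pow_succ]
    linear_combination h2 + s * ih + r ^ n * h1

lemma eq_add_mul_of_sub_mul_eq {f : ℕ → ℝ} {r B : ℝ} (hr : r ≠ 0)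
    (h : ∀ n, f (n + 1) - r * f n = B * r ^ n) (n : ℕ) :
    f n = (f 0 + n * (B / r)) * r ^ n := by
  induction n with
  | zero => simp
  | succ n ih =>
    have h1 : B = B / r * r := by field_simp
    have h2 := h n
    rw [pow_succ]
    push_cast
    linear_combination h2 + r * ih + r ^ n * h1

end RenewalSequences

section Classification

variable {d : ℕ} {μ μ0 : Zd d → ℝ}

/-- The vertical jump weights `∑ₓ μ(x, i - 1) e^{a·(x,0)}` of the tilted walk. -/
noncomputable def colWeight (d : ℕ) (μ : Zd d → ℝ) (a : Rd d) (i : ℕ) : ℝ :=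
  ∑' x : Fin (d - 1) → ℤ, μ (x, (i : ℤ) - 1) * Real.exp (dotZ d a (x, 0))

lemma dotZ_eq_fst_add (a : Rd d) (w : Zd d) : dotZ d a w = dotZ d a (w.1, 0) + a.2 * w.2 := by
  simp [dotZ]

lemma dotZ_congr_fst {a b : Rd d} (h : b.1 = a.1) (k : Fin (d - 1) → ℤ) :
    dotZ d b (k, 0) = dotZ d a (k, 0) := by
  simp [dotZ, h]

lemma hasSum_colWeight (H : Assumptions d μ μ0) (a : Rd d) {F : ℤ → ℝ} {c : ℝ}
    (h : HasSum (fun w : Zd d => μ w * Real.exp (dotZ d a (w.1, 0)) * F w.2) c) :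
    HasSum (fun i : ℕ => colWeight d μ a i * F ((i : ℤ) - 1)) c := by
  have h1 : HasSum (fun w : ℤ × (Fin (d - 1) → ℤ) =>
      μ (w.2, w.1) * Real.exp (dotZ d a (w.2, 0)) * F w.1) c := by
    rw [← (Equiv.prodComm ℤ (Fin (d - 1) → ℤ)).hasSum_iff] at h
    exact h
  have h2 := h1.prod_fiberwise fun y => (h1.summable.prod_factor y).hasSum
  have hinj : Function.Injective fun i : ℕ => (i : ℤ) - 1 := fun i j hij => by
    have : (i : ℤ) - 1 = (j : ℤ) - 1 := hij
    omega
  rw [← hinj.hasSum_iff] at h2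
  · refine (congrArg (HasSum · _) (funext fun i => ?_)).mp h2
    simp only [Function.comp, colWeight]
    rw [tsum_mul_right]
  · intro y hy
    have hy1 : y < -1 := by
      by_contra! hy1
      exact hy ⟨(y + 1).toNat, by
        simp only
        omega⟩
    simp [H.h0.1 (_, y) hy1]

lemma summable_col (H : Assumptions d μ μ0) (a : Rd d) (y : ℤ) :
    Summable fun x : Fin (d - 1) → ℤ => μ (x, y) * Real.exp (dotZ d a (x, 0)) := by
  have h1 := (H.summable a).prod_symm.prod_factor y
  refine (h1.mul_right (Real.exp (-(a.2 * y)))).congr fun x => ?_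
  simp only [Prod.swap]
  rw [dotZ_eq_fst_add a (x, y), mul_assoc, ← Real.exp_add]
  congr 2
  ring

lemma colWeight_nonneg (H : Assumptions d μ μ0) (a : Rd d) (i : ℕ) : 0 ≤ colWeight d μ a i :=
  tsum_nonneg fun _ => mul_nonneg (H.prob.1 _) (Real.exp_pos _).le

lemma exists_colWeight_pos (H : Assumptions d μ μ0) (a : Rd d) :
    ∃ i, 2 ≤ i ∧ 0 < colWeight d μ a i := by
  obtain ⟨w, hw, hw2⟩ := H.exists_pos
  refine ⟨(w.2 + 1).toNat, by omega, (summable_col H a _).tsum_pos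
    (fun _ => mul_nonneg (H.prob.1 _) (Real.exp_pos _).le) w.1 ?_⟩
  have h1 : (((w.2 + 1).toNat : ℕ) : ℤ) - 1 = w.2 := by omega
  rw [h1]
  exact mul_pos hw (Real.exp_pos _)

lemma exp_mul_natCast_sub_one (t : ℝ) (i : ℕ) :
    Real.exp (t * (((i : ℤ) - 1 : ℤ) : ℝ)) * Real.exp t = Real.exp t ^ i := by
  rw [← Real.exp_add, ← Real.exp_nat_mul]
  congr 1
  push_cast
  ring

lemma hasSum_colWeight_mul_pow (H : Assumptions d μ μ0) {a b : Rd d} (hab : b.1 = a.1)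
    (hb : jgf d μ b = 1) :
    HasSum (fun i => colWeight d μ a i * Real.exp b.2 ^ i) (Real.exp b.2) := by
  have h1 : HasSum (fun w : Zd d => μ w * Real.exp (dotZ d b w)) 1 := by
    rw [← hb]
    exact (H.summable b).hasSum
  have h2 := (hasSum_colWeight H a (F := fun y => Real.exp (b.2 * y)) (c := 1)
    ((congrArg (HasSum · _) (funext fun w => by
      rw [dotZ_eq_fst_add b w, dotZ_congr_fst hab, Real.exp_add, mul_assoc])).mp h1)).mul_right
    (Real.exp b.2)
  rw [one_mul] at h2
  refine (congrArg (HasSum · _) (funext fun i => ?_)).mp h2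
  rw [mul_assoc, exp_mul_natCast_sub_one]

lemma hasSum_colWeight_mul_pow_deriv (H : Assumptions d μ μ0) {a : Rd d}
    (ha : jgf d μ a = 1) (ha0 : jgfDβ d μ a = 0) :
    HasSum (fun i => colWeight d μ a i * (i * Real.exp a.2 ^ i)) (Real.exp a.2) := by
  have h1 : HasSum (fun w : Zd d => μ w * w.2 * Real.exp (dotZ d a w)) 0 := by
    rw [← ha0]
    exact (summable_mul_snd H.prob.1 H.summable a).hasSum
  have h2 := (hasSum_colWeight H a (F := fun y => y * Real.exp (a.2 * y)) (c := 0)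
    ((congrArg (HasSum · _) (funext fun w => by
      rw [dotZ_eq_fst_add a w, Real.exp_add]
      ring)).mp h1)).mul_right (Real.exp a.2)
  have h3 := h2.add (hasSum_colWeight_mul_pow H rfl ha)
  rw [zero_mul, zero_add] at h3
  refine (congrArg (HasSum · _) (funext fun i => ?_)).mp h3
  rw [mul_assoc, mul_assoc, exp_mul_natCast_sub_one]
  push_cast
  ring

lemma hasSum_colWeight_geom (H : Assumptions d μ μ0) {a b : Rd d} (ha : a ∈ bdPlus d μ)
    (hb : b ∈ bdMinus d μ) (hab : b.1 = a.1) :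
    HasSum (fun i => colWeight d μ a i *
      ∑ j ∈ Finset.range i, Real.exp a.2 ^ j * Real.exp b.2 ^ (i - 1 - j)) 1 := by
  by_cases hrs : a = b
  · subst hrs
    have h1 := (hasSum_colWeight_mul_pow_deriv H ha.1 (le_antisymm hb.2 ha.2)).div_const
      (Real.exp a.2)
    rw [div_self (Real.exp_pos _).ne'] at h1
    refine (congrArg (HasSum · _) (funext fun i => ?_)).mp h1
    rw [mul_div_assoc]
    congr 1
    rw [Finset.sum_congr rfl (g := fun _ => Real.exp a.2 ^ (i - 1)) fun j hj => by
      rw [← pow_add]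
      congr 1
      have := Finset.mem_range.1 hj
      omega]
    rw [Finset.sum_const, Finset.card_range, nsmul_eq_mul, mul_div_assoc]
    rcases i with _ | i
    · simp
    · congr 1
      rw [pow_succ, Nat.add_sub_cancel, mul_div_cancel_right₀ _ (Real.exp_pos _).ne']
  · have hne : Real.exp a.2 - Real.exp b.2 ≠ 0 := fun h =>
      hrs (Prod.ext hab.symm (Real.exp_injective (sub_eq_zero.1 h)))
    have h1 := ((hasSum_colWeight_mul_pow H rfl ha.1).sub
      (hasSum_colWeight_mul_pow H hab hb.1)).div_const (Real.exp a.2 - Real.exp b.2)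
    rw [div_self hne] at h1
    refine (congrArg (HasSum · _) (funext fun i => ?_)).mp h1
    rw [← mul_sub, mul_div_assoc, ← geom_sum₂_mul, mul_div_cancel_right₀ _ hne]

/-- Positive harmonic functions which are multiplied by `e^{a·k}` under shifts along the
boundary. -/
structure IsEquivariantHarmonic (d : ℕ) (μ μ0 : Zd d → ℝ) (a : Rd d) (K : St d → ℝ) : Prop where
  pos : ∀ z, 0 < K z
  shift : ∀ k z, K (shiftSt d k z) = Real.exp (dotZ d a (k, 0)) * K z
  harmonic : IsHarmonic d μ μ0 K

namespace IsEquivariantHarmonic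

variable {a b : Rd d} {K : St d → ℝ}

lemma eq_mul (hK : IsEquivariantHarmonic d μ μ0 a K) (z : St d) :
    K z = Real.exp (dotZ d a (z.1, 0)) * K (0, z.2) := by
  rw [← hK.shift z.1 (0, z.2)]
  simp [shiftSt]

lemma hasSum_jump (hK : IsEquivariantHarmonic d μ μ0 a K) (H : Assumptions d μ μ0) (n : ℕ) :
    HasSum (fun w : Zd d => (if n = 0 then μ0 else μ) w *
      (Real.exp (dotZ d a (w.1, 0)) * K (0, (w.2 + n).toNat))) (K (0, n)) := by
  have h1 := hK.harmonic (0, n)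
  rw [← hasSum_toZ_sub d (0, n)]
  · refine (congrArg (HasSum · _) (funext fun z => ?_)).mp h1
    rw [hK.eq_mul z, stepR]
    have h2 : (toZ d z - toZ d (0, n)).1 = z.1 := by simp [toZ]
    have h3 : ((toZ d z - toZ d (0, n)).2 + (n : ℤ)).toNat = z.2 := by simp [toZ]
    rw [h2, h3]
    simp only
    split_ifs <;> rfl
  · intro w hw
    simp only at hw
    split_ifs with hn
    · rw [H.h0.2 w (by omega), zero_mul]
    · rw [H.h0.1 w (by omega), zero_mul]

lemma hasSum_interior (hK : IsEquivariantHarmonic d μ μ0 a K) (H : Assumptions d μ μ0) (n : ℕ) :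
    HasSum (fun i => colWeight d μ a i * K (0, n + i)) (K (0, n + 1)) := by
  have h1 := hK.hasSum_jump H (n + 1)
  simp only [Nat.succ_ne_zero, if_false, ← mul_assoc] at h1
  refine (congrArg (HasSum · _) (funext fun i => ?_)).mp (hasSum_colWeight H a
    (F := fun y => K (0, (y + ((n + 1 : ℕ) : ℤ)).toNat)) h1)
  have h2 : ((i : ℤ) - 1 + ((n + 1 : ℕ) : ℤ)).toNat = n + i := by omega
  simp only [h2]

lemma growth (hK : IsEquivariantHarmonic d μ μ0 a K) (H : Assumptions d μ μ0)
    (hb : b ∈ bdMinus d μ) (hab : b.1 = a.1) (n : ℕ) :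
    Real.exp b.2 * K (0, n) ≤ K (0, n + 1) := by
  obtain ⟨t, ht, -, hgrow⟩ := exists_rate_of_superharmonic H a
    (U := fun z => ENNReal.ofReal (K z)) (fun z => ENNReal.ofReal_pos.2 (hK.pos z))
    (fun z => ENNReal.ofReal_ne_top) (fun k z => by
      rw [hK.shift, ENNReal.ofReal_mul (Real.exp_pos _).le]) (fun z => by
      change _ ≤ ENNReal.ofReal (K z)
      rw [kerOp_apply, ← (hK.harmonic z).tsum_eq, ENNReal.ofReal_tsum_of_nonneg
        (fun w => mul_nonneg (stepR_nonneg H z w) (hK.pos w).le) (hK.harmonic z).summable]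
      refine ENNReal.tsum_le_tsum fun w => ?_
      rw [step_eq_ofReal_stepR, ENNReal.ofReal_mul (stepR_nonneg H z w)])
  have h1 : b.2 ≤ t := le_of_jgf_le_one H hb (hab ▸ ht)
  have h2 := hgrow 0 n
  rw [← ENNReal.ofReal_mul (Real.exp_pos _).le, ENNReal.ofReal_le_ofReal_iff (hK.pos _).le] at h2
  exact (mul_le_mul_of_nonneg_right (Real.exp_le_exp.2 h1) (hK.pos _).le).trans h2

lemma sub_mul_eq (hK : IsEquivariantHarmonic d μ μ0 a K) (H : Assumptions d μ μ0)
    (ha : a ∈ bdPlus d μ) (hb : b ∈ bdMinus d μ) (hab : b.1 = a.1) (n : ℕ) :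
    K (0, n + 1) - Real.exp b.2 * K (0, n) =
      (K (0, 1) - Real.exp b.2 * K (0, 0)) * Real.exp a.2 ^ n :=
  sub_mul_eq_of_hasSum (f := fun n => K (0, n)) (Real.exp_pos _) (Real.exp_pos _)
    (colWeight_nonneg H a) (exists_colWeight_pos H a) (hasSum_colWeight_mul_pow H hab hb.1)
    (hasSum_colWeight_geom H ha hb hab) (hK.hasSum_interior H) (hK.growth H hb hab) n

lemma exp_dotZ_toZ (hab : b.1 = a.1) (z : St d) :
    Real.exp (dotZ d b (toZ d z)) = Real.exp (dotZ d a (z.1, 0)) * Real.exp b.2 ^ z.2 := by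
  rw [dotZ_eq_fst_add, Real.exp_add, ← Real.exp_nat_mul]
  simp only [toZ, Int.cast_natCast]
  rw [dotZ_congr_fst hab, mul_comm b.2]

lemma hasSum_boundary (hK : IsEquivariantHarmonic d μ μ0 a K) (H : Assumptions d μ μ0)
    {F : ℤ → Zd d → ℝ} (hF : ∀ z : St d, K z = F z.2 (toZ d z)) :
    HasSum (fun w : Zd d => μ0 w * F w.2 w) (F 0 0) := by
  have h1 := hK.hasSum_jump H 0
  have h2 : K (0, 0) = F 0 0 := hF (0, 0)
  rw [h2] at h1
  refine (congrArg (HasSum · _) (funext fun w => ?_)).mp h1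
  simp only [if_true]
  by_cases hw : w.2 < 0
  · simp [H.h0.2 w hw]
  · have h3 := hF (w.1, w.2.toNat)
    have h4 : toZ d (w.1, w.2.toNat) = w := by
      ext
      · rfl
      · simp only [toZ]
        omega
    have h5 : ((w.2.toNat : ℕ) : ℤ) = w.2 := by omega
    rw [hK.eq_mul, h4] at h3
    simp only [h5] at h3
    rw [← h3]
    simp

lemma exists_eq_const_mul (hK : IsEquivariantHarmonic d μ μ0 a K) (H : Assumptions d μ μ0)
    (ha : a ∈ bdPlus d μ) (hb : b ∈ bdMinus d μ) (hab : b.1 = a.1) :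
    ∃ c : ℝ, ∀ z, K z = c * hfun d μ μ0 a b z := by
  have hsub := hK.sub_mul_eq H ha hb hab
  set B := K (0, 1) - Real.exp b.2 * K (0, 0) with hB
  by_cases hrs : a = b
  · subst hrs
    have hsol := eq_add_mul_of_sub_mul_eq (f := fun n => K (0, n)) (Real.exp_pos a.2).ne' hsub
    set B' := B / Real.exp a.2 with hB'
    set A := K (0, 0) with hA
    have hKz : ∀ z : St d, K z = (A + z.2 * B') * Real.exp (dotZ d a (toZ d z)) := by
      intro z
      rw [hK.eq_mul z, exp_dotZ_toZ rfl]
      have h1 := hsol z.2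
      rw [h1]
      ring
    have h1 := hK.hasSum_boundary H (F := fun y w => (A + y * B') * Real.exp (dotZ d a w))
      (by simpa using hKz)
    have h2 := ((H.summable0 a).hasSum.mul_left A).add
      ((summable_mul_snd H.prob0.1 H.summable0 a).hasSum.mul_left B')
    have h3 := h1.unique ((congrArg (HasSum · _) (funext fun w => by ring)).mp h2)
    change _ = A * jgf d μ0 a + B' * jgfDβ d μ0 a at h3
    simp only [dotZ_zero_right, Real.exp_zero, Int.cast_zero, zero_mul, add_zero, mul_one] at h3
    have hD := jgfDβ0_pos H a
    by_cases h0 : jgf d μ0 a = 1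
    · rw [h0, mul_one] at h3
      have h4 : B' = 0 := by
        have : B' * jgfDβ d μ0 a = 0 := by linarith
        exact (mul_eq_zero.1 this).resolve_right hD.ne'
      refine ⟨A, fun z => ?_⟩
      rw [hKz z, h4, hfun, if_pos h0]
      ring
    · have h4 : 1 - jgf d μ0 a ≠ 0 := fun h => h0 (by linarith)
      refine ⟨B', fun z => ?_⟩
      have h5 : A = B' * (jgfDβ d μ0 a / (1 - jgf d μ0 a)) := by
        field_simp
        linarith
      rw [hKz z, hfun, if_neg h0, if_pos rfl, h5]
      ring
  · have hne : Real.exp a.2 ≠ Real.exp b.2 := fun h =>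
      hrs (Prod.ext hab.symm (Real.exp_injective h))
    have hsol := eq_add_of_sub_mul_eq (f := fun n => K (0, n)) hne hsub
    set A := B / (Real.exp a.2 - Real.exp b.2) with hA
    set A' := K (0, 0) - A with hA'
    have hKz : ∀ z : St d, K z = A * Real.exp (dotZ d a (toZ d z)) +
        A' * Real.exp (dotZ d b (toZ d z)) := by
      intro z
      rw [hK.eq_mul z, exp_dotZ_toZ rfl, exp_dotZ_toZ hab]
      have h1 := hsol z.2
      rw [h1]
      ring
    have h1 := hK.hasSum_boundary H
      (F := fun _ w => A * Real.exp (dotZ d a w) + A' * Real.exp (dotZ d b w)) hKz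
    have h2 := ((H.summable0 a).hasSum.mul_left A).add ((H.summable0 b).hasSum.mul_left A')
    have h3 := h1.unique ((congrArg (HasSum · _) (funext fun w => by ring)).mp h2)
    change _ = A * jgf d μ0 a + A' * jgf d μ0 b at h3
    simp only [dotZ_zero_right, Real.exp_zero, mul_one] at h3
    by_cases h0 : jgf d μ0 b = 1
    · have hlt : b.2 < a.2 := lt_of_le_of_ne (le_of_jgf_le_one H hb (by rw [hab]; exact ha.1.le))
        fun h => hrs (Prod.ext hab.symm h.symm)
      have h4 : jgf d μ0 b < jgf d μ0 a := by
        have h5 : jgf d μ0 (a.1, b.2) < jgf d μ0 a := jgf_mono0 H a.1 hlt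
        have h6 : b = (a.1, b.2) := Prod.ext hab rfl
        rwa [← h6] at h5
      have h6 : A = 0 := by
        have : A * (jgf d μ0 a - 1) = 0 := by rw [h0] at h3; linarith
        exact (mul_eq_zero.1 this).resolve_right (by linarith)
      refine ⟨A', fun z => ?_⟩
      rw [hKz z, h6, hfun, if_pos h0]
      ring
    · have h4 : 1 - jgf d μ0 b ≠ 0 := fun h => h0 (by linarith)
      have h5 : A' = -A * ((1 - jgf d μ0 a) / (1 - jgf d μ0 b)) := by
        field_simp
        linarith
      refine ⟨A, fun z => ?_⟩
      rw [hKz z, hfun, if_neg h0, if_neg hrs, h5]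
      ring

lemma eq_div (hK : IsEquivariantHarmonic d μ μ0 a K) (H : Assumptions d μ μ0)
    (ha : a ∈ bdPlus d μ) (hb : b ∈ bdMinus d μ) (hab : b.1 = a.1) {z0 : St d}
    (hz0 : K z0 = 1) (z : St d) :
    K z = hfun d μ μ0 a b z / hfun d μ μ0 a b z0 := by
  obtain ⟨c, hc⟩ := hK.exists_eq_const_mul H ha hb hab
  have h1 : c * hfun d μ μ0 a b z0 = 1 := by rw [← hc, hz0]
  rw [eq_div_iff (right_ne_zero_of_mul_eq_one h1), hc z]
  linear_combination hfun d μ μ0 a b z * h1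

end IsEquivariantHarmonic

end Classification

section Convergence

variable {d : ℕ} {μ μ0 : Zd d → ℝ}

lemma isClosed_normalCone (s : Set (Rd d)) (a : Rd d) : IsClosed (normalCone d s a) := by
  simp only [normalCone, Set.ofPred_forall]
  refine isClosed_biInter fun b _ => isClosed_le ?_ continuous_const
  unfold dotR
  fun_prop

lemma zero_mem_normalCone (s : Set (Rd d)) (a : Rd d) : (0 : Rd d) ∈ normalCone d s a := by
  intro b _
  simp [dotR]

lemma exists_tendsto_unit_mem {C : Set (Rd d)} (hC : IsClosed C) (hne : C.Nonempty)
    {u : ℕ → Rd d} (hdir : Tendsto (fun n => Metric.infDist (‖u n‖⁻¹ • u n) C) atTop (nhds 0))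
    (U : Ultrafilter ℕ) (hU : (U : Filter ℕ) ≤ atTop) :
    ∃ q ∈ C, Tendsto (fun n => ‖u n‖⁻¹ • u n) U (nhds q) := by
  have hball : ∀ n, ‖u n‖⁻¹ • u n ∈ Metric.closedBall (0 : Rd d) 1 := fun n => by
    rw [mem_closedBall_zero_iff, norm_smul, norm_inv, norm_norm]
    exact inv_mul_le_one
  obtain ⟨q, -, hq⟩ := (isCompact_closedBall (0 : Rd d) 1).ultrafilter_le_nhds
    (U.map fun n => ‖u n‖⁻¹ • u n) (tendsto_principal.2 (Eventually.of_forall hball))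
  refine ⟨q, ?_, hq⟩
  rw [hC.mem_iff_infDist_zero hne]
  exact tendsto_nhds_unique (((Metric.continuous_infDist_pt C).tendsto q).comp hq)
    (hdir.mono_left hU)

lemma exists_martinRatio_limit (H : Assumptions d μ μ0) (z0 : St d) (zn : ℕ → St d)
    (U : Ultrafilter ℕ) :
    ∃ K : St d → ℝ, ∀ z, Tendsto (fun n => martinRatio d μ μ0 z0 z (zn n)) U (nhds (K z)) := by
  obtain ⟨M, -, hM⟩ := exists_martinRatio_bounds H z0
  suffices h : ∀ z, ∃ k, Tendsto (fun n => martinRatio d μ μ0 z0 z (zn n)) U (nhds k) by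
    choose K hK using h
    exact ⟨K, hK⟩
  intro z
  obtain ⟨k, -, hk⟩ := isCompact_Icc.ultrafilter_le_nhds
    (U.map fun n => martinRatio d μ μ0 z0 z (zn n))
    (tendsto_principal.2 (Eventually.of_forall fun n => hM z (zn n)))
  exact ⟨k, hk⟩

end Convergence

/-- convergence of the Martin kernels along sequences whose directions
approach the normal cone `V(a)`, `a ∈ D̂ ∩ ∂₊D`. -/
theorem martin_kernel_convergence
    (d : ℕ) (hd : 2 ≤ d) (μ μ0 : Zd d → ℝ)
    (hμ : IsProb d μ) (hμ0 : IsProb d μ0)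
    (hH0 : H0 d μ μ0) (hH1 : H1 d μ μ0) (hH2 : H2 d μ)
    (hH3 : H3 d μ μ0) (hH4 : H4 d μ μ0)
    (a abar : Rd d) (ha : a ∈ Dhat d μ μ0 ∩ bdPlus d μ)
    (habar : abar ∈ bdMinus d μ ∧ abar.1 = a.1)
    (z0 : St d) (zn : ℕ → St d)
    (hnorm : Tendsto (fun n => ‖toR d (toZ d (zn n))‖) atTop atTop)
    (hdir : Tendsto (fun n =>
        Metric.infDist ((‖toR d (toZ d (zn n))‖)⁻¹ • toR d (toZ d (zn n)))
          (normalCone d (Dhat d μ μ0) a)) atTop (nhds 0)) :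
    ∀ z : St d,
      Tendsto (fun n =>
          (green d μ μ0 z (zn n)).toReal / (green d μ μ0 z0 (zn n)).toReal)
        atTop (nhds (hfun d μ μ0 a abar z / hfun d μ μ0 a abar z0)) := by
  intro z
  have H : Assumptions d μ μ0 := ⟨hd, hμ, hμ0, hH0, hH1, hH2, hH3, hH4⟩
  obtain ⟨⟨hT, -⟩, ha⟩ := ha
  obtain ⟨hb, hab⟩ := habar
  have hb0 : jgf d μ0 abar ≤ 1 := jgf0_le_one_of_mem_Theta H hb (hab ▸ hT)
  change Tendsto (fun n => martinRatio d μ μ0 z0 z (zn n)) atTop _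
  rw [tendsto_iff_ultrafilter]
  intro U hU
  obtain ⟨q, hq, hlim⟩ := exists_tendsto_unit_mem (isClosed_normalCone _ _)
    ⟨0, zero_mem_normalCone _ _⟩ hdir U hU
  obtain ⟨K, hK⟩ := exists_martinRatio_limit H z0 zn U
  have hnormU := hnorm.mono_left hU
  have hKeq : IsEquivariantHarmonic d μ μ0 a K :=
    { pos := martinLimit_pos H z0 hK
      shift := martinLimit_shift H hab ha.1.le hb.1.le hb0 hq z0 hnormU hlim hK
      harmonic := martinLimit_harmonic H z0 hnormU hK }
  have hK0 : K z0 = 1 := by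
    refine tendsto_nhds_unique (hK z0) ?_
    simp only [martinRatio, div_self (toReal_kerGreen_pos H z0 _).ne']
    exact tendsto_const_nhds
  rw [← hKeq.eq_div H ha hb hab hK0 z]
  exact hK z

end ReflectedRW
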